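/- Let Γ be a finite connected triangle-free simplicial graph with at least two edges. Let Sym(Γ) ≤ Aut(A_Γ) be the subgroup of automorphisms induced by graph symmetries of Γ, let Sym⁰(Γ) = Sym(Γ) ∩ Aut⁰(A_Γ), and let Q(Γ) = Sym(Γ)/Sym⁰(Γ), which is naturally isomorphic to Aut(A_Γ)/Aut⁰(A_Γ) and to Out(A_Γ)/Out⁰(A_Γ). Then the quotient maps from Aut(A_Γ), from Out(A_Γ), and from Sym(Γ) onto Q(Γ) all split, i.e., each admits a group-homomorphism section. -/

import Mathlib

noncomputable section

/-! ### Outer automorphism groups -/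

/-- The subgroup of inner automorphisms of `G` inside `MulAut G`. -/
def Inn (G : Type*) [Group G] : Subgroup (MulAut G) := (MulAut.conj : G →* MulAut G).range

instance Inn.normal (G : Type*) [Group G] : (Inn G).Normal := by
  constructor
  intro n hn φ
  obtain ⟨g, rfl⟩ := hn
  refine ⟨φ g, ?_⟩
  ext x
  simp [MulAut.conj_apply, MulAut.mul_apply, map_mul, map_inv, mul_assoc]

/-- The outer automorphism group of `G`. -/
abbrev Out (G : Type*) [Group G] := MulAut G ⧸ Inn G

/-! ### Right-angled Artin groups -/

variable {V : Type*}

/-- The commutator relations defining a right-angled Artin group. -/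
def raagRels (Γ : SimpleGraph V) : Set (FreeGroup V) :=
  {r | ∃ v w : V, Γ.Adj v w ∧
    r = FreeGroup.of v * FreeGroup.of w * (FreeGroup.of v)⁻¹ * (FreeGroup.of w)⁻¹}

/-- The right-angled Artin group associated to a simple graph. -/
abbrev RAAG (Γ : SimpleGraph V) := PresentedGroup (raagRels Γ)

/-- The generator of `RAAG Γ` corresponding to a vertex. -/
def raagGen (Γ : SimpleGraph V) (v : V) : RAAG Γ := PresentedGroup.of v

/-- The special subgroup generated by the vertices in `Θ`. -/
def SpecialSubgroup (Γ : SimpleGraph V) (Θ : Set V) : Subgroup (RAAG Γ) :=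
  Subgroup.closure (raagGen Γ '' Θ)

/-! ### Graph-theoretic notions -/

/-- The link of a vertex. -/
def lk (Γ : SimpleGraph V) (v : V) : Set V := Γ.neighborSet v

/-- The (closed) star of a vertex. -/
def starOf (Γ : SimpleGraph V) (v : V) : Set V := insert v (Γ.neighborSet v)

/-- `Θ⊥`: the intersection of the closed stars of the vertices of `Θ`. -/
def perp (Γ : SimpleGraph V) (Θ : Set V) : Set V := ⋂ v ∈ Θ, starOf Γ v

/-- A leaf is a vertex of valence one. -/
def IsLeaf (Γ : SimpleGraph V) (v : V) : Prop := ∃ w, Γ.neighborSet v = {w}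

/-- The vertex set of the maximal join `J_v = L_v * L_v⊥` associated to a vertex `v`. -/
def JoinOf (Γ : SimpleGraph V) (v : V) : Set V := lk Γ v ∪ perp Γ (lk Γ v)

/-- A vertex is cyclic if `L_v⊥ = {v}`. -/
def IsCyclicVertex (Γ : SimpleGraph V) (v : V) : Prop := perp Γ (lk Γ v) = {v}

/-- `C` is a connected component of the full subgraph of `Γ` spanned by `S`. -/
def IsComponentOf (Γ : SimpleGraph V) (S C : Set V) : Prop :=
  C ⊆ S ∧ C.Nonempty ∧ (Γ.induce C).Connected ∧
    ∀ x ∈ C, ∀ y ∈ S, Γ.Adj x y → y ∈ C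

/-- A separating vertex: `Γ − {v}` is disconnected. -/
def IsSeparating (Γ : SimpleGraph V) (v : V) : Prop :=
  Set.Nonempty ({v}ᶜ : Set V) ∧ ¬ (Γ.induce ({v}ᶜ : Set V)).Connected

/-- `δ_C(v)`: the number of connected components of `Γ − {v}`. -/
noncomputable def deltaC (Γ : SimpleGraph V) (v : V) : ℕ :=
  {C : Set V | IsComponentOf Γ ({v}ᶜ : Set V) C}.ncard

/-- `ℓ(v)`: the number of leaves adjacent to `v`. -/
noncomputable def nAdjLeaves (Γ : SimpleGraph V) (v : V) : ℕ :=
  {w : V | Γ.Adj v w ∧ IsLeaf Γ w}.ncard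

/-- A twig at `v`: a non-singleton component of `Γ − {v}` contained in the ball of
radius 2 about `v` (as a metric space, so every edge must have an endpoint adjacent
to `v`). -/
def IsTwigOf (Γ : SimpleGraph V) (v : V) (C : Set V) : Prop :=
  IsComponentOf Γ ({v}ᶜ : Set V) C ∧ (¬ ∃ w, C = {w}) ∧
  (∀ x ∈ C, Γ.dist v x ≤ 2) ∧
  ∀ x ∈ C, ∀ y ∈ C, Γ.Adj x y → (Γ.Adj v x ∨ Γ.Adj v y)

/-- `τ(v)`: the number of twigs at `v`. -/
noncomputable def nTwigs (Γ : SimpleGraph V) (v : V) : ℕ := {C : Set V | IsTwigOf Γ v C}.ncard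

/-- `Γ` is the star `{v} * W`. -/
def IsStarGraph (Γ : SimpleGraph V) (v : V) : Prop :=
  ∀ x y, Γ.Adj x y ↔ (x = v ∧ y ≠ v) ∨ (y = v ∧ x ≠ v)

/-- The link-equivalence class of `v` is maximal. -/
def HasMaximalLink (Γ : SimpleGraph V) (v : V) : Prop :=
  ∀ w, lk Γ v ⊆ lk Γ w → lk Γ w = lk Γ v

/-- `V0` is a set of representatives, one from each maximal link-equivalence class
(with the convention `V0 = {v}` when `Γ` is a star `{v} * W`). -/
def IsV0 (Γ : SimpleGraph V) (V0 : Set V) : Prop :=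
  (∃ v, IsStarGraph Γ v ∧ V0 = {v}) ∨
  ((¬ ∃ v, IsStarGraph Γ v) ∧
    (∀ v ∈ V0, HasMaximalLink Γ v) ∧
    (∀ v ∈ V0, ∀ w ∈ V0, lk Γ v = lk Γ w → v = w) ∧
    (∀ w, HasMaximalLink Γ w → ∃ v ∈ V0, lk Γ v = lk Γ w))

/-- A join `U * W` (as a full subgraph of `Γ`): a complete bipartite full subgraph. -/
def IsJoin (Γ : SimpleGraph V) (U W : Set V) : Prop :=
  U.Nonempty ∧ W.Nonempty ∧ Disjoint U W ∧
  (∀ u ∈ U, ∀ w ∈ W, Γ.Adj u w) ∧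
  (∀ u ∈ U, ∀ u' ∈ U, ¬ Γ.Adj u u') ∧
  (∀ w ∈ W, ∀ w' ∈ W, ¬ Γ.Adj w w')

/-- A maximal join: a join not properly contained in any other join subgraph. -/
def IsMaximalJoin (Γ : SimpleGraph V) (U W : Set V) : Prop :=
  IsJoin Γ U W ∧ ∀ U' W', IsJoin Γ U' W' → U ∪ W ⊆ U' ∪ W' → U ∪ W = U' ∪ W'

/-! ### Generating automorphisms and `Aut⁰`, `Out⁰` -/

/-- `φ` is the inversion at the vertex `v`. -/
def IsInversionAt (Γ : SimpleGraph V) (φ : MulAut (RAAG Γ)) (v : V) : Prop :=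
  φ (raagGen Γ v) = (raagGen Γ v)⁻¹ ∧ ∀ w, w ≠ v → φ (raagGen Γ w) = raagGen Γ w

/-- `φ` conjugates the generators in `C` by `v` and fixes all other generators. -/
def IsPartialConjBy (Γ : SimpleGraph V) (φ : MulAut (RAAG Γ)) (v : V) (C : Set V) : Prop :=
  (∀ x ∈ C, φ (raagGen Γ x) = (raagGen Γ v)⁻¹ * raagGen Γ x * raagGen Γ v) ∧
  (∀ x, x ∉ C → φ (raagGen Γ x) = raagGen Γ x)

/-- `φ` is the (right) transvection `w ↦ wv` (defined when `st(v) ⊇ lk(w)`). -/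
def IsTransvection (Γ : SimpleGraph V) (φ : MulAut (RAAG Γ)) (w v : V) : Prop :=
  v ≠ w ∧ lk Γ w ⊆ starOf Γ v ∧
  φ (raagGen Γ w) = raagGen Γ w * raagGen Γ v ∧
  ∀ x, x ≠ w → φ (raagGen Γ x) = raagGen Γ x

/-- The group of pure automorphisms `Aut⁰(A_Γ)`. -/
def Aut0 (Γ : SimpleGraph V) : Subgroup (MulAut (RAAG Γ)) :=
  Subgroup.closure
    ({φ | φ ∈ Inn (RAAG Γ)} ∪ {φ | ∃ v, IsInversionAt Γ φ v} ∪
     {φ | ∃ v C, IsComponentOf Γ ((starOf Γ v)ᶜ) C ∧ IsPartialConjBy Γ φ v C} ∪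
     {φ | ∃ w v, IsTransvection Γ φ w v})

/-- The group of pure outer automorphisms `Out⁰(A_Γ)`. -/
def Out0 (Γ : SimpleGraph V) : Subgroup (Out (RAAG Γ)) :=
  (Aut0 Γ).map (QuotientGroup.mk' (Inn (RAAG Γ)))


/-- The automorphisms of `A_Γ` induced by graph symmetries of `Γ`. -/
def SymSet (Γ : SimpleGraph V) : Set (MulAut (RAAG Γ)) :=
  {φ | ∃ σ : Γ ≃g Γ, ∀ u, φ (raagGen Γ u) = raagGen Γ (σ u)}

/-- The subgroup `Sym(Γ) ≤ Aut(A_Γ)` of automorphisms induced by graph symmetries. -/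
def SymGrp (Γ : SimpleGraph V) : Subgroup (MulAut (RAAG Γ)) := Subgroup.closure (SymSet Γ)

/-- `Sym⁰(Γ) = Sym(Γ) ∩ Aut⁰(A_Γ)`. -/
def Sym0 (Γ : SimpleGraph V) : Subgroup (MulAut (RAAG Γ)) := SymGrp Γ ⊓ Aut0 Γ

namespace RaagSplit

variable {V : Type*} {Γ : SimpleGraph V}

section

variable {V : Type*}

/-! ### Letters, words and the link subgroups -/

/-- The formal inverse of a signed letter. -/
def flip (s : V × Bool) : V × Bool := (s.1, !s.2)

@[simp] lemma flip_fst (s : V × Bool) : (flip s).1 = s.1 := rfl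
@[simp] lemma flip_flip (s : V × Bool) : flip (flip s) = s := by simp [flip]
lemma flip_ne (s : V × Bool) : flip s ≠ s := by
  rcases s with ⟨x, b⟩; simp [flip]
lemma eq_or_eq_flip {r s : V × Bool} (h : r.1 = s.1) : r = s ∨ r = flip s := by
  rcases r with ⟨x, b⟩; rcases s with ⟨y, c⟩
  cases b <;> cases c <;> simp_all [flip]

variable (Γ : SimpleGraph V)

/-- The group element represented by a signed letter. -/
def lt (s : V × Bool) : RAAG Γ := if s.2 then raagGen Γ s.1 else (raagGen Γ s.1)⁻¹

/-- The group element represented by a word. -/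
def wp (w : List (V × Bool)) : RAAG Γ := (w.map (lt Γ)).prod

/-- The subgroup generated by the link of `x`. -/
abbrev LS (x : V) : Subgroup (RAAG Γ) := SpecialSubgroup Γ (lk Γ x)

@[simp] lemma lt_flip (s : V × Bool) : lt Γ (flip s) = (lt Γ s)⁻¹ := by
  rcases s with ⟨x, b⟩; cases b <;> simp [lt, flip]

@[simp] lemma lt_true (x : V) : lt Γ (x, true) = raagGen Γ x := by simp [lt]
@[simp] lemma lt_false (x : V) : lt Γ (x, false) = (raagGen Γ x)⁻¹ := by simp [lt]

@[simp] lemma wp_nil : wp Γ [] = 1 := rfl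
@[simp] lemma wp_cons (s : V × Bool) (w) : wp Γ (s :: w) = lt Γ s * wp Γ w := by simp [wp]
@[simp] lemma wp_append (w w') : wp Γ (w ++ w') = wp Γ w * wp Γ w' := by simp [wp]

/-- The formal inverse of a word. -/
def winv (w : List (V × Bool)) : List (V × Bool) := (w.map flip).reverse

@[simp] lemma wp_winv (w : List (V × Bool)) : wp Γ (winv w) = (wp Γ w)⁻¹ := by
  induction w with
  | nil => simp [winv]
  | cons s w ih => simp only [winv, List.map_cons, List.reverse_cons, wp_append, wp_cons, wp_nil,
      lt_flip, mul_one, mul_inv_rev] at ih ⊢; rw [ih]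

variable {Γ}

lemma gen_comm {v w : V} (h : Γ.Adj v w) : raagGen Γ v * raagGen Γ w = raagGen Γ w * raagGen Γ v := by
  have h1 : (PresentedGroup.mk (raagRels Γ)
      (FreeGroup.of v * FreeGroup.of w * (FreeGroup.of v)⁻¹ * (FreeGroup.of w)⁻¹)) = 1 :=
    PresentedGroup.one_of_mem ⟨v, w, h, rfl⟩
  simp only [map_mul, map_inv] at h1
  have h2 := eq_of_mul_inv_eq_one h1
  rw [mul_inv_eq_iff_eq_mul] at h2
  exact h2

lemma lt_commute {r s : V × Bool} (h : Γ.Adj r.1 s.1) : Commute (lt Γ r) (lt Γ s) := by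
  have h1 : Commute (raagGen Γ r.1) (raagGen Γ s.1) := gen_comm h
  rcases r with ⟨x, b⟩; rcases s with ⟨y, c⟩
  cases b <;> cases c <;> simp_all [lt]

lemma gen_mem {J : Set V} {x : V} (h : x ∈ J) : raagGen Γ x ∈ SpecialSubgroup Γ J :=
  Subgroup.subset_closure ⟨x, h, rfl⟩

lemma lt_mem {J : Set V} {s : V × Bool} (h : s.1 ∈ J) : lt Γ s ∈ SpecialSubgroup Γ J := by
  rcases s with ⟨x, b⟩
  cases b
  · simpa using gen_mem h
  · simpa using gen_mem h

lemma wp_mem {J : Set V} {w : List (V × Bool)} (h : ∀ s ∈ w, s.1 ∈ J) :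
    wp Γ w ∈ SpecialSubgroup Γ J := by
  refine Subgroup.list_prod_mem _ fun y hy => ?_
  obtain ⟨s, hs, rfl⟩ := List.mem_map.1 hy
  exact lt_mem (h s hs)

lemma exists_wp {J : Set V} {g : RAAG Γ} (h : g ∈ SpecialSubgroup Γ J) :
    ∃ w, (∀ s ∈ w, s.1 ∈ J) ∧ wp Γ w = g := by
  induction h using Subgroup.closure_induction with
  | mem x hx =>
    obtain ⟨v, hv, rfl⟩ := hx
    exact ⟨[(v, true)], by simpa using hv, by simp⟩
  | one => exact ⟨[], by simp, rfl⟩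
  | mul x y _ _ hx hy =>
    obtain ⟨w, hw, rfl⟩ := hx
    obtain ⟨w', hw', rfl⟩ := hy
    exact ⟨w ++ w', by simp only [List.mem_append]; rintro s (h | h); exacts [hw s h, hw' s h],
      by simp⟩
  | inv x _ hx =>
    obtain ⟨w, hw, rfl⟩ := hx
    refine ⟨winv w, ?_, by simp⟩
    simp only [winv, List.mem_reverse, List.mem_map]
    rintro s ⟨t, ht, rfl⟩
    exact hw t ht

lemma special_univ : SpecialSubgroup Γ Set.univ = ⊤ := by
  simp only [SpecialSubgroup, Set.image_univ]
  exact PresentedGroup.closure_range_of _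

lemma exists_word (g : RAAG Γ) : ∃ w, wp Γ w = g := by
  obtain ⟨w, -, h⟩ := exists_wp (J := Set.univ) (g := g) (by rw [special_univ]; trivial)
  exact ⟨w, h⟩

lemma LS_commute {x : V} {l : RAAG Γ} (hl : l ∈ LS Γ x) : Commute l (raagGen Γ x) := by
  have : LS Γ x ≤ Subgroup.centralizer {raagGen Γ x} := by
    refine (Subgroup.closure_le _).2 ?_
    rintro _ ⟨y, hy, rfl⟩
    simp only [SetLike.mem_coe, Subgroup.mem_centralizer_iff, Set.mem_singleton_iff, forall_eq]
    exact gen_comm hy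
  have h := this hl
  simp only [Subgroup.mem_centralizer_iff, Set.mem_singleton_iff, forall_eq] at h
  exact h.symm

lemma LS_commute_lt {s : V × Bool} {l : RAAG Γ} (hl : l ∈ LS Γ s.1) : Commute l (lt Γ s) := by
  rcases s with ⟨x, b⟩
  have := LS_commute hl
  cases b <;> simp [this, lt]

/-! ### The halfspace predicate -/

open scoped Classical in
/-- The permutation of `A × Bool` recording crossings of the standard wall labelled `x`. -/
def sidePerm (Γ : SimpleGraph V) (x z : V) : Equiv.Perm (RAAG Γ × Bool) where
  toFun p := (p.1 * (raagGen Γ z)⁻¹,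
    xor p.2 (decide (z = x ∧ p.1 * (raagGen Γ z)⁻¹ ∈ LS Γ x)))
  invFun p := (p.1 * raagGen Γ z, xor p.2 (decide (z = x ∧ p.1 ∈ LS Γ x)))
  left_inv p := by simp
  right_inv p := by simp

lemma sidePerm_comm (x : V) {v w : V} (h : Γ.Adj v w) :
    sidePerm Γ x v * sidePerm Γ x w = sidePerm Γ x w * sidePerm Γ x v := by
  have hc : Commute (raagGen Γ v)⁻¹ (raagGen Γ w)⁻¹ :=
    Commute.inv_inv (show Commute _ _ from gen_comm h)
  have key : ∀ g : RAAG Γ, g * (raagGen Γ w)⁻¹ * (raagGen Γ v)⁻¹ = g * (raagGen Γ v)⁻¹ * (raagGen Γ w)⁻¹ := by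
    intro g; rw [mul_assoc, mul_assoc, hc.eq]
  have key2 : ∀ (g : RAAG Γ) {a b : V}, Γ.Adj a b → a = x → (g * (raagGen Γ b)⁻¹ ∈ LS Γ x ↔ g ∈ LS Γ x) := by
    intro g a b hab e
    subst e
    exact Subgroup.mul_mem_cancel_right _ (Subgroup.inv_mem _ (gen_mem hab))
  ext p
  · simp [sidePerm, key]
  · have hvw : ¬ (v = x ∧ w = x) := by rintro ⟨rfl, rfl⟩; exact h.ne rfl
    simp only [sidePerm, Equiv.Perm.coe_mul, Equiv.coe_fn_mk, Function.comp_apply]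
    by_cases h1 : v = x
    · have h2 : w ≠ x := fun h' => hvw ⟨h1, h'⟩
      simp only [h1, h2, true_and, false_and, decide_false, Bool.xor_false]
      rw [← h1, key, h1, key2 _ h h1]
    · by_cases h2 : w = x
      · simp only [h1, h2, true_and, false_and, decide_false, Bool.xor_false]
        rw [← h2, ← key, h2, key2 _ h.symm h2]
      · simp [h1, h2]

/-- The action of the group recording crossings of the standard wall labelled `x`. -/
def sideHom (Γ : SimpleGraph V) (x : V) : RAAG Γ →* Equiv.Perm (RAAG Γ × Bool) :=
  PresentedGroup.toGroup (f := sidePerm Γ x) (by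
    rintro r ⟨v, w, h, rfl⟩
    simp only [map_mul, map_inv, FreeGroup.lift_apply_of]
    rw [sidePerm_comm x h]
    group)

lemma sideHom_gen (x z : V) : sideHom Γ x (raagGen Γ z) = sidePerm Γ x z :=
  PresentedGroup.toGroup.of _

/-- The element `g` lies on the positive side of the standard wall labelled `x`. -/
def side (x : V) (g : RAAG Γ) : Prop := (sideHom Γ x g⁻¹ (1, false)).2 = true

lemma sideHom_fst (x : V) (g : RAAG Γ) (p) : (sideHom Γ x g p).1 = p.1 * g⁻¹ := by
  have hz : ∀ z p, (sidePerm Γ x z p).1 = p.1 * (raagGen Γ z)⁻¹ := fun _ _ => rfl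
  have hz' : ∀ z p, ((sidePerm Γ x z).symm p).1 = p.1 * (raagGen Γ z) := fun _ _ => rfl
  obtain ⟨w, rfl⟩ := exists_word g
  induction w generalizing p with
  | nil => simp
  | cons s w ih =>
    rcases s with ⟨z, b⟩
    cases b
    · simp [sideHom_gen, hz', ih, mul_assoc]
    · simp [sideHom_gen, hz, ih, mul_assoc]

lemma side_one (x : V) : ¬ side x (1 : RAAG Γ) := by simp [side]

lemma side_mul_gen (x z : V) (g : RAAG Γ) :
    side x (g * raagGen Γ z) ↔ ¬ (side x g ↔ z = x ∧ g ∈ LS Γ x) := by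
  have h1 := sideHom_fst x g⁻¹ (1, false)
  simp only [one_mul, inv_inv] at h1
  simp only [side, mul_inv_rev, map_mul, map_inv, Equiv.Perm.coe_mul, Function.comp_apply,
    sideHom_gen]
  simp only [map_inv] at h1
  have h2 : ∀ p, ((sidePerm Γ x z)⁻¹ p).2 = true ↔ ¬ (p.2 = true ↔ (z = x ∧ p.1 ∈ LS Γ x)) := by
    intro p
    change xor p.2 _ = true ↔ _
    by_cases h : z = x ∧ p.1 ∈ LS Γ x <;> simp [h]
  rw [h2, h1]

lemma side_mul_gen_inv (x z : V) (g : RAAG Γ) :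
    side x (g * (raagGen Γ z)⁻¹) ↔ ¬ (side x g ↔ z = x ∧ g * (raagGen Γ z)⁻¹ ∈ LS Γ x) := by
  have := side_mul_gen x z (g * (raagGen Γ z)⁻¹)
  rw [inv_mul_cancel_right] at this
  rw [this]
  tauto

/-- The element `g` lies in the standard halfspace of the signed letter `s`, that is, some
reduced word for `g` begins with `s`. -/
def S (s : V × Bool) (g : RAAG Γ) : Prop :=
  if s.2 then side s.1 g else ¬ side s.1 (raagGen Γ s.1 * g)

lemma side_LS {x : V} {l : RAAG Γ} (hl : l ∈ LS Γ x) : ¬ side x l := by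
  obtain ⟨w, hw, rfl⟩ := exists_wp hl
  induction w using List.reverseRecOn with
  | nil => exact side_one x
  | append_singleton w s ih =>
    have hs : s.1 ≠ x := by
      have := hw s (by simp)
      exact (SimpleGraph.Adj.ne this).symm
    have ih' := ih (fun t ht => hw t (by simp [ht])) (wp_mem fun t ht => hw t (by simp [ht]))
    rcases s with ⟨z, b⟩
    cases b
    · simp only [wp_append, wp_cons, wp_nil, mul_one, lt_false, side_mul_gen_inv]
      simp_all
    · simp only [wp_append, wp_cons, wp_nil, mul_one, lt_true, side_mul_gen]
      simp_all

lemma side_LS_mul {x : V} {l : RAAG Γ} (hl : l ∈ LS Γ x) (g : RAAG Γ) :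
    side x (l * g) ↔ side x g := by
  obtain ⟨w, rfl⟩ := exists_word g
  induction w using List.reverseRecOn with
  | nil => simp [side_LS hl, side_one]
  | append_singleton w s ih =>
    have key : ∀ h : RAAG Γ, l * h ∈ LS Γ x ↔ h ∈ LS Γ x := fun h =>
      Subgroup.mul_mem_cancel_left _ hl
    rcases s with ⟨z, b⟩
    cases b
    · simp only [wp_append, wp_cons, wp_nil, mul_one, lt_false, ← mul_assoc, side_mul_gen_inv, ih]
      rw [mul_assoc l, key]
    · simp only [wp_append, wp_cons, wp_nil, mul_one, lt_true, ← mul_assoc, side_mul_gen, ih, key]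

lemma S_LS_mul {s : V × Bool} {l : RAAG Γ} (hl : l ∈ LS Γ s.1) (g : RAAG Γ) :
    S s (l * g) ↔ S s g := by
  rcases s with ⟨x, b⟩
  cases b
  · simp only [S, Bool.false_eq_true, if_false]
    rw [← mul_assoc, ← (LS_commute hl).eq, mul_assoc, side_LS_mul hl]
  · simp [S, side_LS_mul hl]

lemma S_one (s : V × Bool) : ¬ S s (1 : RAAG Γ) := by
  rcases s with ⟨x, b⟩
  cases b
  · have := side_mul_gen x x (1 : RAAG Γ)
    simp only [one_mul] at this
    simp [S, this, side_one]
  · simp [S, side_one]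

lemma S_LS {s : V × Bool} {l : RAAG Γ} (hl : l ∈ LS Γ s.1) : ¬ S s l := by
  have := S_LS_mul hl 1
  rw [mul_one] at this
  rw [this]; exact S_one s

lemma S_flip (s : V × Bool) (g : RAAG Γ) : S (flip s) g ↔ ¬ S s (lt Γ s * g) := by
  rcases s with ⟨x, b⟩
  cases b <;> simp [S, flip]

lemma S_mul_ne {r s : V × Bool} (h : r.1 ≠ s.1) (g : RAAG Γ) : S s (g * lt Γ r) ↔ S s g := by
  rcases r with ⟨y, c⟩; rcases s with ⟨x, b⟩
  simp only [ne_eq] at h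
  have h1 : ∀ g : RAAG Γ, side x (g * raagGen Γ y) ↔ side x g := by
    intro g; rw [side_mul_gen]; simp [h]
  have h2 : ∀ g : RAAG Γ, side x (g * (raagGen Γ y)⁻¹) ↔ side x g := by
    intro g; rw [side_mul_gen_inv]; simp [h]
  cases b <;> cases c <;> simp [S, h1, h2, ← mul_assoc]

lemma S_mul_self (s : V × Bool) (g : RAAG Γ) :
    S s (g * lt Γ s) ↔ ¬ (S s g ↔ g ∈ LS Γ s.1) := by
  rcases s with ⟨x, b⟩
  cases b
  · simp only [S, Bool.false_eq_true, if_false, lt_false, ← mul_assoc]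
    have hm : raagGen Γ x * g * (raagGen Γ x)⁻¹ ∈ LS Γ x ↔ g ∈ LS Γ x := by
      constructor
      · intro h
        have h1 := (LS_commute h).eq
        have : raagGen Γ x * g * (raagGen Γ x)⁻¹ = g := by
          have h2 : raagGen Γ x * g  = raagGen Γ x * (raagGen Γ x * g * (raagGen Γ x)⁻¹) := by
            rw [← h1]; group
          exact (mul_left_cancel h2).symm
        rwa [this] at h
      · intro h
        rw [← (LS_commute h).eq]; simpa using h
    rw [side_mul_gen_inv, hm]
    tauto
  · simp [S, side_mul_gen]

lemma S_mul_flip (s : V × Bool) (g : RAAG Γ) :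
    S s (g * (lt Γ s)⁻¹) ↔ ¬ (S s g ↔ g * (lt Γ s)⁻¹ ∈ LS Γ s.1) := by
  have := S_mul_self s (g * (lt Γ s)⁻¹)
  rw [inv_mul_cancel_right] at this
  rw [this]; tauto

lemma S_LS_mul_lt {s : V × Bool} {l : RAAG Γ} (hl : l ∈ LS Γ s.1) : S s (l * lt Γ s) := by
  rw [S_mul_self]; have := S_LS hl; tauto

lemma S_lt (s : V × Bool) : S s (lt Γ s) := by
  simpa using S_LS_mul_lt (s := s) (Subgroup.one_mem (LS Γ s.1))

/-- Crossing into a halfspace. -/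
lemma S_enter {r s : V × Bool} {g : RAAG Γ} (h1 : ¬ S s g) (h2 : S s (g * lt Γ r)) :
    r = s ∧ g ∈ LS Γ s.1 := by
  by_cases hrs : r.1 = s.1
  · rcases eq_or_eq_flip hrs with rfl | rfl
    · rw [S_mul_self] at h2
      exact ⟨rfl, by tauto⟩
    · rw [lt_flip] at h2
      have h3 := h2
      rw [S_mul_flip] at h2
      exact absurd h3 (S_LS (by tauto))
  · rw [S_mul_ne hrs] at h2; exact absurd h2 h1

/-- Crossing out of a halfspace. -/
lemma S_exit {r s : V × Bool} {g : RAAG Γ} (h1 : S s g) (h2 : ¬ S s (g * lt Γ r)) :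
    r = flip s ∧ g * lt Γ r ∈ LS Γ s.1 := by
  have := S_enter (r := flip r) (s := s) (g := g * lt Γ r) h2 (by simpa using h1)
  exact ⟨by rw [← this.1]; simp, this.2⟩

/-- A path entering a halfspace crosses its wall. -/
lemma S_enter_word {s : V × Bool} {w : List (V × Bool)} {g : RAAG Γ} (h1 : ¬ S s g)
    (h2 : S s (g * wp Γ w)) : ∃ w₁ w₂, w = w₁ ++ s :: w₂ ∧ g * wp Γ w₁ ∈ LS Γ s.1 := by
  induction w generalizing g with
  | nil => simp at h2; exact absurd h2 h1
  | cons r w ih =>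
    by_cases h3 : S s (g * lt Γ r)
    · obtain ⟨rfl, h4⟩ := S_enter h1 h3
      exact ⟨[], w, rfl, by simpa using h4⟩
    · obtain ⟨w₁, w₂, rfl, h5⟩ := ih h3 (by simpa [mul_assoc] using h2)
      exact ⟨r :: w₁, w₂, rfl, by simpa [mul_assoc] using h5⟩

/-- A path leaving a halfspace crosses its wall. -/
lemma S_exit_word {s : V × Bool} {w : List (V × Bool)} {g : RAAG Γ} (h1 : S s g)
    (h2 : ¬ S s (g * wp Γ w)) :
    ∃ w₁ w₂, w = w₁ ++ flip s :: w₂ ∧ g * wp Γ w₁ * lt Γ (flip s) ∈ LS Γ s.1 := by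
  induction w generalizing g with
  | nil => simp at h2; exact absurd h1 h2
  | cons r w ih =>
    by_cases h3 : S s (g * lt Γ r)
    · obtain ⟨w₁, w₂, rfl, h5⟩ := ih h3 (by simpa [mul_assoc] using h2)
      exact ⟨r :: w₁, w₂, rfl, by simpa [mul_assoc] using h5⟩
    · obtain ⟨rfl, h4⟩ := S_exit h1 h3
      exact ⟨[], w, rfl, by simpa using h4⟩

lemma S_mul_special {s : V × Bool} {J : Set V} (hs : s.1 ∉ J) {h : RAAG Γ}
    (hh : h ∈ SpecialSubgroup Γ J) (g : RAAG Γ) : S s (g * h) ↔ S s g := by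
  obtain ⟨w, hw, rfl⟩ := exists_wp hh
  clear hh
  induction w using List.reverseRecOn with
  | nil => simp
  | append_singleton w r ih =>
    simp only [wp_append, wp_cons, wp_nil, mul_one, ← mul_assoc]
    rw [S_mul_ne (fun h => hs (h ▸ hw r (by simp))), ih fun t ht => hw t (by simp [ht])]

end

section

/-! ### Halfspaces -/

open scoped Pointwise

/-- The halfspace on the far side of the edge from `k` to `k * s`. -/
def HS (k : RAAG Γ) (s : V × Bool) : Set (RAAG Γ) := {g | S s (k⁻¹ * g)}

lemma mem_HS {k g : RAAG Γ} {s : V × Bool} : g ∈ HS k s ↔ S s (k⁻¹ * g) := Iff.rfl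

@[simp] lemma mem_HS_one {g : RAAG Γ} {s : V × Bool} : g ∈ HS 1 s ↔ S s g := by simp [mem_HS]

lemma HS_compl (k : RAAG Γ) (s : V × Bool) : (HS k s)ᶜ = HS (k * lt Γ s) (flip s) := by
  ext g
  rw [Set.mem_compl_iff, mem_HS, mem_HS, S_flip]
  simp [mul_assoc]

@[simp] lemma smul_HS (g k : RAAG Γ) (s : V × Bool) : g • HS k s = HS (g * k) s := by
  ext x
  rw [Set.mem_smul_set_iff_inv_smul_mem, mem_HS, mem_HS]
  simp [mul_assoc]

lemma base_notMem (k : RAAG Γ) (s : V × Bool) : k ∉ HS k s := by simp [mem_HS, S_one]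

lemma base_mul_mem (k : RAAG Γ) (s : V × Bool) : k * lt Γ s ∈ HS k s := by simp [mem_HS, S_lt]

lemma HS_enter {k g : RAAG Γ} {r s : V × Bool} (h1 : g ∉ HS k s) (h2 : g * lt Γ r ∈ HS k s) :
    r = s ∧ k⁻¹ * g ∈ LS Γ s.1 :=
  S_enter h1 (by rwa [mem_HS, ← mul_assoc] at h2)

lemma HS_exit {k g : RAAG Γ} {r s : V × Bool} (h1 : g ∈ HS k s) (h2 : g * lt Γ r ∉ HS k s) :
    r = flip s ∧ k⁻¹ * g * lt Γ r ∈ LS Γ s.1 :=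
  S_exit h1 (by rwa [mem_HS, ← mul_assoc] at h2)

lemma HS_congr {k h : RAAG Γ} {s : V × Bool} (hl : k⁻¹ * h ∈ LS Γ s.1) : HS h s = HS k s := by
  ext g
  rw [mem_HS, mem_HS, ← S_LS_mul hl]
  simp [mul_assoc]

lemma HS_eq_iff {k h : RAAG Γ} {r s : V × Bool} :
    HS h r = HS k s ↔ r = s ∧ k⁻¹ * h ∈ LS Γ s.1 := by
  constructor
  · intro e
    exact HS_enter (e ▸ base_notMem h r) (e ▸ base_mul_mem h r)
  · rintro ⟨rfl, h⟩
    exact HS_congr h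

/-- Halfspaces are connected in the Cayley graph. -/
lemma HS_connected {h : RAAG Γ} {r : V × Bool} {P : RAAG Γ → Prop}
    (hP : ∀ e t, e ∈ HS h r → e * lt Γ t ∈ HS h r → (P e ↔ P (e * lt Γ t)))
    {e : RAAG Γ} (he : e ∈ HS h r) : P e ↔ P (h * lt Γ r) := by
  have hL : ∀ w : List (V × Bool), (∀ s ∈ w, s.1 ∈ lk Γ r.1) →
      (P (h * lt Γ r * wp Γ w) ↔ P (h * lt Γ r)) := by
    intro w
    induction w using List.reverseRecOn with
    | nil => simp
    | append_singleton w s ih =>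
      intro hw
      have hm : ∀ w : List (V × Bool), (∀ s ∈ w, s.1 ∈ lk Γ r.1) →
          h * lt Γ r * wp Γ w ∈ HS h r := by
        intro w hw
        have h1 := wp_mem (Γ := Γ) hw
        rw [mul_assoc, ← (LS_commute_lt h1).eq, mem_HS]
        simpa using S_LS_mul_lt h1
      have hw' : ∀ s ∈ w, s.1 ∈ lk Γ r.1 := fun t ht => hw t (by simp [ht])
      rw [← ih hw', wp_append, ← mul_assoc]
      have := hP (h * lt Γ r * wp Γ w) s (hm w hw') (by simpa [mul_assoc] using hm _ hw)
      simpa using this.symm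
  have hmain : ∀ w : List (V × Bool), S r (wp Γ w) → (P (h * wp Γ w) ↔ P (h * lt Γ r)) := by
    intro w
    induction w using List.reverseRecOn with
    | nil => intro h; exact absurd h (S_one r)
    | append_singleton w t ih =>
      intro hS
      have e1 : wp Γ (w ++ [t]) = wp Γ w * lt Γ t := by simp
      rw [e1] at hS ⊢
      by_cases h1 : S r (wp Γ w)
      · rw [← ih h1, ← mul_assoc]
        exact (hP _ _ (by simpa [mem_HS] using h1) (by simpa [mem_HS, mul_assoc] using hS)).symm
      · obtain ⟨rfl, h2⟩ := S_enter h1 hS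
        rw [(LS_commute_lt h2).eq, ← mul_assoc]
        obtain ⟨w', hw', e⟩ := exists_wp h2
        rw [← e]
        exact hL w' hw'
  obtain ⟨w, hw⟩ := exists_word (h⁻¹ * e)
  have := hmain w (by rw [hw]; exact he)
  rwa [hw, mul_inv_cancel_left] at this

lemma HS_dichotomy {h k : RAAG Γ} {r s : V × Bool}
    (hs : ∀ l ∈ LS Γ s.1, k * l ∉ HS h r ∧ k * l * lt Γ s ∉ HS h r) :
    HS h r ⊆ HS k s ∨ Disjoint (HS k s) (HS h r) := by
  have key : ∀ e t, e ∈ HS h r → e * lt Γ t ∈ HS h r →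
      (e ∈ HS k s ↔ e * lt Γ t ∈ HS k s) := by
    intro e t he het
    by_cases h1 : e ∈ HS k s
    · by_cases h2 : e * lt Γ t ∈ HS k s
      · tauto
      · obtain ⟨rfl, h3⟩ := HS_exit h1 h2
        have := (hs _ h3).1
        rw [mul_assoc k⁻¹, mul_inv_cancel_left] at this
        exact absurd het this
    · by_cases h2 : e * lt Γ t ∈ HS k s
      · obtain ⟨rfl, h3⟩ := HS_enter h1 h2
        have := (hs _ h3).1
        rw [mul_inv_cancel_left] at this
        exact absurd he this
      · tauto
  by_cases h1 : h * lt Γ r ∈ HS k s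
  · exact Or.inl fun e he => (HS_connected key he).2 h1
  · exact Or.inr (Set.disjoint_left.2 fun e he1 he2 => h1 ((HS_connected key he2).1 he1))

/-- Walls with non-adjacent labels do not cross. -/
lemma HS_nested {h k : RAAG Γ} {r s : V × Bool} (hrs : ¬ Γ.Adj s.1 r.1) :
    HS k s ⊆ HS h r ∨ HS h r ⊆ HS k s ∨ Disjoint (HS k s) (HS h r) ∨
      HS k s ∪ HS h r = Set.univ := by
  have e1 : ∀ l ∈ LS Γ s.1, (k * l ∈ HS h r ↔ k ∈ HS h r) := by
    intro l hl
    rw [mem_HS, ← mul_assoc, S_mul_special hrs hl, mem_HS]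
  have e2 : ∀ l ∈ LS Γ s.1, (k * l * lt Γ s ∈ HS h r ↔ k * lt Γ s ∈ HS h r) := by
    intro l hl
    rw [mul_assoc, (LS_commute_lt hl).eq, mem_HS, ← mul_assoc, ← mul_assoc,
      S_mul_special hrs hl, mem_HS, ← mul_assoc]
  by_cases h1 : k ∈ HS h r
  · by_cases h2 : k * lt Γ s ∈ HS h r
    · have := HS_dichotomy (h := h * lt Γ r) (k := k) (r := flip r) (s := s) (by
        rw [← HS_compl]
        intro l hl
        simp [e1 l hl, e2 l hl, h1, h2])
      rw [← HS_compl] at this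
      rcases this with h3 | h3
      · right; right; right
        rw [Set.union_comm]
        exact Set.compl_subset_iff_union.1 h3
      · left
        exact Set.disjoint_compl_right_iff_subset.1 h3
    · obtain ⟨rfl, h3⟩ := HS_exit h1 h2
      right; right; left
      have : HS k (flip r) = (HS h r)ᶜ := by
        rw [HS_compl]
        refine HS_congr ?_
        have h4 := LS_commute_lt (s := r) h3
        have : (h * lt Γ r)⁻¹ * k = h⁻¹ * k * lt Γ (flip r) := by
          have h6 : (h * lt Γ r)⁻¹ * k = (lt Γ r)⁻¹ * (h⁻¹ * k * lt Γ (flip r) * lt Γ r) := by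
            simp [mul_assoc]
          rw [h6, h4.eq, inv_mul_cancel_left]
        rw [this]; exact h3
      rw [this]
      exact disjoint_compl_left
  · by_cases h2 : k * lt Γ s ∈ HS h r
    · obtain ⟨rfl, h3⟩ := HS_enter h1 h2
      left
      rw [HS_congr h3]
    · have := HS_dichotomy (h := h) (k := k) (r := r) (s := s) (by
        intro l hl
        simp [e1 l hl, e2 l hl, h1, h2])
      tauto

lemma S_disjoint {r s : V × Bool} (hrs : ¬ Γ.Adj r.1 s.1) (hne : r ≠ s) {g : RAAG Γ}
    (hr : S r g) (hs : S s g) : False := by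
  rcases HS_nested (h := (1 : RAAG Γ)) (k := 1) (r := s) (s := r) hrs with h | h | h | h
  · have := h (base_mul_mem 1 r)
    exact hne (HS_enter (base_notMem 1 s) this).1
  · have := h (base_mul_mem 1 s)
    exact hne (HS_enter (base_notMem 1 r) this).1.symm
  · exact Set.disjoint_left.1 h (mem_HS_one.2 hr) (mem_HS_one.2 hs)
  · have : (1 : RAAG Γ) ∈ HS 1 r ∪ HS 1 s := h ▸ Set.mem_univ _
    rcases this with h | h
    · exact base_notMem _ _ h
    · exact base_notMem _ _ h

/-- Only finitely many halfspaces separate two points. -/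
lemma finite_walls (p q : RAAG Γ) :
    {K : Set (RAAG Γ) | (∃ k s, K = HS k s) ∧ p ∈ K ∧ q ∉ K}.Finite := by
  obtain ⟨w, hw⟩ := exists_word (p⁻¹ * q)
  obtain rfl : q = p * wp Γ w := by rw [hw]; simp
  clear hw
  induction w generalizing p with
  | nil =>
    convert Set.finite_empty
    ext K; simp
  | cons t w ih =>
    refine ((ih (p * lt Γ t)).union (Set.finite_singleton (HS (p * lt Γ t) (flip t)))).subset ?_
    rintro K ⟨⟨k, s, rfl⟩, h1, h2⟩
    by_cases h3 : p * lt Γ t ∈ HS k s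
    · left
      exact ⟨⟨k, s, rfl⟩, h3, by simpa [mul_assoc] using h2⟩
    · right
      obtain ⟨rfl, h4⟩ := HS_exit h1 h3
      rw [flip_flip, Set.mem_singleton_iff]
      refine (HS_congr ?_).symm
      simpa [mul_assoc] using h4

lemma pow_smul_subset {z : RAAG Γ} {X : Set (RAAG Γ)} (h : z • X ⊂ X) {m n : ℕ} (hmn : m < n) :
    z ^ n • X ⊂ z ^ m • X := by
  induction hmn with
  | refl =>
    rw [pow_succ, mul_smul]
    exact ⟨Set.smul_set_subset_smul_set_iff.2 h.1, fun h' => h.2 (Set.smul_set_subset_smul_set_iff.1 h')⟩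
  | @step k _ ih =>
    refine ssubset_trans ?_ ih
    rw [pow_succ, mul_smul]
    exact ⟨Set.smul_set_subset_smul_set_iff.2 h.1, fun h' => h.2 (Set.smul_set_subset_smul_set_iff.1 h')⟩

lemma exists_notMem_pow_smul {z k : RAAG Γ} {s : V × Bool} (h : z • HS k s ⊂ HS k s)
    (p : RAAG Γ) : ∃ n : ℕ, p ∉ z ^ n • HS k s := by
  by_contra! hp
  have hinj : Function.Injective fun n : ℕ => z ^ n • HS k s := by
    intro m n hmn
    rcases lt_trichotomy m n with h1 | h1 | h1
    · exact absurd hmn.symm (pow_smul_subset h h1).ne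
    · exact h1
    · exact absurd hmn (pow_smul_subset h h1).ne
  have hfin := finite_walls p k
  refine Set.infinite_range_of_injective hinj (hfin.subset ?_)
  rintro _ ⟨n, rfl⟩
  refine ⟨⟨z ^ n * k, s, by simp⟩, hp n, ?_⟩
  rcases Nat.eq_zero_or_pos n with rfl | hn
  · simpa using base_notMem k s
  · intro h1
    have := (pow_smul_subset h hn).1 h1
    rw [pow_zero, one_smul] at this
    exact base_notMem k s this

lemma compl_ssubset_of_smul {z : RAAG Γ} {X : Set (RAAG Γ)} (h : z • X ⊂ X) :
    z⁻¹ • Xᶜ ⊂ Xᶜ := by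
  have h1 : X ⊂ z⁻¹ • X := by
    constructor
    · rw [← Set.smul_set_subset_smul_set_iff (a := z)]; simpa using h.1
    · rw [← Set.smul_set_subset_smul_set_iff (a := z)]; simpa using h.2
  rw [Set.smul_set_compl]
  exact compl_lt_compl_iff_lt.2 h1

lemma exists_mem_inv_pow_smul {z k : RAAG Γ} {s : V × Bool} (h : z • HS k s ⊂ HS k s)
    (p : RAAG Γ) : ∃ n : ℕ, p ∈ z⁻¹ ^ n • HS k s := by
  have h1 := compl_ssubset_of_smul h
  rw [HS_compl] at h1
  obtain ⟨n, hn⟩ := exists_notMem_pow_smul h1 p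
  rw [← HS_compl, Set.smul_set_compl, Set.mem_compl_iff, not_not] at hn
  exact ⟨n, hn⟩

end

section

/-! ### Weighted word length -/

section Length

variable {M : Type*} [AddCommMonoid M] [LinearOrder M] [IsOrderedCancelAddMonoid M]
  [WellFoundedLT M]

/-- The weighted length of a word. -/
def wlen (wt : V → M) (w : List (V × Bool)) : M := (w.map fun s => wt s.1).sum

@[simp] lemma wlen_nil (wt : V → M) : wlen wt [] = 0 := rfl
@[simp] lemma wlen_cons (wt : V → M) (s w) : wlen wt (s :: w) = wt s.1 + wlen wt w := by
  simp [wlen]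
@[simp] lemma wlen_append (wt : V → M) (w w') : wlen wt (w ++ w') = wlen wt w + wlen wt w' := by
  simp [wlen]

@[simp] lemma wlen_winv (wt : V → M) (w) : wlen wt (winv w) = wlen wt w := by
  induction w with
  | nil => rfl
  | cons s w ih =>
    have : winv (s :: w) = winv w ++ [flip s] := by simp [winv]
    rw [this, wlen_append, ih]; simp [add_comm]

/-- The weighted word length of a group element. -/
def om (wt : V → M) (g : RAAG Γ) : M :=
  wellFounded_lt.min {m | ∃ w, wp Γ w = g ∧ wlen wt w = m}
    (let ⟨w, hw⟩ := exists_word g; ⟨_, w, hw, rfl⟩)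

lemma exists_geod (wt : V → M) (g : RAAG Γ) : ∃ w, wp Γ w = g ∧ wlen wt w = om wt g :=
  wellFounded_lt.min_mem {m | ∃ w, wp Γ w = g ∧ wlen wt w = m} _

lemma om_le (wt : V → M) (w : List (V × Bool)) : om wt (wp Γ w) ≤ wlen wt w :=
  not_lt.1 (wellFounded_lt.not_lt_min {m | ∃ w', wp Γ w' = wp Γ w ∧ wlen wt w' = m} ⟨w, rfl, rfl⟩)

lemma om_mul_le (wt : V → M) (g h : RAAG Γ) : om wt (g * h) ≤ om wt g + om wt h := by
  obtain ⟨w, rfl, hw⟩ := exists_geod wt g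
  obtain ⟨w', rfl, hw'⟩ := exists_geod wt h
  rw [← hw, ← hw', ← wlen_append, ← wp_append]
  exact om_le wt _

lemma om_inv_le (wt : V → M) (g : RAAG Γ) : om wt g⁻¹ ≤ om wt g := by
  obtain ⟨w, rfl, hw⟩ := exists_geod wt g
  rw [← hw, ← wp_winv, ← wlen_winv wt w]
  exact om_le wt _

@[simp] lemma om_inv (wt : V → M) (g : RAAG Γ) : om wt g⁻¹ = om wt g :=
  le_antisymm (om_inv_le wt g) (by simpa using om_inv_le wt g⁻¹)

lemma om_lt_le (wt : V → M) (s : V × Bool) : om wt (lt Γ s) ≤ wt s.1 := by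
  simpa using om_le (Γ := Γ) wt [s]

variable {wt : V → M}

/-- A word is reduced if it is a shortest word for the element it represents. -/
def IsRed (Γ : SimpleGraph V) (wt : V → M) (w : List (V × Bool)) : Prop :=
  wlen wt w = om wt (wp Γ w)

lemma exists_red (wt : V → M) (g : RAAG Γ) : ∃ w, IsRed Γ wt w ∧ wp Γ w = g := by
  obtain ⟨w, h1, h2⟩ := exists_geod wt g
  exact ⟨w, by rw [IsRed, h1, h2], h1⟩

lemma IsRed.le {w w' : List (V × Bool)} (h : IsRed Γ wt w) (hw : wp Γ w' = wp Γ w) :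
    wlen wt w ≤ wlen wt w' := by
  rw [h, ← hw]; exact om_le wt w'

lemma isRed_of_le {w : List (V × Bool)} (h : ∀ w', wp Γ w' = wp Γ w → wlen wt w ≤ wlen wt w') :
    IsRed Γ wt w := by
  obtain ⟨w', h1, h2⟩ := exists_geod wt (wp Γ w)
  exact le_antisymm (h2 ▸ h w' h1) (om_le wt w)

lemma IsRed.middle {a b c : List (V × Bool)} (h : IsRed Γ wt (a ++ b ++ c)) : IsRed Γ wt b := by
  refine isRed_of_le fun w' hw' => ?_
  have := h.le (w' := a ++ w' ++ c) (by simp [hw'])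
  simpa using this

lemma IsRed.left {a b : List (V × Bool)} (h : IsRed Γ wt (a ++ b)) : IsRed Γ wt a :=
  IsRed.middle (a := []) (c := b) (by simpa using h)

lemma IsRed.right {a b : List (V × Bool)} (h : IsRed Γ wt (a ++ b)) : IsRed Γ wt b :=
  IsRed.middle (a := a) (c := []) (by simpa using h)

lemma IsRed.winv {w : List (V × Bool)} (h : IsRed Γ wt w) : IsRed Γ wt (winv w) := by
  rw [IsRed, wlen_winv, wp_winv, om_inv, h]

variable (hpos : ∀ v, 0 < wt v)
include hpos

lemma wlen_nonneg (w : List (V × Bool)) : 0 ≤ wlen wt w := by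
  induction w with
  | nil => simp
  | cons s w ih => simpa using add_nonneg (hpos s.1).le ih

lemma om_one : om wt (1 : RAAG Γ) = 0 := by
  refine le_antisymm (by simpa using om_le (Γ := Γ) wt []) ?_
  obtain ⟨w, -, hw⟩ := exists_geod wt (1 : RAAG Γ)
  rw [← hw]; exact wlen_nonneg hpos w

lemma S_of_isRed_cons {s : V × Bool} {w : List (V × Bool)} (h : IsRed Γ wt (s :: w)) :
    S s (wp Γ (s :: w)) := by
  by_contra h1
  rw [wp_cons] at h1
  obtain ⟨w₁, w₂, rfl, h2⟩ := S_exit_word (S_lt s) h1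
  have h3 : wp Γ (w₁ ++ w₂) = wp Γ (s :: (w₁ ++ flip s :: w₂)) := by
    have h4 := (LS_commute_lt h2).eq
    simp only [wp_append, wp_cons, lt_flip] at h4 ⊢
    have h5 : wp Γ w₁ = lt Γ s * wp Γ w₁ * (lt Γ s)⁻¹ := by
      have : lt Γ s * (lt Γ s * wp Γ w₁ * (lt Γ s)⁻¹) = lt Γ s * wp Γ w₁ := by
        rw [← h4]; simp
      exact (mul_left_cancel this).symm
    nth_rw 1 [h5]; simp [mul_assoc]
  have h6 := h.le h3
  have h7 := add_pos (hpos s.1) (hpos s.1)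
  simp only [wlen_append, wlen_cons, flip_fst] at h6
  have h8 : wt s.1 + (wlen wt w₁ + (wt s.1 + wlen wt w₂))
      = wlen wt w₁ + wlen wt w₂ + (wt s.1 + wt s.1) := by abel
  rw [h8] at h6
  exact absurd h6 (not_le.2 (lt_add_of_pos_right _ h7))

lemma exists_S {g : RAAG Γ} (hg : g ≠ 1) : ∃ s, S s g := by
  obtain ⟨w, h1, rfl⟩ := exists_red wt g
  cases w with
  | nil => simp at hg
  | cons s w => exact ⟨s, S_of_isRed_cons hpos h1⟩

omit hpos in
lemma om_of_S {s : V × Bool} {k : RAAG Γ} (h : S s k) :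
    om wt k = wt s.1 + om wt ((lt Γ s)⁻¹ * k) := by
  apply le_antisymm
  · have := om_mul_le wt (lt Γ s) ((lt Γ s)⁻¹ * k)
    rw [mul_inv_cancel_left] at this
    exact this.trans (by gcongr; exact om_lt_le wt s)
  · obtain ⟨w, rfl, hw⟩ := exists_geod wt k
    obtain ⟨w₁, w₂, rfl, h2⟩ := S_enter_word (S_one s) (by simpa using h)
    rw [one_mul] at h2
    have : (lt Γ s)⁻¹ * wp Γ (w₁ ++ s :: w₂) = wp Γ (w₁ ++ w₂) := by
      simp only [wp_append, wp_cons]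
      rw [← mul_assoc (wp Γ w₁), (LS_commute_lt h2).eq]; simp [mul_assoc]
    rw [this, ← hw]
    have := om_le (Γ := Γ) wt (w₁ ++ w₂)
    simp only [wlen_append, wlen_cons] at this ⊢
    calc _ ≤ wt s.1 + (wlen wt w₁ + wlen wt w₂) := by gcongr
      _ = _ := by abel

omit hpos in
/-- A geodesic entering a halfspace splits at the wall. -/
lemma om_enter {p k h : RAAG Γ} {s : V × Bool} (hp : p ∉ HS k s) (hh : h ∈ HS k s) :
    ∃ l ∈ LS Γ s.1, om wt (p⁻¹ * h) =
        om wt (p⁻¹ * (k * l)) + wt s.1 + om wt ((k * l * lt Γ s)⁻¹ * h) ∧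
      om wt (p⁻¹ * (k * l * lt Γ s)) = om wt (p⁻¹ * (k * l)) + wt s.1 := by
  obtain ⟨w, h1, h2⟩ := exists_red wt (p⁻¹ * h)
  obtain ⟨w₁, w₂, rfl, h3⟩ := S_enter_word (g := k⁻¹ * p) (w := w) hp (by
    rw [h2]; simpa [mul_assoc, mem_HS] using hh)
  refine ⟨k⁻¹ * p * wp Γ w₁, h3, ?_⟩
  have e1 : p⁻¹ * (k * (k⁻¹ * p * wp Γ w₁)) = wp Γ w₁ := by group
  have e2 : p⁻¹ * (k * (k⁻¹ * p * wp Γ w₁) * lt Γ s) = wp Γ (w₁ ++ [s]) := by simp; group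
  have e3 : (k * (k⁻¹ * p * wp Γ w₁) * lt Γ s)⁻¹ * h = wp Γ w₂ := by
    have : h = p * wp Γ (w₁ ++ s :: w₂) := by rw [h2]; group
    rw [this]; simp; group
  rw [e1, e2, e3, ← h2]
  have r1 := h1.left
  have r2 : IsRed Γ wt w₂ := IsRed.right (a := w₁ ++ [s]) (by simpa using h1)
  have r3 : IsRed Γ wt (w₁ ++ [s]) := IsRed.left (b := w₂) (by simpa using h1)
  rw [← h1, ← r1, ← r2, ← r3]
  simp [add_assoc]

end Length

/-- A convenient form of the existence of descents, for the constant weight. -/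
lemma exists_S' {g : RAAG Γ} (hg : g ≠ 1) : ∃ s, S s g :=
  exists_S (wt := fun _ : V => (1 : ℕ)) (fun _ => Nat.one_pos) hg

/-! ### Retractions and supports -/

open scoped Classical in
/-- The retraction onto a special subgroup. -/
def ret (Γ : SimpleGraph V) (J : Set V) : RAAG Γ →* RAAG Γ :=
  PresentedGroup.toGroup (f := fun v => if v ∈ J then raagGen Γ v else 1) (by
    rintro r ⟨v, w, h, rfl⟩
    simp only [map_mul, map_inv, FreeGroup.lift_apply_of]
    have := gen_comm h
    split_ifs <;> simp [this])

open scoped Classical in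
lemma ret_gen (J : Set V) (v : V) : ret Γ J (raagGen Γ v) = if v ∈ J then raagGen Γ v else 1 :=
  PresentedGroup.toGroup.of _

open scoped Classical in
lemma ret_lt (J : Set V) (s : V × Bool) : ret Γ J (lt Γ s) = if s.1 ∈ J then lt Γ s else 1 := by
  rcases s with ⟨x, b⟩
  cases b <;> simp only [lt_true, lt_false, map_inv, ret_gen] <;> split_ifs <;> simp

open scoped Classical in
lemma ret_wp (J : Set V) (w : List (V × Bool)) :
    ret Γ J (wp Γ w) = wp Γ (w.filter fun s => s.1 ∈ J) := by
  induction w with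
  | nil => simp
  | cons s w ih =>
    by_cases h : s.1 ∈ J <;> simp [h, ret_lt, ih]

lemma ret_mem (J : Set V) (g : RAAG Γ) : ret Γ J g ∈ SpecialSubgroup Γ J := by
  classical
  obtain ⟨w, rfl⟩ := exists_word g
  rw [ret_wp]
  exact wp_mem (by simp)

lemma ret_of_mem {J : Set V} {g : RAAG Γ} (hg : g ∈ SpecialSubgroup Γ J) : ret Γ J g = g := by
  classical
  obtain ⟨w, hw, rfl⟩ := exists_wp hg
  rw [ret_wp, List.filter_eq_self.2 (by simpa using hw)]

lemma ret_of_disjoint {J J' : Set V} (h : Disjoint J' J) {g : RAAG Γ}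
    (hg : g ∈ SpecialSubgroup Γ J') : ret Γ J g = 1 := by
  classical
  obtain ⟨w, hw, rfl⟩ := exists_wp hg
  rw [ret_wp, List.filter_eq_nil_iff.2, wp_nil]
  intro s hs
  simpa using Set.disjoint_left.1 h (hw s hs)

lemma special_mono {J J' : Set V} (h : J ⊆ J') : SpecialSubgroup Γ J ≤ SpecialSubgroup Γ J' :=
  Subgroup.closure_mono (Set.image_mono h)

section Support

variable {M : Type*} [AddCommMonoid M] [LinearOrder M] [IsOrderedCancelAddMonoid M]
  [WellFoundedLT M] {wt : V → M}

lemma wlen_filter_le (hpos : ∀ v, 0 < wt v) (p : V × Bool → Bool) (w : List (V × Bool)) :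
    wlen wt (w.filter p) ≤ wlen wt w := by
  induction w with
  | nil => simp
  | cons s w ih =>
    by_cases h : p s
    · simp only [List.filter_cons_of_pos h, wlen_cons]; gcongr
    · rw [List.filter_cons_of_neg (by simpa using h), wlen_cons]
      exact ih.trans (le_add_of_nonneg_left (hpos _).le)

lemma wlen_filter_lt (hpos : ∀ v, 0 < wt v) (p : V × Bool → Bool) {w : List (V × Bool)}
    {s : V × Bool} (hs : s ∈ w) (hp : p s = false) : wlen wt (w.filter p) < wlen wt w := by
  obtain ⟨a, b, rfl⟩ := List.append_of_mem hs
  have h1 := wlen_filter_le hpos p a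
  have h2 := wlen_filter_le hpos p b
  simp only [List.filter_append, List.filter_cons, hp, wlen_append, wlen_cons]
  have : wlen wt (b.filter p) < wt s.1 + wlen wt b :=
    lt_of_le_of_lt h2 (lt_add_of_pos_left _ (hpos _))
  simpa using add_lt_add_of_le_of_lt h1 this

lemma IsRed.support (hpos : ∀ v, 0 < wt v) {w : List (V × Bool)} {J : Set V}
    (h : IsRed Γ wt w) (hJ : wp Γ w ∈ SpecialSubgroup Γ J) : ∀ s ∈ w, s.1 ∈ J := by
  classical
  by_contra! h1
  obtain ⟨s, hs, hsJ⟩ := h1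
  have h2 := ret_of_mem hJ
  rw [ret_wp] at h2
  exact absurd (h.le h2) (not_le.2 (wlen_filter_lt hpos _ hs (by simpa using hsJ)))

end Support

lemma special_inter {J J' : Set V} {g : RAAG Γ} (h : g ∈ SpecialSubgroup Γ J)
    (h' : g ∈ SpecialSubgroup Γ J') : g ∈ SpecialSubgroup Γ (J ∩ J') := by
  obtain ⟨w, hw, rfl⟩ := exists_red (fun _ : V => (1 : ℕ)) g
  have hpos : ∀ v : V, 0 < (fun _ : V => (1 : ℕ)) v := fun _ => Nat.one_pos
  exact wp_mem fun s hs => ⟨hw.support hpos h s hs, hw.support hpos h' s hs⟩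

lemma special_empty {g : RAAG Γ} (h : g ∈ SpecialSubgroup Γ ∅) : g = 1 := by
  simpa [SpecialSubgroup] using h

/-! ### Abelianization -/

section Ab

variable (R : Type*) [CommRing R]

open scoped Classical in
/-- The abelianization homomorphism with coefficients in `R`. -/
def abHom (Γ : SimpleGraph V) : RAAG Γ →* Multiplicative (V → R) :=
  PresentedGroup.toGroup (f := fun v => Multiplicative.ofAdd (Pi.single v (1 : R))) (by
    rintro r ⟨v, w, h, rfl⟩
    simp only [map_mul, map_inv, FreeGroup.lift_apply_of]
    rw [mul_comm (Multiplicative.ofAdd _) (Multiplicative.ofAdd _)]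
    simp)

/-- The exponent-sum vector of a group element. -/
def ab (g : RAAG Γ) : V → R := (abHom R Γ g).toAdd

open scoped Classical in
lemma ab_gen (v : V) : ab R (raagGen Γ v) = Pi.single v 1 :=
  congrArg Multiplicative.toAdd (PresentedGroup.toGroup.of _)

@[simp] lemma ab_one : ab R (1 : RAAG Γ) = 0 := by simp [ab]
@[simp] lemma ab_mul (g h : RAAG Γ) : ab R (g * h) = ab R g + ab R h := by simp [ab]
@[simp] lemma ab_inv (g : RAAG Γ) : ab R g⁻¹ = -ab R g := by simp [ab]
@[simp] lemma ab_pow (g : RAAG Γ) (n : ℕ) : ab R (g ^ n) = n • ab R g := by simp [ab]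
@[simp] lemma ab_zpow (g : RAAG Γ) (n : ℤ) : ab R (g ^ n) = n • ab R g := by simp [ab]

lemma ab_conj (g h : RAAG Γ) : ab R (g * h * g⁻¹) = ab R h := by simp

lemma ab_special {J : Set V} {g : RAAG Γ} (hg : g ∈ SpecialSubgroup Γ J) {v : V} (hv : v ∉ J) :
    ab R g v = 0 := by
  classical
  induction hg using Subgroup.closure_induction with
  | mem x hx =>
    obtain ⟨y, hy, rfl⟩ := hx
    rw [ab_gen, Pi.single_eq_of_ne]
    rintro rfl; exact hv hy
  | one => simp
  | mul x y _ _ hx hy => simp [hx, hy]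
  | inv x _ hx => simp [hx]

variable [Fintype V]

/-- The linear map induced by an endomorphism on the abelianization. -/
def abMap (φ : RAAG Γ →* RAAG Γ) : (V → R) →ₗ[R] (V → R) :=
  Fintype.linearCombination R fun v => ab R (φ (raagGen Γ v))

lemma ab_map (φ : RAAG Γ →* RAAG Γ) (g : RAAG Γ) : ab R (φ g) = abMap R φ (ab R g) := by
  classical
  obtain ⟨w, rfl⟩ := exists_word g
  induction w with
  | nil => simp
  | cons s w ih =>
    have h : ∀ v, ab R (φ (raagGen Γ v)) = abMap R φ (ab R (raagGen Γ v)) := by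
      intro v; rw [ab_gen]; simp [abMap, Fintype.linearCombination_apply_single]
    rcases s with ⟨v, b⟩
    cases b <;> simp [ih, h]

lemma abMap_gen [DecidableEq V] (φ : RAAG Γ →* RAAG Γ) (v : V) :
    abMap R φ (Pi.single v 1) = ab R (φ (raagGen Γ v)) := by
  simp [abMap, Fintype.linearCombination_apply_single]

lemma abMap_comp_inv (φ : MulAut (RAAG Γ)) (x : V → R) :
    abMap R (φ : RAAG Γ →* RAAG Γ) (abMap R (φ⁻¹ : MulAut (RAAG Γ)).toMonoidHom x) = x := by
  classical
  have : (abMap R φ.toMonoidHom) ∘ₗ (abMap R (φ⁻¹ : MulAut (RAAG Γ)).toMonoidHom)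
      = LinearMap.id := by
    refine LinearMap.pi_ext' fun v => LinearMap.ext_ring ?_
    simp only [LinearMap.comp_apply, LinearMap.single_apply, LinearMap.id_apply]
    rw [abMap_gen, ← ab_map, ← ab_gen (Γ := Γ)]
    simp
  exact congrArg (fun f => f x) this

/-- The linear automorphism induced by an automorphism. -/
def abEquiv (φ : MulAut (RAAG Γ)) : (V → R) ≃ₗ[R] (V → R) :=
  { abMap R φ.toMonoidHom with
    invFun := abMap R (φ⁻¹ : MulAut (RAAG Γ)).toMonoidHom
    left_inv := fun x => by simpa using abMap_comp_inv R φ⁻¹ x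
    right_inv := fun x => abMap_comp_inv R φ x }

lemma ab_aut (φ : MulAut (RAAG Γ)) (g : RAAG Γ) : ab R (φ g) = abEquiv R φ (ab R g) :=
  ab_map R φ.toMonoidHom g

end Ab

end

section

/-! ### Automorphisms -/

/-- The endomorphism with prescribed values on generators. -/
def endo (f : V → RAAG Γ) (h : ∀ v w, Γ.Adj v w → f v * f w = f w * f v) : RAAG Γ →* RAAG Γ :=
  PresentedGroup.toGroup (f := f) (by
    rintro r ⟨v, w, hvw, rfl⟩
    simp only [map_mul, map_inv, FreeGroup.lift_apply_of]
    rw [h v w hvw]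
    group)

@[simp] lemma endo_gen (f : V → RAAG Γ) (h) (v : V) : endo f h (raagGen Γ v) = f v :=
  PresentedGroup.toGroup.of _

lemma hom_ext {G : Type*} [Group G] {φ ψ : RAAG Γ →* G}
    (h : ∀ v, φ (raagGen Γ v) = ψ (raagGen Γ v)) : φ = ψ :=
  PresentedGroup.ext h

lemma aut_ext {φ ψ : MulAut (RAAG Γ)} (h : ∀ v, φ (raagGen Γ v) = ψ (raagGen Γ v)) : φ = ψ := by
  have : φ.toMonoidHom = ψ.toMonoidHom := hom_ext h
  ext x
  exact DFunLike.congr_fun this x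

lemma aut_inv_gen {φ : MulAut (RAAG Γ)} {a b : RAAG Γ} (h : φ a = b) : φ⁻¹ b = a := by
  rw [← h]; exact MulAut.inv_apply_self _ φ a

/-- The automorphism given by two mutually inverse endomorphisms. -/
def mkAut (φ ψ : RAAG Γ →* RAAG Γ) (h1 : ∀ v, ψ (φ (raagGen Γ v)) = raagGen Γ v)
    (h2 : ∀ v, φ (ψ (raagGen Γ v)) = raagGen Γ v) : MulAut (RAAG Γ) :=
  MonoidHom.toMulEquiv φ ψ (hom_ext h1) (hom_ext h2)

@[simp] lemma mkAut_apply (φ ψ : RAAG Γ →* RAAG Γ) (h1 h2) (g : RAAG Γ) :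
    mkAut φ ψ h1 h2 g = φ g := rfl

lemma Inn_le_Aut0 : Inn (RAAG Γ) ≤ Aut0 Γ := fun _ h =>
  Subgroup.subset_closure (Or.inl (Or.inl (Or.inl h)))

lemma mem_Aut0_of_inversion {φ : MulAut (RAAG Γ)} {v : V} (h : IsInversionAt Γ φ v) :
    φ ∈ Aut0 Γ := Subgroup.subset_closure (Or.inl (Or.inl (Or.inr ⟨v, h⟩)))

lemma mem_Aut0_of_partialConj {φ : MulAut (RAAG Γ)} {v : V} {C : Set V}
    (hC : IsComponentOf Γ ((starOf Γ v)ᶜ) C) (h : IsPartialConjBy Γ φ v C) : φ ∈ Aut0 Γ :=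
  Subgroup.subset_closure (Or.inl (Or.inr ⟨v, C, hC, h⟩))

lemma mem_Aut0_of_transvection {φ : MulAut (RAAG Γ)} {w v : V} (h : IsTransvection Γ φ w v) :
    φ ∈ Aut0 Γ := Subgroup.subset_closure (Or.inr ⟨w, v, h⟩)

open scoped Classical in
lemma exists_inversion (Γ : SimpleGraph V) (u : V) : ∃ α ∈ Aut0 Γ,
    α (raagGen Γ u) = (raagGen Γ u)⁻¹ ∧ ∀ v, v ≠ u → α (raagGen Γ v) = raagGen Γ v := by
  let f : V → RAAG Γ := fun v => if v = u then (raagGen Γ v)⁻¹ else raagGen Γ v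
  have hf : ∀ v w, Γ.Adj v w → f v * f w = f w * f v := by
    intro v w hvw
    have h : Commute (raagGen Γ v) (raagGen Γ w) := gen_comm hvw
    simp only [f]
    split_ifs
    · exact h.inv_inv
    · exact h.inv_left
    · exact h.inv_right
    · exact h
  have h1 : ∀ v, endo f hf (endo f hf (raagGen Γ v)) = raagGen Γ v := by
    intro v
    by_cases h : v = u <;> simp [f, h]
  have h2 : IsInversionAt Γ (mkAut _ _ h1 h1) u := by
    constructor
    · simp [f]
    · intro v hv; simp [f, hv]
  exact ⟨_, mem_Aut0_of_inversion h2, h2⟩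

open scoped Classical in
lemma exists_transvection_aux {w v : V} (hne : v ≠ w) (hst : lk Γ w ⊆ starOf Γ v) :
    ∃ α ∈ Aut0 Γ, α (raagGen Γ w) = raagGen Γ w * raagGen Γ v ∧
      ∀ x, x ≠ w → α (raagGen Γ x) = raagGen Γ x := by
  let f : RAAG Γ → V → RAAG Γ := fun g x => if x = w then raagGen Γ x * g else raagGen Γ x
  have hf : ∀ g, (∀ x, Γ.Adj w x → Commute g (raagGen Γ x)) →
      ∀ x y, Γ.Adj x y → f g x * f g y = f g y * f g x := by
    intro g hg x y hxy
    have h : Commute (raagGen Γ x) (raagGen Γ y) := gen_comm hxy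
    simp only [f]
    split_ifs with h1 h2 h2
    · subst h1; subst h2; rfl
    · subst h1; exact Commute.mul_left h (hg _ hxy)
    · subst h2; exact Commute.mul_right h (hg _ hxy.symm).symm
    · exact h
  have hc : ∀ x, Γ.Adj w x → Commute (raagGen Γ v) (raagGen Γ x) := by
    intro x hx
    rcases hst hx with rfl | h
    · exact Commute.refl _
    · exact gen_comm h
  have hc' : ∀ x, Γ.Adj w x → Commute (raagGen Γ v)⁻¹ (raagGen Γ x) := fun x hx => (hc x hx).inv_left
  have h1 : ∀ x, endo _ (hf _ hc') (endo _ (hf _ hc) (raagGen Γ x)) = raagGen Γ x := by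
    intro x
    by_cases h : x = w <;> simp [f, h, hne]
  have h2 : ∀ x, endo _ (hf _ hc) (endo _ (hf _ hc') (raagGen Γ x)) = raagGen Γ x := by
    intro x
    by_cases h : x = w <;> simp [f, h, hne]
  have h3 : IsTransvection Γ (mkAut _ _ h1 h2) w v := by
    refine ⟨hne, hst, ?_, ?_⟩
    · simp [f]
    · intro x hx; simp [f, hx]
  exact ⟨_, mem_Aut0_of_transvection h3, h3.2.2⟩

lemma exists_transvection_right {w : V} {p : V × Bool} (hne : p.1 ≠ w)
    (hst : lk Γ w ⊆ starOf Γ p.1) :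
    ∃ α ∈ Aut0 Γ, α (raagGen Γ w) = raagGen Γ w * lt Γ p ∧
      ∀ x, x ≠ w → α (raagGen Γ x) = raagGen Γ x := by
  obtain ⟨α, h1, h2, h3⟩ := exists_transvection_aux hne hst
  rcases p with ⟨v, b⟩
  cases b
  · refine ⟨α⁻¹, inv_mem h1, aut_inv_gen ?_, fun x hx => aut_inv_gen (h3 x hx)⟩
    simp only at hne
    simp [h2, h3 v hne]
  · exact ⟨α, h1, by simpa using h2, h3⟩

lemma exists_transvection_left {w : V} {p : V × Bool} (hne : p.1 ≠ w)
    (hst : lk Γ w ⊆ starOf Γ p.1) :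
    ∃ α ∈ Aut0 Γ, α (raagGen Γ w) = lt Γ p * raagGen Γ w ∧
      ∀ x, x ≠ w → α (raagGen Γ x) = raagGen Γ x := by
  obtain ⟨α, h1, h2, h3⟩ := exists_transvection_right (p := flip p) hne hst
  obtain ⟨ι, i1, i2, i3⟩ := exists_inversion Γ w
  have hp : ι (lt Γ p) = lt Γ p := by
    rcases p with ⟨v, b⟩
    cases b <;> simp [i3 v hne]
  refine ⟨ι * α * ι, mul_mem (mul_mem i1 h1) i1, ?_, fun x hx => ?_⟩
  · simp [i2, h2, hp]
  · simp [i3 x hx, h3 x hx]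

open scoped Classical in
lemma exists_partialConj_aux {u : V} {C : Set V} (hC : IsComponentOf Γ ((starOf Γ u)ᶜ) C) :
    ∃ α ∈ Aut0 Γ, (∀ x ∈ C, α (raagGen Γ x) = (raagGen Γ u)⁻¹ * raagGen Γ x * raagGen Γ u) ∧
      ∀ x, x ∉ C → α (raagGen Γ x) = raagGen Γ x := by
  let f : RAAG Γ → V → RAAG Γ := fun g x => if x ∈ C then g⁻¹ * raagGen Γ x * g else raagGen Γ x
  have hadj : ∀ x y, x ∈ C → y ∉ C → Γ.Adj x y → Γ.Adj u y := by
    intro x y hx hy hxy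
    by_contra h
    refine hy (hC.2.2.2 x hx y ?_ hxy)
    rintro (rfl | h')
    · exact hC.1 hx (Or.inr hxy.symm)
    · exact h h'
  have hu : u ∉ C := fun h => hC.1 h (Or.inl rfl)
  have hf : ∀ g, (∀ x, Γ.Adj u x → Commute g (raagGen Γ x)) →
      ∀ x y, Γ.Adj x y → f g x * f g y = f g y * f g x := by
    intro g hg x y hxy
    have h : Commute (raagGen Γ x) (raagGen Γ y) := gen_comm hxy
    simp only [f]
    split_ifs with h1 h2 h2
    · have := congrArg (fun z => g⁻¹ * z * g) h.eq
      simpa [mul_assoc] using this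
    · have := hg _ (hadj x y h1 h2 hxy)
      exact Commute.mul_left (Commute.mul_left this.inv_left h) this
    · have := (hg _ (hadj y x h2 h1 hxy.symm)).symm
      exact Commute.mul_right (Commute.mul_right this.inv_right h) this
    · exact h
  have hc : ∀ x, Γ.Adj u x → Commute (raagGen Γ u) (raagGen Γ x) := fun x hx => gen_comm hx
  have hc' : ∀ x, Γ.Adj u x → Commute (raagGen Γ u)⁻¹ (raagGen Γ x) :=
    fun x hx => (hc x hx).inv_left
  have h1 : ∀ x, endo _ (hf _ hc') (endo _ (hf _ hc) (raagGen Γ x)) = raagGen Γ x := by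
    intro x
    by_cases h : x ∈ C <;> simp [f, h, hu, mul_assoc]
  have h2 : ∀ x, endo _ (hf _ hc) (endo _ (hf _ hc') (raagGen Γ x)) = raagGen Γ x := by
    intro x
    by_cases h : x ∈ C <;> simp [f, h, hu, mul_assoc]
  have h3 : IsPartialConjBy Γ (mkAut _ _ h1 h2) u C := by
    constructor
    · intro x hx; simp [f, hx]
    · intro x hx; simp [f, hx]
  exact ⟨_, mem_Aut0_of_partialConj hC h3, h3⟩

lemma exists_partialConj {p : V × Bool} {C : Set V}
    (hC : IsComponentOf Γ ((starOf Γ p.1)ᶜ) C) :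
    ∃ α ∈ Aut0 Γ, (∀ x ∈ C, α (raagGen Γ x) = (lt Γ p)⁻¹ * raagGen Γ x * lt Γ p) ∧
      ∀ x, x ∉ C → α (raagGen Γ x) = raagGen Γ x := by
  obtain ⟨α, h1, h2, h3⟩ := exists_partialConj_aux hC
  rcases p with ⟨u, b⟩
  have hu : u ∉ C := fun h => hC.1 h (Or.inl rfl)
  cases b
  · refine ⟨α⁻¹, inv_mem h1, fun x hx => aut_inv_gen ?_, fun x hx => aut_inv_gen (h3 x hx)⟩
    simp [h2 x hx, h3 u hu, mul_assoc]
  · exact ⟨α, h1, by simpa using h2, h3⟩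

/-- The automorphism induced by a graph symmetry. -/
def symAut (σ : Γ ≃g Γ) : MulAut (RAAG Γ) :=
  mkAut (endo (fun v => raagGen Γ (σ v)) fun _ _ h => gen_comm (σ.map_rel_iff.2 h))
    (endo (fun v => raagGen Γ (σ.symm v)) fun _ _ h => gen_comm (σ.symm.map_rel_iff.2 h))
    (by simp) (by simp)

@[simp] lemma symAut_gen (σ : Γ ≃g Γ) (v : V) : symAut σ (raagGen Γ v) = raagGen Γ (σ v) := by
  simp [symAut]

lemma map_special (φ : MulAut (RAAG Γ)) (J : Set V) (H : Subgroup (RAAG Γ))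
    (h : ∀ v ∈ J, φ (raagGen Γ v) ∈ H) {g : RAAG Γ} (hg : g ∈ SpecialSubgroup Γ J) : φ g ∈ H := by
  have : SpecialSubgroup Γ J ≤ H.comap φ.toMonoidHom := by
    refine (Subgroup.closure_le _).2 ?_
    rintro _ ⟨v, hv, rfl⟩
    exact h v hv
  exact this hg

end

section

/-! ### Automorphisms adapted to the domination structure -/

/-- The vertices whose link contains the link of `v`. -/
def Uset (Γ : SimpleGraph V) (v : V) : Set V := {x | lk Γ v ⊆ lk Γ x}

/-- The join subgroup associated to `v`. -/
abbrev Nsub (Γ : SimpleGraph V) (v : V) : Subgroup (RAAG Γ) :=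
  SpecialSubgroup Γ (Uset Γ v ∪ lk Γ v)

lemma self_mem_Uset (v : V) : v ∈ Uset Γ v := fun _ h => h

lemma mem_lk {v w : V} : w ∈ lk Γ v ↔ Γ.Adj v w := Iff.rfl

lemma Uset_adj {v x y : V} (hx : x ∈ Uset Γ v) (hy : y ∈ lk Γ v) : Γ.Adj x y := hx hy

lemma Uset_trans {v x y : V} (hx : x ∈ Uset Γ v) (hy : y ∈ Uset Γ x) : y ∈ Uset Γ v :=
  fun _ h => hy (hx h)

lemma special_le_normalizer {J K : Set V} (h : ∀ x ∈ J, ∀ y ∈ K, Γ.Adj x y) :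
    SpecialSubgroup Γ (J ∪ K) ≤ Subgroup.normalizer (SpecialSubgroup Γ K : Set (RAAG Γ)) := by
  refine (Subgroup.closure_le _).2 ?_
  rintro _ ⟨x, hx | hx, rfl⟩
  · have hc : ∀ g ∈ SpecialSubgroup Γ K, Commute (raagGen Γ x) g := by
      intro g hg
      have : SpecialSubgroup Γ K ≤ LS Γ x := special_mono fun y hy => h x hx y hy
      exact (LS_commute (this hg)).symm
    rw [SetLike.mem_coe, Subgroup.mem_normalizer_iff]
    intro g
    constructor
    · intro hg
      rw [(hc g hg).eq]; simpa using hg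
    · intro hg
      have h1 := (hc _ hg).eq
      have h2 : raagGen Γ x * g * (raagGen Γ x)⁻¹ = g := by
        apply mul_left_cancel (a := raagGen Γ x)
        rw [h1]; simp
      rwa [h2] at hg
  · exact Subgroup.le_normalizer (gen_mem hx)

lemma conj_mem_special {J K : Set V} (h : ∀ x ∈ J, ∀ y ∈ K, Γ.Adj x y) {b f : RAAG Γ}
    (hb : b ∈ SpecialSubgroup Γ (J ∪ K)) (hf : f ∈ SpecialSubgroup Γ K) :
    b⁻¹ * f * b ∈ SpecialSubgroup Γ K := by
  have := (Subgroup.mem_normalizer_iff.1 (inv_mem (special_le_normalizer h hb)) f).1 hf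
  simpa using this

lemma conj_mem_lk {v : V} {b f : RAAG Γ} (hb : b ∈ Nsub Γ v) (hf : f ∈ LS Γ v) :
    b⁻¹ * f * b ∈ LS Γ v :=
  conj_mem_special (fun _ hx _ hy => Uset_adj hx hy) hb hf

lemma conj_mem_U {v : V} {b f : RAAG Γ} (hb : b ∈ Nsub Γ v)
    (hf : f ∈ SpecialSubgroup Γ (Uset Γ v)) : b⁻¹ * f * b ∈ SpecialSubgroup Γ (Uset Γ v) :=
  conj_mem_special (J := lk Γ v) (fun _ hx _ hy => (Uset_adj hy hx).symm)
    (by rwa [Set.union_comm]) hf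

/-- An automorphism preserving, up to conjugacy, the subgroups generated by the dominating
sets, with conjugating elements `g` that are compatible along edges. -/
structure Good (φ : MulAut (RAAG Γ)) (g : V → RAAG Γ) : Prop where
  dom : ∀ v, ∀ x ∈ Uset Γ v, (g v)⁻¹ * φ (raagGen Γ x) * g v ∈ SpecialSubgroup Γ (Uset Γ v)
  edge : ∀ u v, Γ.Adj u v → ∃ a ∈ Nsub Γ u, ∃ b ∈ Nsub Γ v, (g u)⁻¹ * g v = a * b

lemma Good.lk_gen {φ : MulAut (RAAG Γ)} {g : V → RAAG Γ} (h : Good φ g) {v x : V}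
    (hx : Γ.Adj v x) : (g v)⁻¹ * φ (raagGen Γ x) * g v ∈ LS Γ v := by
  obtain ⟨a, ha, b, hb, hab⟩ := h.edge x v hx.symm
  have h1 := h.dom x x (self_mem_Uset x)
  have h2 := conj_mem_U ha h1
  have h3 : SpecialSubgroup Γ (Uset Γ x) ≤ LS Γ v :=
    special_mono fun y hy => (Uset_adj hy (show v ∈ lk Γ x from hx.symm)).symm
  have h4 := conj_mem_lk hb (h3 h2)
  have h5 : g v = g x * (a * b) := by rw [← hab]; simp
  rw [h5]
  simpa [mul_assoc] using h4

lemma conj_lt_mem {φ : MulAut (RAAG Γ)} {h : RAAG Γ} {H : Subgroup (RAAG Γ)} {p : V × Bool}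
    (hp : h⁻¹ * φ (raagGen Γ p.1) * h ∈ H) : h⁻¹ * φ (lt Γ p) * h ∈ H := by
  rcases p with ⟨x, b⟩
  cases b
  · have := inv_mem hp
    simpa [mul_assoc] using this
  · simpa using hp

lemma Good.lk_lt {φ : MulAut (RAAG Γ)} {g : V → RAAG Γ} (h : Good φ g) {v : V} {p : V × Bool}
    (hx : Γ.Adj v p.1) : (g v)⁻¹ * φ (lt Γ p) * g v ∈ LS Γ v :=
  conj_lt_mem (h.lk_gen hx)

lemma Good.dom_lt {φ : MulAut (RAAG Γ)} {g : V → RAAG Γ} (h : Good φ g) {v : V} {p : V × Bool}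
    (hx : p.1 ∈ Uset Γ v) : (g v)⁻¹ * φ (lt Γ p) * g v ∈ SpecialSubgroup Γ (Uset Γ v) :=
  conj_lt_mem (h.dom v _ hx)

lemma Good.transvection {φ α : MulAut (RAAG Γ)} {g : V → RAAG Γ} (h : Good φ g) {w : V}
    {p : V × Bool} (hp : p.1 ∈ Uset Γ w)
    (h1 : α (raagGen Γ w) = raagGen Γ w * lt Γ p ∨ α (raagGen Γ w) = lt Γ p * raagGen Γ w)
    (h2 : ∀ x, x ≠ w → α (raagGen Γ x) = raagGen Γ x) : Good (φ * α) g := by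
  refine ⟨fun v x hx => ?_, h.edge⟩
  by_cases hxw : x = w
  · subst hxw
    have i1 := h.dom v x hx
    have i2 := h.dom_lt (p := p) (Uset_trans hx hp)
    rcases h1 with h1 | h1
    · have := mul_mem i1 i2
      simpa [h1, mul_assoc] using this
    · have := mul_mem i2 i1
      simpa [h1, mul_assoc] using this
  · simpa [h2 x hxw] using h.dom v x hx

open scoped Classical in
lemma Good.partialConj {φ α : MulAut (RAAG Γ)} {g : V → RAAG Γ}
    (h : Good φ g) {p : V × Bool} {C : Set V} (hC : IsComponentOf Γ ((starOf Γ p.1)ᶜ) C)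
    (h1 : ∀ x ∈ C, α (raagGen Γ x) = (lt Γ p)⁻¹ * raagGen Γ x * lt Γ p)
    (h2 : ∀ x, x ∉ C → α (raagGen Γ x) = raagGen Γ x) :
    Good (φ * α) (fun t => if t ∈ C then (φ (lt Γ p))⁻¹ * g t else g t) := by
  have hstar : ∀ x ∈ C, x ≠ p.1 ∧ ¬ Γ.Adj p.1 x := fun x hx =>
    ⟨fun e => hC.1 hx (Or.inl e), fun e => hC.1 hx (Or.inr e)⟩
  have hclosed : ∀ x ∈ C, ∀ y, Γ.Adj x y → y ∉ C → Γ.Adj p.1 y := by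
    intro x hx y hxy hy
    by_contra hn
    refine hy (hC.2.2.2 x hx y ?_ hxy)
    rintro (rfl | h')
    · exact (hstar x hx).2 hxy.symm
    · exact hn h'
  constructor
  · intro t x hx
    have key : p.1 ∈ Uset Γ t → (g t)⁻¹ * φ (lt Γ p) * φ (raagGen Γ x) * (φ (lt Γ p))⁻¹ * g t
        ∈ SpecialSubgroup Γ (Uset Γ t) ∧
        (g t)⁻¹ * (φ (lt Γ p))⁻¹ * φ (raagGen Γ x) * φ (lt Γ p) * g t
        ∈ SpecialSubgroup Γ (Uset Γ t) := by
      intro hp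
      have i1 := h.dom t x hx
      have i2 := h.dom_lt (p := p) hp
      have i3 := mul_mem (mul_mem i2 i1) (inv_mem i2)
      have i4 := mul_mem (mul_mem (inv_mem i2) i1) i2
      exact ⟨by simpa [mul_assoc] using i3, by simpa [mul_assoc] using i4⟩
    by_cases ht : t ∈ C
    · by_cases hxC : x ∈ C
      · simpa [ht, h1 x hxC, mul_assoc] using h.dom t x hx
      · simp only [ht, if_true, MulAut.mul_apply, h2 x hxC]
        have hcomm : Γ.Adj p.1 x ∨ x = p.1 → Commute (φ (lt Γ p)) (φ (raagGen Γ x)) := by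
          intro hh
          refine Commute.map (f := φ) ?_
          rcases hh with hh | rfl
          · exact lt_commute (s := (x, true)) (by simpa using hh) |> fun q => by simpa using q
          · rcases p with ⟨u, b⟩
            cases b
            · simp
            · simp
        have hfin : Commute (φ (lt Γ p)) (φ (raagGen Γ x)) →
            ((φ (lt Γ p))⁻¹ * g t)⁻¹ * φ (raagGen Γ x) * ((φ (lt Γ p))⁻¹ * g t) ∈
              SpecialSubgroup Γ (Uset Γ t) := by
          intro hc
          have e : ((φ (lt Γ p))⁻¹ * g t)⁻¹ * φ (raagGen Γ x) * ((φ (lt Γ p))⁻¹ * g t) =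
              (g t)⁻¹ * φ (raagGen Γ x) * g t := by
            have : φ (lt Γ p) * (φ (raagGen Γ x) * ((φ (lt Γ p))⁻¹ * g t)) =
              φ (raagGen Γ x) * g t := by
              rw [← mul_assoc, hc.eq]; simp [mul_assoc]
            simp [mul_assoc, this]
          rw [e]; exact h.dom t x hx
        by_cases hx1 : Γ.Adj p.1 x ∨ x = p.1
        · exact hfin (hcomm hx1)
        · have hp : p.1 ∈ Uset Γ t := by
            intro y hy
            by_cases hyC : y ∈ C
            · exact absurd (Or.inl (hclosed y hyC x (Uset_adj hx hy).symm hxC)) hx1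
            · exact hclosed t ht y hy hyC
          simpa [mul_assoc] using (key hp).1
    · by_cases hxC : x ∈ C
      · simp only [ht, if_false, MulAut.mul_apply, h1 x hxC]
        have hp : p.1 ∈ Uset Γ t := by
          by_cases ht1 : t = p.1
          · rw [ht1]; exact self_mem_Uset _
          by_cases ht2 : Γ.Adj p.1 t
          · exact absurd (Uset_adj hx (show p.1 ∈ lk Γ t from ht2.symm)).symm (hstar x hxC).2
          intro y hy
          have hxy := Uset_adj hx hy
          by_cases hyC : y ∈ C
          · exact absurd (hclosed y hyC t (SimpleGraph.Adj.symm hy) ht) ht2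
          · exact hclosed x hxC y hxy hyC
        simpa [mul_assoc] using (key hp).2
      · simpa [ht, h2 x hxC] using h.dom t x hx
  · intro t t' htt
    obtain ⟨a, ha, b, hb, hab⟩ := h.edge t t' htt
    have hLN : ∀ v, LS Γ v ≤ Nsub Γ v := fun v => special_mono Set.subset_union_right
    by_cases ht : t ∈ C <;> by_cases ht' : t' ∈ C
    · exact ⟨a, ha, b, hb, by simpa [ht, ht', mul_assoc] using hab⟩
    · have h3 := hclosed t ht t' htt ht'
      have h4 := hLN _ (h.lk_lt (p := p) h3.symm)
      refine ⟨a, ha, b * _, mul_mem hb h4, ?_⟩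
      simp only [ht, ht', if_true, if_false]
      rw [← mul_assoc, ← hab]
      simp [mul_assoc]
    · have h3 := hclosed t' ht' t htt.symm ht
      have h4 := hLN _ (h.lk_lt (p := p) h3.symm)
      refine ⟨_ * a, mul_mem (inv_mem h4) ha, b, hb, ?_⟩
      simp only [ht, ht', if_true, if_false]
      rw [mul_assoc _ a b, ← hab]
      simp [mul_assoc]
    · exact ⟨a, ha, b, hb, by simpa [ht, ht'] using hab⟩

lemma Good.mul_right {φ : MulAut (RAAG Γ)} {g f : V → RAAG Γ} (h : Good φ g)
    (hf : ∀ v, f v ∈ SpecialSubgroup Γ (Uset Γ v)) : Good φ (fun v => g v * f v) := by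
  have hLN : ∀ v, SpecialSubgroup Γ (Uset Γ v) ≤ Nsub Γ v := fun v =>
    special_mono Set.subset_union_left
  constructor
  · intro v x hx
    have := mul_mem (mul_mem (inv_mem (hf v)) (h.dom v x hx)) (hf v)
    simpa [mul_assoc] using this
  · intro u v huv
    obtain ⟨a, ha, b, hb, hab⟩ := h.edge u v huv
    refine ⟨(f u)⁻¹ * a, mul_mem (inv_mem (hLN u (hf u))) ha, b * f v,
      mul_mem hb (hLN v (hf v)), ?_⟩
    have : (g u * f u)⁻¹ * (g v * f v) = (f u)⁻¹ * ((g u)⁻¹ * g v) * f v := by simp [mul_assoc]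
    rw [this, hab]; simp [mul_assoc]

section Minimal

variable {M : Type*} [AddCommMonoid M] [LinearOrder M] [IsOrderedCancelAddMonoid M]
  [WellFoundedLT M]

/-- A good automorphism that cannot be shortened by transvections and partial conjugations, with
shortest conjugating elements. -/
structure Tight (wt : V → M) (φ : MulAut (RAAG Γ)) (g : V → RAAG Γ) : Prop extends Good φ g where
  right_le : ∀ v, ∀ p : V × Bool, p.1 ∈ Uset Γ v → p.1 ≠ v →
    om wt (φ (raagGen Γ v)) ≤ om wt (φ (raagGen Γ v) * φ (lt Γ p))
  left_le : ∀ v, ∀ p : V × Bool, p.1 ∈ Uset Γ v → p.1 ≠ v →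
    om wt (φ (raagGen Γ v)) ≤ om wt (φ (lt Γ p) * φ (raagGen Γ v))
  conj_le : ∀ (p : V × Bool) (C : Set V), IsComponentOf Γ ((starOf Γ p.1)ᶜ) C →
    ∃ t ∈ C, om wt (φ (raagGen Γ t)) ≤ om wt ((φ (lt Γ p))⁻¹ * φ (raagGen Γ t) * φ (lt Γ p))
  base : ∀ v s, s.1 ∈ Uset Γ v → ¬ S s (g v)⁻¹

lemma Good.exists_base {wt : V → M} (hpos : ∀ v, 0 < wt v) {φ : MulAut (RAAG Γ)}
    {g : V → RAAG Γ} (h : Good φ g) :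
    ∃ g', Good φ g' ∧ ∀ v s, s.1 ∈ Uset Γ v → ¬ S s (g' v)⁻¹ := by
  have hex : ∀ v, ∃ f ∈ SpecialSubgroup Γ (Uset Γ v), ∀ f' ∈ SpecialSubgroup Γ (Uset Γ v),
      om wt (g v * f) ≤ om wt (g v * f') := by
    intro v
    let T : Set M := {m | ∃ f ∈ SpecialSubgroup Γ (Uset Γ v), om wt (g v * f) = m}
    have hT : T.Nonempty := ⟨_, 1, one_mem _, rfl⟩
    obtain ⟨f, hf, e⟩ := wellFounded_lt.min_mem T hT
    refine ⟨f, hf, fun f' hf' => ?_⟩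
    rw [e]
    exact not_lt.1 (wellFounded_lt.not_lt_min T ⟨f', hf', rfl⟩)
  choose f hf hmin using hex
  refine ⟨_, h.mul_right hf, fun v s hs hS => ?_⟩
  have h1 := om_of_S (wt := wt) hS
  have h2 := hmin v (f v * lt Γ s) (mul_mem (hf v) (lt_mem hs))
  have h3 : (lt Γ s)⁻¹ * (g v * f v)⁻¹ = (g v * (f v * lt Γ s))⁻¹ := by simp [mul_assoc]
  rw [h3, om_inv, om_inv] at h1
  rw [h1] at h2
  exact absurd h2 (not_le.2 (lt_add_of_pos_left _ (hpos _)))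

lemma Good.exists_tight [Fintype V] {wt : V → M}
    (hpos : ∀ v, 0 < wt v) {φ : MulAut (RAAG Γ)} {g : V → RAAG Γ} (h : Good φ g) :
    ∃ α ∈ Aut0 Γ, ∃ g', Tight wt (φ * α) g' := by
  classical
  let T : Set M := {m | ∃ α ∈ Aut0 Γ, (∃ g', Good (φ * α) g') ∧
    ∑ v, om wt ((φ * α) (raagGen Γ v)) = m}
  have hT : T.Nonempty := ⟨_, 1, one_mem _, ⟨g, by simpa using h⟩, rfl⟩
  obtain ⟨α, hα, ⟨g', hg'⟩, e⟩ := wellFounded_lt.min_mem T hT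
  obtain ⟨g'', hg'', hb⟩ := hg'.exists_base hpos
  have hmin : ∀ β ∈ Aut0 Γ, (∃ g', Good (φ * α * β) g') →
      ∑ v, om wt ((φ * α) (raagGen Γ v)) ≤ ∑ v, om wt ((φ * α * β) (raagGen Γ v)) := by
    intro β hβ hg
    rw [e]
    exact not_lt.1 (wellFounded_lt.not_lt_min T
      ⟨α * β, mul_mem hα hβ, by rwa [← mul_assoc], by rw [← mul_assoc]⟩)
  have hone : ∀ β ∈ Aut0 Γ, (∃ g', Good (φ * α * β) g') → ∀ v,
      (∀ x, x ≠ v → β (raagGen Γ x) = raagGen Γ x) →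
      om wt ((φ * α) (raagGen Γ v)) ≤ om wt ((φ * α) (β (raagGen Γ v))) := by
    intro β hβ hg v hv
    have h1 := hmin β hβ hg
    rw [← Finset.add_sum_erase _ _ (Finset.mem_univ v),
      ← Finset.add_sum_erase Finset.univ (fun v => om wt ((φ * α * β) (raagGen Γ v)))
        (Finset.mem_univ v)] at h1
    have hs : ∑ x ∈ Finset.univ.erase v, om wt ((φ * α * β) (raagGen Γ x)) =
        ∑ x ∈ Finset.univ.erase v, om wt ((φ * α) (raagGen Γ x)) :=
      Finset.sum_congr rfl fun x hx => by
        rw [MulAut.mul_apply _ (φ * α) β, hv x (Finset.ne_of_mem_erase hx)]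
    rw [hs] at h1
    exact le_of_add_le_add_right h1
  have hst : ∀ {v : V} {p : V × Bool}, p.1 ∈ Uset Γ v → lk Γ v ⊆ starOf Γ p.1 :=
    fun hp y hy => Or.inr (hp hy)
  refine ⟨α, hα, g'', ⟨hg'', ?_, ?_, ?_, hb⟩⟩
  · intro v p hp hpv
    obtain ⟨β, hβ, b1, b2⟩ := exists_transvection_right hpv (hst hp)
    simpa [b1] using hone β hβ ⟨_, hg''.transvection hp (Or.inl b1) b2⟩ v b2
  · intro v p hp hpv
    obtain ⟨β, hβ, b1, b2⟩ := exists_transvection_left hpv (hst hp)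
    simpa [b1] using hone β hβ ⟨_, hg''.transvection hp (Or.inr b1) b2⟩ v b2
  · intro p C hC
    by_contra! hlt
    obtain ⟨β, hβ, b1, b2⟩ := exists_partialConj hC
    have h1 := hmin β hβ ⟨_, hg''.partialConj hC b1 b2⟩
    refine absurd h1 (not_le.2 (Finset.sum_lt_sum (fun v _ => ?_) ?_))
    · by_cases hv : v ∈ C
      · have := (hlt v hv).le
        simpa [b1 v hv] using this
      · simp [b2 v hv]
    · obtain ⟨v, hv⟩ := hC.2.1
      refine ⟨v, Finset.mem_univ _, ?_⟩
      have := hlt v hv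
      simpa [b1 v hv] using this

end Minimal

end

section

/-! ### Reduced words in free special subgroups, and balanced cuts -/

section Free

variable {M : Type*} [AddCommMonoid M] [LinearOrder M] [IsOrderedCancelAddMonoid M]
  [WellFoundedLT M] {wt : V → M} (hpos : ∀ v, 0 < wt v)
include hpos

lemma not_isRed_cancel {c d : List (V × Bool)} {r : V × Bool} :
    ¬ IsRed Γ wt (c ++ r :: flip r :: d) := by
  intro h
  have h1 : IsRed Γ wt (c ++ [r, flip r] ++ d) := by simpa using h
  have h2 := h1.middle
  have h3 : wp Γ [r, flip r] = 1 := by simp [wp_cons, lt_flip, wp_nil]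
  rw [IsRed, h3, om_one hpos, wlen_cons, wlen_cons, wlen_nil] at h2
  have := add_pos (hpos r.1) (hpos r.1)
  simp only [flip_fst, add_zero] at h2
  exact this.ne' h2

lemma free_reduced_mul {J : Set V} (hJ : ∀ x ∈ J, ∀ y ∈ J, ¬ Γ.Adj x y) {h : RAAG Γ}
    (hh : ∀ s : V × Bool, s.1 ∈ J → ¬ S s h) {w : List (V × Bool)} (hw : IsRed Γ wt w)
    (hwJ : ∀ s ∈ w, s.1 ∈ J) : om wt (wp Γ w * h) = wlen wt w + om wt h ∧
      ∀ s : V × Bool, s.1 ∈ J → S s (wp Γ w * h) → ∃ w', w = s :: w' := by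
  induction w with
  | nil => exact ⟨by simp [wp_nil, wlen_nil], fun s hs h1 => absurd (by simpa using h1) (hh s hs)⟩
  | cons r w ih =>
    have hr : r.1 ∈ J := hwJ r (by simp)
    obtain ⟨ih1, ih2⟩ := ih (IsRed.right (a := [r]) hw) fun s hs => hwJ s (by simp [hs])
    have h1 : ¬ S (flip r) (wp Γ w * h) := by
      intro h1
      obtain ⟨w', rfl⟩ := ih2 _ (by simpa using hr) h1
      exact not_isRed_cancel hpos (c := []) (by simpa using hw)
    have h2 : S r (lt Γ r * (wp Γ w * h)) := by
      have := (S_flip (flip r) (lt Γ r * (wp Γ w * h))).2 (by simpa [lt_flip] using h1)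
      simpa using this
    rw [wp_cons, mul_assoc]
    refine ⟨?_, fun s hs h3 => ?_⟩
    · rw [om_of_S h2, wlen_cons, inv_mul_cancel_left, ih1, add_assoc]
    · by_cases hsr : r = s
      · exact ⟨w, by rw [hsr]⟩
      · exact (S_disjoint (hJ _ hr _ hs) hsr h2 h3).elim

end Free

section Cut

variable [Fintype V] [LinearOrder V]

/-- Multisets of vertices, compared lexicographically. -/
def LexW (V : Type*) : Type _ := Lex (V → ℕ)

instance : AddCommMonoid (LexW V) := inferInstanceAs (AddCommMonoid (Lex (V → ℕ)))

instance : LinearOrder (LexW V) := inferInstanceAs (LinearOrder (Lex (V → ℕ)))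

instance : IsOrderedCancelAddMonoid (LexW V) :=
  inferInstanceAs (IsOrderedCancelAddMonoid (Lex (V → ℕ)))

instance : WellFoundedLT (LexW V) := inferInstanceAs (WellFoundedLT (Lex (V → ℕ)))

/-- The multiplicity of a vertex. -/
def LexW.mult (m : LexW V) (x : V) : ℕ := ofLex (α := V → ℕ) m x

lemma LexW.lt_iff {m n : LexW V} :
    m < n ↔ ∃ i, (∀ j < i, m.mult j = n.mult j) ∧ m.mult i < n.mult i := Iff.rfl

@[simp] lemma LexW.mult_add (m n : LexW V) (x : V) : (m + n).mult x = m.mult x + n.mult x := rfl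

@[simp] lemma LexW.mult_zero (x : V) : (0 : LexW V).mult x = 0 := rfl

/-- The lexicographic weight of a vertex. -/
def lexWt (v : V) : LexW V := toLex (α := V → ℕ) (Pi.single v 1)

lemma mult_lexWt (v x : V) : (lexWt v).mult x = if x = v then 1 else 0 := by
  simp [LexW.mult, lexWt, Pi.single_apply]

lemma lexWt_pos (v : V) : 0 < lexWt v :=
  LexW.lt_iff.2 ⟨v, fun j hj => by simp [mult_lexWt, hj.ne], by simp [mult_lexWt]⟩

lemma ab_lt_zmod (s : V × Bool) : ab (ZMod 2) (lt Γ s) = Pi.single s.1 1 := by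
  rcases s with ⟨v, b⟩
  cases b
  · rw [lt_false, ab_inv, ab_gen]
    funext x
    rw [Pi.neg_apply, ZMod.neg_eq_self_mod_two]
    congr!
  · rw [lt_true, ab_gen]
    congr!

lemma wlen_lexWt_parity (w : List (V × Bool)) (x : V) :
    ((wlen lexWt w).mult x : ZMod 2) = ab (ZMod 2) (wp Γ w) x := by
  induction w with
  | nil => simp [wlen_nil, wp_nil]
  | cons s w ih =>
    rw [wlen_cons, wp_cons, ab_mul, Pi.add_apply, ← ih, ab_lt_zmod, LexW.mult_add,
      Nat.cast_add, mult_lexWt, Pi.single_apply]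
    simp

lemma exists_first_cut {w a : List (V × Bool)} (h : wlen lexWt a ≤ wlen lexWt w)
    (hne : a ++ w ≠ []) : ∃ a' s b, a ++ w = a' ++ s :: b ∧
      wlen lexWt a' ≤ wlen lexWt b + lexWt s.1 ∧ wlen lexWt b < wlen lexWt a' + lexWt s.1 := by
  induction w generalizing a with
  | nil =>
    rcases a with - | ⟨s, a⟩
    · simp at hne
    · rw [wlen_nil, wlen_cons] at h
      have := add_pos_of_pos_of_nonneg (lexWt_pos s.1) (wlen_nonneg lexWt_pos a)
      exact absurd h (not_le.2 this)
  | cons s w ih =>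
    by_cases h1 : wlen lexWt (a ++ [s]) ≤ wlen lexWt w
    · obtain ⟨a', s', b, e, h2⟩ := ih h1 (by simp)
      exact ⟨a', s', b, by rw [← e]; simp, h2⟩
    · refine ⟨a, s, w, rfl, ?_, ?_⟩
      · rwa [wlen_cons, add_comm] at h
      · simpa [wlen_append, wlen_cons, wlen_nil] using h1

lemma lexWt_aux {m n : LexW V} {x y : V} (hodd : m.mult x ≠ n.mult x) (hxy : x < y)
    (h1 : m < n + lexWt y) : m < n := by
  rcases lt_trichotomy m n with h | h | h
  · exact h
  · exact absurd (by rw [h]) hodd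
  · exfalso
    obtain ⟨i, hi, hlt⟩ := LexW.lt_iff.1 h
    have hix : i ≤ x := by
      by_contra hx
      exact hodd (hi x (not_le.1 hx)).symm
    have hs : ∀ j ≤ i, (n + lexWt y).mult j = n.mult j := by
      intro j hj
      have : j ≠ y := (lt_of_le_of_lt (hj.trans hix) hxy).ne
      simp [mult_lexWt, this]
    have : n + lexWt y < m := LexW.lt_iff.2
      ⟨i, fun j hj => (hs j hj.le).trans (hi j hj), (hs i le_rfl).trans_lt hlt⟩
    exact lt_asymm this h1

lemma exists_cut {w : List (V × Bool)} {x : V} (h : ab (ZMod 2) (wp Γ w) x ≠ 0) :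
    ∃ a s b, w = a ++ s :: b ∧ wlen lexWt a < wlen lexWt b + lexWt s.1 ∧
      wlen lexWt b < wlen lexWt a + lexWt s.1 ∧ s.1 ≤ x := by
  have hne : [] ++ w ≠ [] := by
    rintro h'
    rw [List.nil_append] at h'
    simp [h', wp_nil] at h
  obtain ⟨a, s, b, e, h1, h2⟩ := exists_first_cut (a := []) (w := w)
    (by rw [wlen_nil]; exact wlen_nonneg lexWt_pos w) hne
  rw [List.nil_append] at e
  rw [← wlen_lexWt_parity, e, wlen_append, wlen_cons] at h
  have h3 : wlen lexWt a ≠ wlen lexWt b + lexWt s.1 := by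
    intro h3
    rw [h3, add_comm (lexWt s.1)] at h
    simp only [LexW.mult_add, Nat.cast_add] at h
    exact h (CharTwo.add_self_eq_zero _)
  have h1' := lt_of_le_of_ne h1 h3
  refine ⟨a, s, b, e, h1', h2, ?_⟩
  by_contra hx
  have hx := not_le.1 hx
  have h4 : (wlen lexWt a).mult x ≠ (wlen lexWt b).mult x := by
    intro h4
    have h5 : (lexWt s.1).mult x = 0 := by simp [mult_lexWt, hx.ne]
    simp only [LexW.mult_add, Nat.cast_add, h4, h5] at h
    simp only [Nat.cast_zero, zero_add] at h
    exact h (CharTwo.add_self_eq_zero _)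
  exact lt_asymm (lexWt_aux h4 hx h1') (lexWt_aux h4.symm hx h2)

end Cut

lemma abMap_mem_of_gen {R : Type*} [CommRing R] [Fintype V] {φ : MulAut (RAAG Γ)} {A : Set V}
    {W : Submodule R (V → R)} (h : ∀ x ∈ A, ab R (φ (raagGen Γ x)) ∈ W) {f : V → R}
    (hf : ∀ x, x ∉ A → f x = 0) : abEquiv R φ f ∈ W := by
  classical
  have hs : f = ∑ x, f x • Pi.single x (1 : R) := by
    funext y
    simp [Pi.single_apply]
  rw [hs, map_sum]
  refine Submodule.sum_mem _ fun x _ => ?_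
  rw [map_smul]
  by_cases hx : x ∈ A
  · have := h x hx
    rw [ab_aut, ab_gen] at this
    exact W.smul_mem _ (by convert this)
  · simp [hf x hx]

/-- The functions vanishing outside `A`. -/
def suppIn (R : Type*) [CommRing R] (A : Set V) : Submodule R (V → R) where
  carrier := {f | ∀ x, x ∉ A → f x = 0}
  add_mem' ha hb x hx := by simp [ha x hx, hb x hx]
  zero_mem' := by simp
  smul_mem' c f hf x hx := by simp [hf x hx]

lemma mem_suppIn {R : Type*} [CommRing R] {A : Set V} {f : V → R} :
    f ∈ suppIn R A ↔ ∀ x, x ∉ A → f x = 0 := Iff.rfl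

lemma ab_inv_conj (R : Type*) [CommRing R] (g k : RAAG Γ) : ab R (k⁻¹ * g * k) = ab R g := by
  simp

lemma ab_mem_suppIn (R : Type*) [CommRing R] {A : Set V} {g k : RAAG Γ}
    (hg : k⁻¹ * g * k ∈ SpecialSubgroup Γ A) : ab R g ∈ suppIn R A := by
  intro x hx
  have h1 := ab_special R hg hx
  rwa [ab_inv_conj] at h1

lemma map_suppIn_eq {K : Type*} [Field K] [Fintype V] {φ : MulAut (RAAG Γ)} {A : Set V}
    (h : ∀ x ∈ A, ab K (φ (raagGen Γ x)) ∈ suppIn K A) {f : V → K}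
    (hf : abEquiv K φ f ∈ suppIn K A) : f ∈ suppIn K A := by
  have h1 : (suppIn K A).map (abEquiv K φ : (V → K) →ₗ[K] (V → K)) = suppIn K A := by
    refine Submodule.eq_of_le_of_finrank_eq ?_ (LinearEquiv.finrank_map_eq _ _)
    rintro _ ⟨f, hf, rfl⟩
    exact abMap_mem_of_gen h hf
  rw [← h1] at hf
  obtain ⟨f', hf', e⟩ := hf
  rwa [← (abEquiv K φ).injective e]

lemma Good.nondegenerate [Fintype V] {φ : MulAut (RAAG Γ)} {g : V → RAAG Γ} (h : Good φ g)
    (v : V) : ∃ x, lk Γ x = lk Γ v ∧ ab (ZMod 2) (φ (raagGen Γ v)) x ≠ 0 := by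
  by_contra! hno
  have h0 : ∀ x, ab (ZMod 2) (φ (raagGen Γ x)) ∈ suppIn (ZMod 2) (Uset Γ x) := fun x =>
    ab_mem_suppIn _ (h.dom x x (self_mem_Uset x))
  let A : Set V := {x ∈ Uset Γ v | lk Γ x ≠ lk Γ v}
  have hA : ∀ x ∈ A, ab (ZMod 2) (φ (raagGen Γ x)) ∈ suppIn (ZMod 2) A := by
    intro x hx y hy
    refine h0 x y fun hy' => hy ⟨Uset_trans hx.1 hy', fun e => ?_⟩
    refine hx.2 (Set.Subset.antisymm ?_ hx.1)
    rw [← e]; exact hy'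
  have hv : ab (ZMod 2) (φ (raagGen Γ v)) ∈ suppIn (ZMod 2) A := by
    intro y hy
    by_cases hyv : lk Γ y = lk Γ v
    · exact hno y hyv
    · exact h0 v y fun hy' => hy ⟨hy', hyv⟩
  rw [ab_aut] at hv
  have := map_suppIn_eq hA hv v (fun h => h.2 rfl)
  classical
  simp [ab_gen] at this

lemma exists_component {T : Set V} {v : V} (hv : v ∈ T) : ∃ C, IsComponentOf Γ T C ∧ v ∈ C ∧
    ∀ P : V → Prop, P v → (∀ x ∈ T, ∀ y ∈ T, Γ.Adj x y → P x → P y) → ∀ x ∈ C, P x := by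
  classical
  let C : Set V := {x | ∃ h : x ∈ T, (Γ.induce T).Reachable ⟨v, hv⟩ ⟨x, h⟩}
  have hsub : C ⊆ T := fun x hx => hx.1
  have hvC : v ∈ C := ⟨hv, SimpleGraph.Reachable.refl _⟩
  refine ⟨C, ⟨hsub, ⟨v, hvC⟩, ?_, ?_⟩, hvC, ?_⟩
  · refine SimpleGraph.induce_connected_of_patches v hvC ?_
    rintro x ⟨hx, ⟨W⟩⟩
    let W' := W.map (SimpleGraph.Embedding.induce T).toHom
    refine ⟨{y | y ∈ W'.support}, ?_, W'.start_mem_support, W'.end_mem_support,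
      W'.connected_induce_support _ _⟩
    intro y hy
    simp only [W', Set.mem_ofPred_eq, SimpleGraph.Walk.support_map, List.mem_map] at hy
    obtain ⟨⟨z, hz⟩, hz', rfl⟩ := hy
    exact ⟨hz, ⟨W.takeUntil _ hz'⟩⟩
  · rintro x ⟨hx, hr⟩ y hy hxy
    exact ⟨hy, hr.trans (SimpleGraph.Adj.reachable (by simpa using hxy))⟩
  · rintro P hP hstep x ⟨hx, hr⟩
    have : ∀ y z : T, (Γ.induce T).Reachable y z → P y → P z := by
      rintro y z ⟨W⟩
      induction W with
      | nil => exact id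
      | @cons a b c h W ih => exact fun ha => ih (hstep a a.2 b b.2 (by simpa using h) ha)
    exact this _ ⟨x, hx⟩ hr hP

end

section

/-! ### Tight automorphisms permute the generators and their inverses -/

open scoped Pointwise

/-- The standing hypotheses on the graph: no isolated vertices and no triangles. -/
structure TriFree (Γ : SimpleGraph V) : Prop where
  nonempty : ∀ v, (lk Γ v).Nonempty
  tri : ∀ x y z, Γ.Adj x y → Γ.Adj y z → ¬ Γ.Adj x z

lemma TriFree.U_nonadj (hΓ : TriFree Γ) {v : V} : ∀ x ∈ Uset Γ v, ∀ y ∈ Uset Γ v, ¬ Γ.Adj x y := by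
  intro x hx y hy
  obtain ⟨z, hz⟩ := hΓ.nonempty v
  exact hΓ.tri x z y (hx hz) (SimpleGraph.Adj.symm (hy hz))

lemma U_disj_lk {v : V} : Uset Γ v ∩ lk Γ v = ∅ := by
  ext x
  simp only [Set.mem_inter_iff, Set.mem_empty_iff_false, iff_false, not_and]
  exact fun hx hx' => Γ.loopless.irrefl x (hx hx')

lemma lk_congr_adj {x x' y y' : V} (hx : lk Γ x' = lk Γ x) (hy : lk Γ y' = lk Γ y) :
    Γ.Adj x' y' ↔ Γ.Adj x y := by
  rw [← mem_lk, hx, mem_lk, Γ.adj_comm, ← mem_lk, hy, mem_lk, Γ.adj_comm]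

lemma U_LS_one {v : V} {f : RAAG Γ} (h : f ∈ SpecialSubgroup Γ (Uset Γ v)) (h' : f ∈ LS Γ v) :
    f = 1 := by
  have := special_inter h h'
  rw [U_disj_lk] at this
  exact special_empty this

lemma U_commute {v : V} {f l : RAAG Γ} (h : f ∈ SpecialSubgroup Γ (Uset Γ v)) (hl : l ∈ LS Γ v) :
    Commute f l := by
  obtain ⟨w, hw, rfl⟩ := exists_wp h
  clear h
  induction w with
  | nil => exact Commute.one_left l
  | cons s w ih =>
    rw [wp_cons]
    refine Commute.mul_left (LS_commute_lt ?_).symm (ih fun r hr => hw r (by simp [hr]))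
    exact special_mono (hw s (by simp)) hl

lemma mem_Aut0_of_signs [Fintype V] {ψ : MulAut (RAAG Γ)}
    (h : ∀ v, ψ (raagGen Γ v) = raagGen Γ v ∨ ψ (raagGen Γ v) = (raagGen Γ v)⁻¹) :
    ψ ∈ Aut0 Γ := by
  classical
  suffices H : ∀ A : Finset V, ∀ ψ : MulAut (RAAG Γ),
      (∀ v, ψ (raagGen Γ v) = raagGen Γ v ∨ ψ (raagGen Γ v) = (raagGen Γ v)⁻¹) →
      (∀ v, v ∉ A → ψ (raagGen Γ v) = raagGen Γ v) → ψ ∈ Aut0 Γ from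
    H Finset.univ ψ h (by simp)
  intro A
  induction A using Finset.induction_on with
  | empty =>
    intro ψ _ h2
    have : ψ = 1 := aut_ext fun v => by simpa using h2 v (by simp)
    rw [this]; exact one_mem _
  | insert u A hu ih =>
    intro ψ h1 h2
    rcases h1 u with h3 | h3
    · refine ih ψ h1 fun v hv => ?_
      by_cases hvu : v = u
      · rw [hvu, h3]
      · exact h2 v (by simp [hvu, hv])
    · obtain ⟨α, hα, a1, a2⟩ := exists_inversion Γ u
      have : ψ * α ∈ Aut0 Γ := by
        refine ih _ (fun v => ?_) fun v hv => ?_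
        · by_cases hvu : v = u
          · subst hvu; left; simp [a1, h3]
          · simpa [a2 v hvu] using h1 v
        · by_cases hvu : v = u
          · subst hvu; simp [a1, h3]
          · simpa [a2 v hvu] using h2 v (by simp [hvu, hv])
      simpa using mul_mem this (inv_mem hα)

variable [Fintype V] [LinearOrder V]

/-- For each signed generator, a balanced cut of a reduced word for its image, up to
conjugation. -/
structure CutSystem (Γ : SimpleGraph V) (φ : MulAut (RAAG Γ)) (g : V → RAAG Γ) where
  a : V × Bool → List (V × Bool)
  s : V × Bool → V × Bool
  b : V × Bool → List (V × Bool)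
  red : ∀ p, IsRed Γ lexWt (a p ++ s p :: b p)
  supp : ∀ p, ∀ r ∈ a p ++ s p :: b p, r.1 ∈ Uset Γ p.1
  eq : ∀ p, φ (lt Γ p) = g p.1 * wp Γ (a p ++ s p :: b p) * (g p.1)⁻¹
  left : ∀ p, wlen lexWt (a p) < wlen lexWt (b p) + lexWt (s p).1
  right : ∀ p, wlen lexWt (b p) < wlen lexWt (a p) + lexWt (s p).1
  link : ∀ p, lk Γ (s p).1 = lk Γ p.1
  flip_a : ∀ p, a (flip p) = winv (b p)
  flip_s : ∀ p, s (flip p) = flip (s p)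
  flip_b : ∀ p, b (flip p) = winv (a p)

lemma Good.exists_cut {φ : MulAut (RAAG Γ)} {g : V → RAAG Γ}
    (hord : ∀ x y : V, x ≤ y → (lk Γ x).ncard ≤ (lk Γ y).ncard) (h : Good φ g) (v : V) :
    ∃ a s b, IsRed Γ lexWt (a ++ s :: b) ∧ (∀ r ∈ a ++ s :: b, r.1 ∈ Uset Γ v) ∧
      φ (raagGen Γ v) = g v * wp Γ (a ++ s :: b) * (g v)⁻¹ ∧
      wlen lexWt a < wlen lexWt b + lexWt s.1 ∧ wlen lexWt b < wlen lexWt a + lexWt s.1 ∧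
      lk Γ s.1 = lk Γ v := by
  obtain ⟨x, hx, hx'⟩ := h.nondegenerate v
  have h1 := h.dom v v (self_mem_Uset v)
  obtain ⟨w, hw, e⟩ := exists_red lexWt ((g v)⁻¹ * φ (raagGen Γ v) * g v)
  have hsupp := hw.support lexWt_pos (e ▸ h1)
  have h2 : ab (ZMod 2) (wp Γ w) x ≠ 0 := by
    rwa [e, ab_inv_conj]
  obtain ⟨a, s, b, rfl, h3, h4, h5⟩ := RaagSplit.exists_cut h2
  refine ⟨a, s, b, hw, hsupp, by rw [e]; simp [mul_assoc], h3, h4, ?_⟩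
  refine (Set.eq_of_subset_of_ncard_le (hsupp s (by simp)) ?_ (Set.toFinite _)).symm
  rw [← hx]
  exact hord _ _ h5

lemma winv_winv (w : List (V × Bool)) : winv (winv w) = w := by
  have : (flip ∘ flip : V × Bool → V × Bool) = id := funext flip_flip
  simp [winv, this]

lemma winv_cut (a b : List (V × Bool)) (s : V × Bool) :
    winv (a ++ s :: b) = winv b ++ flip s :: winv a := by
  simp [winv]

lemma Good.exists_cutSystem {φ : MulAut (RAAG Γ)} {g : V → RAAG Γ}
    (hord : ∀ x y : V, x ≤ y → (lk Γ x).ncard ≤ (lk Γ y).ncard) (h : Good φ g) :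
    Nonempty (CutSystem Γ φ g) := by
  choose a s b h1 h2 h3 h4 h5 h6 using h.exists_cut hord
  refine ⟨⟨fun p => if p.2 then a p.1 else winv (b p.1),
    fun p => if p.2 then s p.1 else flip (s p.1),
    fun p => if p.2 then b p.1 else winv (a p.1), ?_, ?_, ?_, ?_, ?_, ?_, ?_, ?_, ?_⟩⟩
  all_goals rintro ⟨v, _ | _⟩
  all_goals simp only [Bool.false_eq_true, if_true, if_false, ← winv_cut, flip_fst, wlen_winv]
  · exact (h1 v).winv
  · exact h1 v
  · intro r hr
    simp only [winv, List.mem_reverse, List.mem_map] at hr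
    obtain ⟨r', hr', rfl⟩ := hr
    exact h2 v r' hr'
  · exact h2 v
  · rw [wp_winv, lt_false, map_inv, h3 v]; simp [mul_assoc]
  · rw [lt_true, h3 v]
  · exact h5 v
  · exact h4 v
  · exact h4 v
  · exact h5 v
  · exact h6 v
  · exact h6 v
  all_goals simp [flip, winv_winv]

namespace CutSystem

variable {φ : MulAut (RAAG Γ)} {g : V → RAAG Γ} (c : CutSystem Γ φ g)

/-- The base point of the hyperplane cutting the axis of the image of `p`. -/
def base (p : V × Bool) : RAAG Γ := g p.1 * wp Γ (c.a p)

/-- The halfspace attached to the signed generator `p`. -/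
def X (p : V × Bool) : Set (RAAG Γ) := HS (c.base p) (c.s p)

lemma X_def (p : V × Bool) : c.X p = HS (c.base p) (c.s p) := rfl

lemma LS_eq (p : V × Bool) : LS Γ (c.s p).1 = LS Γ p.1 := by
  rw [LS, LS, c.link]

lemma supp_a (p : V × Bool) : ∀ r ∈ c.a p, r.1 ∈ Uset Γ p.1 :=
  fun r hr => c.supp p r (by simp [hr])

lemma supp_b (p : V × Bool) : ∀ r ∈ c.b p, r.1 ∈ Uset Γ p.1 :=
  fun r hr => c.supp p r (by simp [hr])

lemma supp_s (p : V × Bool) : (c.s p).1 ∈ Uset Γ p.1 := c.supp p _ (by simp)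

lemma red_b (p : V × Bool) : IsRed Γ lexWt (c.b p) :=
  IsRed.right (a := c.a p ++ [c.s p]) (by simpa using c.red p)

lemma red_as (p : V × Bool) : IsRed Γ lexWt (c.a p ++ [c.s p]) :=
  IsRed.left (b := c.b p) (by simpa using c.red p)

lemma apply_lt (p : V × Bool) : φ (lt Γ p) =
    g p.1 * wp Γ (c.a p) * lt Γ (c.s p) * wp Γ (c.b p) * (g p.1)⁻¹ := by
  rw [c.eq, wp_append, wp_cons]; simp [mul_assoc]

lemma smul_compl (p : V × Bool) : φ (lt Γ p) • (c.X (flip p))ᶜ = c.X p := by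
  rw [X, HS_compl, smul_HS, c.flip_s, flip_flip, X]
  congr 1
  rw [c.apply_lt, base, base, c.flip_a, wp_winv, lt_flip]
  simp [mul_assoc]

section Base

variable (hΓ : TriFree Γ) (hb : ∀ v s, s.1 ∈ Uset Γ v → ¬ S s (g v)⁻¹)
include hΓ hb

lemma one_notMem (p : V × Bool) : 1 ∉ c.X p := by
  intro h
  rw [X, mem_HS, base, mul_one, mul_inv_rev, ← wp_winv] at h
  have hr : IsRed Γ lexWt (winv (c.a p)) := (IsRed.left (c.red p)).winv
  obtain ⟨w, hw⟩ := (free_reduced_mul lexWt_pos hΓ.U_nonadj (hb p.1) hr (by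
    intro r hr
    simp only [winv, List.mem_reverse, List.mem_map] at hr
    obtain ⟨r', hr', rfl⟩ := hr
    exact c.supp_a p r' hr')).2 _ (c.supp_s p) h
  have h1 : c.a p = winv w ++ [flip (c.s p)] := by
    rw [← winv_winv (c.a p), hw]; simp [winv]
  have h2 := c.red p
  rw [h1] at h2
  exact not_isRed_cancel lexWt_pos (c := winv w) (r := flip (c.s p)) (d := c.b p)
    (by simpa using h2)

lemma om_base (p : V × Bool) {l : RAAG Γ} (hl : l ∈ LS Γ p.1) :
    om lexWt ((φ (lt Γ p))⁻¹ * (c.base p * lt Γ (c.s p) * l)) <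
      om lexWt (c.base p * lt Γ (c.s p) * l) := by
  have hh : ∀ s : V × Bool, s.1 ∈ Uset Γ p.1 → ¬ S s (l⁻¹ * (g p.1)⁻¹) := by
    intro s hs
    rw [S_LS_mul (special_mono hs (inv_mem hl))]
    exact hb _ s hs
  have e1 : (φ (lt Γ p))⁻¹ * (c.base p * lt Γ (c.s p) * l) =
      (wp Γ (c.b p) * (l⁻¹ * (g p.1)⁻¹))⁻¹ := by
    have h1 : (wp Γ (c.b p))⁻¹ * l = l * (wp Γ (c.b p))⁻¹ :=
      (U_commute (inv_mem (wp_mem (c.supp_b p))) hl).eq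
    rw [c.apply_lt, base]
    simp [mul_assoc, h1]
  have e2 : c.base p * lt Γ (c.s p) * l =
      (wp Γ (winv (c.a p ++ [c.s p])) * (l⁻¹ * (g p.1)⁻¹))⁻¹ := by
    have hm : wp Γ (c.a p) * lt Γ (c.s p) ∈ SpecialSubgroup Γ (Uset Γ p.1) :=
      mul_mem (wp_mem (c.supp_a p)) (lt_mem (c.supp_s p))
    have h1 := (U_commute hm hl).eq
    rw [wp_winv, base, wp_append, wp_cons, wp_nil, mul_one]
    simp only [mul_inv_rev, inv_inv, mul_assoc] at h1 ⊢
    rw [h1]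
  have hs : ∀ r ∈ winv (c.a p ++ [c.s p]), r.1 ∈ Uset Γ p.1 := by
    intro r hr
    simp only [winv, List.mem_reverse, List.mem_map] at hr
    obtain ⟨r', hr', rfl⟩ := hr
    exact c.supp p r' (by simp at hr' ⊢; tauto)
  rw [e1, e2, om_inv, om_inv, (free_reduced_mul lexWt_pos hΓ.U_nonadj hh (c.red_b p) (c.supp_b p)).1,
    (free_reduced_mul lexWt_pos hΓ.U_nonadj hh (c.red_as p).winv hs).1, wlen_winv, wlen_append,
    wlen_cons, wlen_nil, add_zero]
  exact add_lt_add_left (c.right p) _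

lemma om_lt_of_mem {p : V × Bool} {h : RAAG Γ} (hh : h ∈ c.X p) :
    om lexWt ((φ (lt Γ p))⁻¹ * h) < om lexWt h := by
  obtain ⟨l, hl, h1, h2⟩ := om_enter (wt := lexWt) (c.one_notMem hΓ hb p) hh
  simp only [inv_one, one_mul] at h1 h2
  have hc : c.base p * l * lt Γ (c.s p) = c.base p * lt Γ (c.s p) * l := by
    rw [mul_assoc, (LS_commute_lt hl).eq, mul_assoc]
  rw [← h2] at h1
  rw [c.LS_eq] at hl
  have h3 := c.om_base hΓ hb p hl
  rw [← hc] at h3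
  calc om lexWt ((φ (lt Γ p))⁻¹ * h)
      = om lexWt ((φ (lt Γ p))⁻¹ * (c.base p * l * lt Γ (c.s p)) *
          ((c.base p * l * lt Γ (c.s p))⁻¹ * h)) := by simp [mul_assoc]
    _ ≤ _ := om_mul_le _ _ _
    _ < om lexWt h := by rw [h1]; exact add_lt_add_left h3 _

lemma base_mem_of_ne {p : V × Bool} : ¬ S (flip (c.s p)) (wp Γ (c.b p)) := by
  intro h
  obtain ⟨w, hw⟩ := (free_reduced_mul lexWt_pos hΓ.U_nonadj (h := 1) (fun s _ => S_one s) (c.red_b p)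
    (c.supp_b p)).2 (flip (c.s p)) (by simpa using c.supp_s p) (by simpa using h)
  have := c.red p
  rw [hw] at this
  exact not_isRed_cancel lexWt_pos this

lemma not_subset_flip (p : V × Bool) : ¬ c.X p ⊆ c.X (flip p) := by
  intro h
  have h1 : c.base p * lt Γ (c.s p) ∈ c.X (flip p) := h (base_mul_mem _ _)
  have h2 : S (flip (c.s p)) (wp Γ (c.b p) * wp Γ (c.a p ++ [c.s p])) := by
    have := h1
    rw [X, mem_HS, c.flip_s, base, c.flip_a, wp_winv, base] at this
    simpa [mul_assoc, wp_append, wp_cons, wp_nil] using this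
  obtain ⟨w₁, w₂, e, h3⟩ := S_enter_word (c.base_mem_of_ne hΓ hb) h2
  have hsupp : ∀ r ∈ w₁, r.1 ∈ Uset Γ p.1 := by
    intro r hr
    refine c.supp p r ?_
    have : r ∈ c.a p ++ [c.s p] := by rw [e]; simp [hr]
    simp at this ⊢; tauto
  have h4 : wp Γ (c.b p) * wp Γ w₁ = 1 := by
    refine U_LS_one (v := p.1) (mul_mem (wp_mem (c.supp_b p)) (wp_mem hsupp)) ?_
    rw [← c.LS_eq]
    simpa using h3
  have h5 : wlen lexWt w₁ = wlen lexWt (c.b p) := by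
    have hr : IsRed Γ lexWt w₁ := by
      have := c.red_as p
      rw [e] at this
      exact this.left
    rw [hr, c.red_b p, eq_inv_of_mul_eq_one_left h4, om_inv]
  rcases List.eq_nil_or_concat w₂ with rfl | ⟨w₃, r, rfl⟩
  · have : [c.s p] = [flip (c.s p)] := List.append_inj_right' e rfl
    exact flip_ne _ (List.cons.inj this).1.symm
  · have h6 : c.a p = w₁ ++ flip (c.s p) :: w₃ := by
      refine List.append_inj_left' (t₁ := [c.s p]) (t₂ := [r]) ?_ rfl
      rw [e]; simp
    have h7 := c.left p
    rw [h6, wlen_append, wlen_cons, h5, flip_fst, ← add_assoc] at h7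
    exact absurd h7 (not_lt.2 (le_add_of_nonneg_right (wlen_nonneg lexWt_pos _)))

lemma union_ne (p q : V × Bool) : c.X p ∪ c.X q ≠ Set.univ := by
  intro h
  have : (1 : RAAG Γ) ∈ c.X p ∪ c.X q := h ▸ Set.mem_univ _
  rcases this with h | h
  · exact c.one_notMem hΓ hb _ h
  · exact c.one_notMem hΓ hb _ h

lemma disjoint_flip (p : V × Bool) : Disjoint (c.X p) (c.X (flip p)) := by
  have hn : ¬ Γ.Adj (c.s p).1 (c.s (flip p)).1 := by
    rw [c.flip_s, flip_fst]; exact Γ.loopless.irrefl _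
  rcases HS_nested (k := c.base p) (h := c.base (flip p)) hn with h | h | h | h
  · exact absurd h (c.not_subset_flip hΓ hb p)
  · refine absurd ?_ (c.not_subset_flip hΓ hb (flip p))
    rw [flip_flip]; exact h
  · exact h
  · exact absurd h (c.union_ne hΓ hb _ _)

end Base

lemma smul_adj (h : Good φ g) {p q : V × Bool} (hpq : Γ.Adj q.1 p.1) :
    φ (lt Γ p) • c.X q = c.X q := by
  rw [X, smul_HS]
  refine HS_congr ?_
  have h1 := h.lk_lt (p := p) hpq
  have h2 := (U_commute (wp_mem (c.supp_a q)) h1).eq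
  rw [c.LS_eq]
  have h3 : (c.base q)⁻¹ * (φ (lt Γ p) * c.base q) = (g q.1)⁻¹ * φ (lt Γ p) * g q.1 := by
    have h4 : φ (lt Γ p) * c.base q = g q.1 * ((g q.1)⁻¹ * φ (lt Γ p) * g q.1 * wp Γ (c.a q)) := by
      simp [base, mul_assoc]
    rw [h4, ← h2, base]
    simp [mul_assoc]
  rwa [h3]

section Tight

variable (hΓ : TriFree Γ) (h : Tight lexWt φ g)
include hΓ h

lemma not_subset_of_dom {p q : V × Bool} (hne : p.1 ≠ q.1) (hu : p.1 ∈ Uset Γ q.1) :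
    ¬ c.X q ⊆ c.X p := by
  intro hsub
  have h1 : φ (lt Γ q) ∈ c.X q := by
    rw [← c.smul_compl, Set.mem_smul_set_iff_inv_smul_mem]
    simpa using c.one_notMem hΓ h.base (flip q)
  have h2 := c.om_lt_of_mem hΓ h.base (hsub h1)
  rcases q with ⟨v, b⟩
  cases b
  · have h3 := h.right_le v p hu hne
    rw [← om_inv _ (φ (lt Γ (v, false)))] at h2
    rw [← om_inv] at h2
    simp only [lt_false, map_inv, mul_inv_rev, inv_inv] at h2
    exact absurd h2 (not_lt.2 h3)
  · have h3 := h.left_le v (flip p) hu hne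
    rw [lt_flip, map_inv] at h3
    rw [lt_true] at h2
    exact absurd h2 (not_lt.2 h3)

omit hΓ in
lemma mem_mul_iff {p : V × Bool} {t : V} (h1 : ¬ lk Γ t ⊆ lk Γ p.1) (h2 : ¬ Γ.Adj p.1 t) {n : RAAG Γ}
    (hn : n ∈ Nsub Γ t) (x : RAAG Γ) : x * n ∈ c.X p ↔ x ∈ c.X p := by
  rw [X, mem_HS, mem_HS, ← mul_assoc]
  refine S_mul_special ?_ hn _
  rintro (hU | hL)
  · exact h1 (fun y hy => by rw [← c.link]; exact hU hy)
  · refine h2 ?_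
    rw [← mem_lk, ← c.link]
    exact SimpleGraph.Adj.symm hL

lemma om_conj_lt {p : V × Bool} {t : V} (h1 : ¬ lk Γ t ⊆ lk Γ p.1) (h2 : ¬ Γ.Adj p.1 t)
    (hg : g t ∈ c.X p) : om lexWt ((φ (lt Γ p))⁻¹ * φ (raagGen Γ t) * φ (lt Γ p)) <
      om lexWt (φ (raagGen Γ t)) := by
  set z := φ (raagGen Γ t) with hz
  have hc := h.dom t t (self_mem_Uset t)
  rw [← hz] at hc
  have hN : SpecialSubgroup Γ (Uset Γ t) ≤ Nsub Γ t := special_mono Set.subset_union_left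
  have hpow : ∀ n : ℤ, z ^ n * g t ∈ c.X p := by
    intro n
    have e : z ^ n * g t = g t * ((g t)⁻¹ * z * g t) ^ n := by
      have := conj_zpow (a := (g t)⁻¹) (b := z) (i := n)
      rw [inv_inv] at this
      rw [this]; simp [mul_assoc]
    rw [e, c.mem_mul_iff h h1 h2 (hN (zpow_mem hc n))]
    exact hg
  have hX : z • c.X p = HS (z * c.base p) (c.s p) := by rw [X, smul_HS]
  have hmem : ∀ x, x ∈ z • c.X p ↔ z⁻¹ * x ∈ c.X p := fun x => by
    rw [Set.mem_smul_set_iff_inv_smul_mem, smul_eq_mul]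
  have hne : z • c.X p ≠ c.X p := by
    intro e
    rw [hX, X, HS_eq_iff, c.LS_eq] at e
    obtain ⟨x, hx, hx'⟩ := h.nondegenerate t
    refine hx' (ab_mem_suppIn (ZMod 2) (A := lk Γ p.1) (k := c.base p) (by
      rw [mul_assoc]; exact e.2) x fun hxp => h2 ?_)
    have : p.1 ∈ lk Γ x := SimpleGraph.Adj.symm hxp
    rw [hx] at this
    exact SimpleGraph.Adj.symm this
  have huniv : z • c.X p ∪ c.X p = Set.univ := by
    rw [hX]
    rcases HS_nested (k := z * c.base p) (h := c.base p) (s := c.s p) (r := c.s p)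
      (Γ.loopless.irrefl _) with h3 | h3 | h3 | h3
    · exfalso
      rw [← hX, ← X_def] at h3
      have h4 : z • HS (c.base p) (c.s p) ⊂ HS (c.base p) (c.s p) := lt_of_le_of_ne h3 hne
      obtain ⟨n, hn⟩ := exists_notMem_pow_smul h4 (g t)
      rw [Set.mem_smul_set_iff_inv_smul_mem, smul_eq_mul] at hn
      have := hpow (-(n : ℤ))
      rw [zpow_neg, zpow_natCast] at this
      exact hn this
    · exfalso
      rw [← hX, ← X_def] at h3
      have h3' : z⁻¹ • c.X p ⊆ c.X p := by
        rw [← Set.smul_set_subset_smul_set_iff (a := z)]; simpa using h3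
      have hne' : z⁻¹ • c.X p ≠ c.X p := by
        intro e
        refine hne ?_
        conv_lhs => rw [← e]
        simp
      have h4 : z⁻¹ • HS (c.base p) (c.s p) ⊂ HS (c.base p) (c.s p) := lt_of_le_of_ne h3' hne'
      obtain ⟨n, hn⟩ := exists_notMem_pow_smul h4 (g t)
      rw [Set.mem_smul_set_iff_inv_smul_mem, smul_eq_mul] at hn
      have := hpow n
      rw [zpow_natCast] at this
      simp only [inv_pow, inv_inv] at hn
      exact hn this
    · exfalso
      rw [← hX, ← X_def, Set.disjoint_left] at h3
      refine h3 (a := g t) ?_ hg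
      rw [hmem]
      simpa using hpow (-1)
    · exact h3
  have h1X := c.one_notMem hΓ h.base p
  have hzX : z ∈ c.X p := by
    have : z ∈ z • c.X p ∪ c.X p := huniv ▸ Set.mem_univ z
    rcases this with h3 | h3
    · rw [hmem, inv_mul_cancel] at h3; exact absurd h3 h1X
    · exact h3
  obtain ⟨l, hl, e1, e2⟩ := om_enter (wt := lexWt) h1X hzX
  simp only [inv_one, one_mul] at e1 e2
  rw [← e2] at e1
  set m := c.base p * l * lt Γ (c.s p) with hm
  have hkl : c.base p * l ∉ c.X p := by
    rw [X, mem_HS, inv_mul_cancel_left]; exact S_LS hl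
  have hmY : m ∈ z • c.X p := by
    by_contra hmY
    have h3 : c.base p * l ∈ z • c.X p := by
      have : c.base p * l ∈ z • c.X p ∪ c.X p := huniv ▸ Set.mem_univ _
      exact this.resolve_right hkl
    rw [hX] at h3 hmY
    exact flip_ne _ (HS_exit h3 hmY).1.symm
  have hY : (z • c.X p)ᶜ = HS (z * c.base p * lt Γ (c.s p)) (flip (c.s p)) := by
    rw [hX, HS_compl]
  have i1 : m ∉ HS (z * c.base p * lt Γ (c.s p)) (flip (c.s p)) := by
    rw [← hY]; exact fun h => h hmY
  have i2 : z ∈ HS (z * c.base p * lt Γ (c.s p)) (flip (c.s p)) := by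
    rw [← hY]
    intro h3
    rw [hmem, inv_mul_cancel] at h3; exact h1X h3
  obtain ⟨l', hl', f1, f2⟩ := om_enter (wt := lexWt) i1 i2
  rw [flip_fst] at hl'
  set m' := c.base p * l' * lt Γ (c.s p) with hm'
  have hcm : ∀ {l}, l ∈ LS Γ (c.s p).1 → c.base p * l * lt Γ (c.s p) =
      c.base p * lt Γ (c.s p) * l := fun hl => by
    rw [mul_assoc, (LS_commute_lt hl).eq, mul_assoc]
  have f3 : z * c.base p * lt Γ (c.s p) * l' = z * m' := by
    rw [hm', hcm hl']; simp only [mul_assoc]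
  have f4 : (z * c.base p * lt Γ (c.s p) * l' * lt Γ (flip (c.s p)))⁻¹ * z = (c.base p * l')⁻¹ := by
    rw [f3, hm', lt_flip]; simp [mul_assoc]
  rw [f4, f3, om_inv] at f1
  have f5 : om lexWt m' ≤ om lexWt (c.base p * l') + lexWt (c.s p).1 :=
    (om_mul_le _ _ _).trans (add_le_add_right (om_lt_le _ _) _)
  have k1 := c.om_base hΓ h.base p (c.LS_eq p ▸ hl)
  have k2 := c.om_base hΓ h.base p (c.LS_eq p ▸ hl')
  rw [← hcm hl, ← hm] at k1
  rw [← hcm hl', ← hm'] at k2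
  have e3 : om lexWt z ≥ om lexWt m + (om lexWt (m⁻¹ * (z * m')) + om lexWt m') := by
    rw [e1, f1, flip_fst, add_assoc (om lexWt (m⁻¹ * (z * m'))), add_comm (lexWt _)]
    exact add_le_add_right (add_le_add_right f5 _) _
  have e4 : (φ (lt Γ p))⁻¹ * z * φ (lt Γ p) =
      ((φ (lt Γ p))⁻¹ * m) * ((m⁻¹ * (z * m')) * ((φ (lt Γ p))⁻¹ * m')⁻¹) := by
    simp [mul_assoc]
  rw [e4]
  refine lt_of_lt_of_le (lt_of_le_of_lt ((om_mul_le _ _ _).trans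
    (add_le_add_right ((om_mul_le _ _ _).trans le_rfl) _)) ?_) e3
  rw [om_inv]
  exact add_lt_add k1 (add_lt_add_right k2 _)

lemma not_subset {p q : V × Bool} (hne : p.1 ≠ q.1) (hadj : ¬ Γ.Adj p.1 q.1) :
    ¬ c.X q ⊆ c.X p := by
  by_cases hu : lk Γ q.1 ⊆ lk Γ p.1
  · exact c.not_subset_of_dom hΓ h hne hu
  intro hsub
  have hqC : q.1 ∈ (starOf Γ p.1)ᶜ := by
    rintro (h1 | h1)
    · exact hne h1.symm
    · exact hadj h1
  have hLN : ∀ t, SpecialSubgroup Γ (Uset Γ t) ≤ Nsub Γ t := fun t =>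
    special_mono Set.subset_union_left
  have hq : g q.1 ∈ c.X p := by
    have h1 := hsub (base_mul_mem (c.base q) (c.s q))
    rw [base, mul_assoc, c.mem_mul_iff h hu hadj
      (hLN _ (mul_mem (wp_mem (c.supp_a q)) (lt_mem (c.supp_s q))))] at h1
    exact h1
  obtain ⟨C, hC, -, hP⟩ := exists_component hqC
  have hall := hP (fun t => ¬ lk Γ t ⊆ lk Γ p.1 ∧ g t ∈ c.X p) ⟨hu, hq⟩ (by
    rintro x hx y hy hxy ⟨h1, h2⟩
    have hx' : ¬ Γ.Adj p.1 x := fun hx' => hx (Or.inr hx')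
    have hy' : ¬ Γ.Adj p.1 y := fun hy' => hy (Or.inr hy')
    have h3 : ¬ lk Γ y ⊆ lk Γ p.1 := fun h3 => hx' (h3 hxy.symm)
    refine ⟨h3, ?_⟩
    obtain ⟨a, ha, b, hb, e⟩ := h.edge x y hxy
    have : g y = g x * a * b := by rw [mul_assoc, ← e]; simp
    rw [this, c.mem_mul_iff h h3 hy' hb, c.mem_mul_iff h h1 hx' ha]
    exact h2)
  obtain ⟨t, ht, hle⟩ := h.conj_le p C hC
  have htp : ¬ Γ.Adj p.1 t := fun ht' => hC.1 ht (Or.inr ht')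
  exact absurd (c.om_conj_lt hΓ h (hall t ht).1 htp (hall t ht).2) (not_lt.2 hle)

lemma disjoint {p q : V × Bool} (hne : p ≠ q) (hadj : ¬ Γ.Adj p.1 q.1) :
    Disjoint (c.X p) (c.X q) := by
  by_cases hv : q.1 = p.1
  · rcases eq_or_eq_flip hv with rfl | rfl
    · exact absurd rfl hne
    · exact c.disjoint_flip hΓ h.base p
  · have hn : ¬ Γ.Adj (c.s p).1 (c.s q).1 := by
      rwa [lk_congr_adj (c.link p) (c.link q)]
    rcases HS_nested (k := c.base p) (h := c.base q) hn with h1 | h1 | h1 | h1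
    · exact absurd h1 (c.not_subset hΓ h hv fun h' => hadj h'.symm)
    · exact absurd h1 (c.not_subset hΓ h (Ne.symm hv) hadj)
    · exact h1
    · exact absurd h1 (c.union_ne hΓ h.base _ _)

lemma S_iff (r : V × Bool) (x : RAAG Γ) : S r x ↔ φ x ∈ c.X r := by
  have hone := c.one_notMem hΓ h.base
  suffices H : ∀ n : ℕ, ∀ x : RAAG Γ, om (fun _ : V => 1) x = n → ∀ r, S r x ↔ φ x ∈ c.X r from
    H _ x rfl r
  intro n
  induction n using Nat.strong_induction_on with
  | _ n ih =>
    intro x hx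
    have hlt : ∀ r, S r x → ∀ t, S t ((lt Γ r)⁻¹ * x) ↔ φ ((lt Γ r)⁻¹ * x) ∈ c.X t := by
      intro r hr
      refine ih _ ?_ _ rfl
      have := om_of_S (wt := fun _ : V => 1) hr
      omega
    have hfwd : ∀ r, S r x → φ x ∈ c.X r := by
      intro r hr
      rw [← c.smul_compl, Set.mem_smul_set_iff_inv_smul_mem, smul_eq_mul, ← map_inv, ← map_mul,
        Set.mem_compl_iff, ← hlt r hr, S_flip]
      simpa using hr
    intro r
    refine ⟨hfwd r, fun hxr => ?_⟩
    have hx1 : x ≠ 1 := by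
      rintro rfl
      rw [map_one] at hxr
      exact hone r hxr
    obtain ⟨t, ht⟩ := exists_S' hx1
    by_cases htr : t = r
    · exact htr ▸ ht
    by_cases hadj : Γ.Adj t.1 r.1
    · have h1 := c.smul_adj h.toGood (p := t) (q := r) hadj.symm
      rw [← h1, Set.mem_smul_set_iff_inv_smul_mem, smul_eq_mul, ← map_inv, ← map_mul,
        ← hlt t ht] at hxr
      rwa [S_LS_mul (inv_mem (lt_mem (show t.1 ∈ lk Γ r.1 from hadj.symm)))] at hxr
    · exact (Set.disjoint_left.1 (c.disjoint hΓ h htr hadj) (hfwd t ht) hxr).elim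

lemma exists_perm : ∀ r, φ (lt Γ r) = lt Γ (c.s r) := by
  have hex : ∀ q, ∃ r, c.s r = q ∧ c.X r = HS 1 q := by
    intro q
    have h1 : φ⁻¹ (lt Γ q) ≠ 1 := by
      intro h1
      have h2 : lt Γ q = 1 := by simpa using h1
      have := S_lt (Γ := Γ) q
      rw [h2] at this
      exact S_one _ this
    obtain ⟨r, hr⟩ := exists_S' h1
    rw [c.S_iff hΓ h] at hr
    have hr' : (1 : RAAG Γ) * lt Γ q ∈ c.X r := by simpa using hr
    obtain ⟨e, hl⟩ := HS_enter (c.one_notMem hΓ h.base r) hr'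
    refine ⟨r, e.symm, ?_⟩
    rw [e]
    exact (HS_congr hl).symm
  have hsurj : Function.Surjective c.s := fun q => (hex q).imp fun _ h => h.1
  have hinj := Finite.injective_iff_surjective.2 hsurj
  have hX : ∀ r, c.X r = HS 1 (c.s r) := by
    intro r
    obtain ⟨r', e, hr'⟩ := hex (c.s r)
    rw [← hinj e]; rwa [← hinj e] at hr'
  intro r
  have h1 := c.smul_compl r
  rw [hX, hX, c.flip_s, HS_compl, flip_flip, smul_HS, lt_flip, HS_eq_iff] at h1
  have hl := h1.2
  simp only [inv_one, one_mul] at hl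
  set l := φ (lt Γ r) * (lt Γ (c.s r))⁻¹ with hl_def
  have e : φ (lt Γ r) = l * lt Γ (c.s r) := by simp [hl_def]
  suffices l = 1 by rw [e, this, one_mul]
  by_contra hne
  obtain ⟨t, ht⟩ := exists_S' hne
  have htl : t.1 ∈ lk Γ (c.s r).1 := by
    by_contra hn
    have := (S_mul_special hn hl 1).1 (by simpa using ht)
    exact S_one _ this
  have hne' : (c.s r).1 ≠ t.1 := fun e => Γ.loopless.irrefl _ (e ▸ htl)
  obtain ⟨t', rfl⟩ := hsurj t
  have h2 : S t' (lt Γ r) := by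
    rw [c.S_iff hΓ h, hX, mem_HS, e, inv_one, one_mul, S_mul_ne hne']
    exact ht
  have h3 : S t' (1 * lt Γ r) := by simpa using h2
  rw [(S_enter (S_one t') h3).1] at hne'
  exact hne' rfl

end Tight

end CutSystem

lemma Good.mem_Aut0 (hΓ : TriFree Γ)
    (hord : ∀ x y : V, x ≤ y → (lk Γ x).ncard ≤ (lk Γ y).ncard) {φ : MulAut (RAAG Γ)}
    {g : V → RAAG Γ} (h : Good φ g) :
    ∃ σ : Γ ≃g Γ, (∀ v, lk Γ (σ v) = lk Γ v) ∧ (symAut σ)⁻¹ * φ ∈ Aut0 Γ := by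
  obtain ⟨α, hα, g', h'⟩ := h.exists_tight lexWt_pos
  obtain ⟨c⟩ := h'.exists_cutSystem hord
  have hs := c.exists_perm hΓ h'
  have hsurj : Function.Surjective fun v => (c.s (v, true)).1 := by
    intro x
    have hφ : Function.Injective fun r => φ (α (lt Γ r)) := by
      intro r r' e
      have e := α.injective (φ.injective e)
      have h1 : S r' (1 * lt Γ r) := by rw [one_mul, e]; exact S_lt r'
      exact (S_enter (S_one r') h1).1
    have hsinj : Function.Injective c.s := by
      intro r r' e
      refine hφ ?_
      have h1 := hs r
      have h2 := hs r'
      rw [e, ← h2] at h1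
      exact h1
    obtain ⟨⟨v, b⟩, hr⟩ := Finite.injective_iff_surjective.1 hsinj (x, true)
    refine ⟨v, ?_⟩
    cases b
    · have := c.flip_s (v, false)
      rw [hr] at this
      exact congrArg Prod.fst this
    · exact congrArg Prod.fst hr
  have hlk : ∀ v, lk Γ (c.s (v, true)).1 = lk Γ v := fun v => c.link (v, true)
  let e := Equiv.ofBijective _ (Finite.injective_iff_surjective.2 hsurj |> fun i => ⟨i, hsurj⟩)
  let σ : Γ ≃g Γ := ⟨e, fun {x y} => lk_congr_adj (hlk x) (hlk y)⟩
  refine ⟨σ, hlk, ?_⟩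
  have h1 : (symAut σ)⁻¹ * (φ * α) ∈ Aut0 Γ := by
    refine mem_Aut0_of_signs fun v => ?_
    have h2 := hs (v, true)
    rw [lt_true] at h2
    rw [MulAut.mul_apply, h2]
    have h3 : symAut σ (raagGen Γ v) = raagGen Γ (c.s (v, true)).1 := symAut_gen σ v
    have h4 := aut_inv_gen h3
    rcases hc : c.s (v, true) with ⟨x, b⟩
    rw [hc] at h4
    cases b
    · right; rw [lt_false, map_inv, h4]
    · left; rw [lt_true, h4]
  have := mul_mem h1 (inv_mem hα)
  simpa [mul_assoc] using this

end

section

/-! ### Skewered halfspaces and translation lengths -/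

section Skewer

open scoped Pointwise commutatorElement

lemma pow_smul_antitone {z : RAAG Γ} {X : Set (RAAG Γ)} (h : z • X ⊂ X) {m n : ℕ}
    (hmn : m ≤ n) : z ^ n • X ⊆ z ^ m • X := by
  rcases hmn.eq_or_lt with rfl | h'
  · exact subset_rfl
  · exact (pow_smul_subset h h').1

lemma inv_pow_smul_monotone {z : RAAG Γ} {X : Set (RAAG Γ)} (h : z • X ⊂ X) {m n : ℕ}
    (hmn : m ≤ n) : z⁻¹ ^ m • X ⊆ z⁻¹ ^ n • X := by
  have := pow_smul_antitone (compl_ssubset_of_smul h) hmn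
  rw [Set.smul_set_compl, Set.smul_set_compl] at this
  exact Set.compl_subset_compl.1 this

lemma skewer_smul {c z : RAAG Γ} {X : Set (RAAG Γ)} (h : c • X ⊂ X) (hz : Commute z c) :
    c • z • X ⊂ z • X := by
  rw [smul_smul, ← hz.eq, ← smul_smul]
  exact ⟨Set.smul_set_subset_smul_set_iff.2 h.1, fun h' => h.2 (Set.smul_set_subset_smul_set_iff.1 h')⟩

lemma skewer_total {c k k' : RAAG Γ} {s : V × Bool} (h : c • HS k s ⊂ HS k s)
    (h' : c • HS k' s ⊂ HS k' s) : HS k s ⊆ HS k' s ∨ HS k' s ⊆ HS k s := by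
  rcases HS_nested (h := k') (k := k) (r := s) (s := s) (Γ.loopless.irrefl _) with h1 | h1 | h1 | h1
  · exact .inl h1
  · exact .inr h1
  · exfalso
    obtain ⟨m, hm⟩ := exists_mem_inv_pow_smul h 1
    obtain ⟨n, hn⟩ := exists_mem_inv_pow_smul h' 1
    have hm := inv_pow_smul_monotone h (le_max_left m n) hm
    have hn := inv_pow_smul_monotone h' (le_max_right m n) hn
    rw [Set.mem_smul_set_iff_inv_smul_mem] at hm hn
    exact Set.disjoint_left.1 h1 hm hn
  · exfalso
    obtain ⟨m, hm⟩ := exists_notMem_pow_smul h 1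
    obtain ⟨n, hn⟩ := exists_notMem_pow_smul h' 1
    have hm := fun hh => hm (pow_smul_antitone h (le_max_left m n) hh)
    have hn := fun hh => hn (pow_smul_antitone h' (le_max_right m n) hh)
    rw [Set.mem_smul_set_iff_inv_smul_mem] at hm hn
    have : (c ^ max m n)⁻¹ • (1 : RAAG Γ) ∈ HS k s ∪ HS k' s := h1 ▸ Set.mem_univ _
    exact this.elim hm hn

/-- The halfspaces of signed label `s` that are skewered by `c`. -/
def Skew (c : RAAG Γ) (s : V × Bool) : Type _ :=
  {X : Set (RAAG Γ) // (∃ k, X = HS k s) ∧ c • X ⊂ X}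

instance (c : RAAG Γ) (s : V × Bool) : LinearOrder (Skew c s) :=
  { PartialOrder.lift (Subtype.val : Skew c s → Set (RAAG Γ)) Subtype.val_injective with
    le_total := by
      rintro ⟨_, ⟨k, rfl⟩, h⟩ ⟨_, ⟨k', rfl⟩, h'⟩
      exact skewer_total h h'
    toDecidableLE := Classical.decRel _ }

lemma Skew.le_iff {c : RAAG Γ} {s : V × Bool} {X Y : Skew c s} : X ≤ Y ↔ X.1 ⊆ Y.1 := Iff.rfl

lemma Skew.lt_iff {c : RAAG Γ} {s : V × Bool} {X Y : Skew c s} : X < Y ↔ X.1 ⊂ Y.1 := Iff.rfl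

instance (c : RAAG Γ) (s : V × Bool) : MulAction (Subgroup.centralizer {c}) (Skew c s) where
  smul z X := ⟨(z : RAAG Γ) • X.1, by
    obtain ⟨⟨k, hk⟩, h⟩ := X.2
    refine ⟨⟨z * k, by rw [hk, smul_HS]⟩, skewer_smul h ?_⟩
    exact (Subgroup.mem_centralizer_singleton_iff.1 z.2)⟩
  one_smul X := Subtype.ext (one_smul (RAAG Γ) X.1)
  mul_smul z z' X := Subtype.ext (mul_smul (z : RAAG Γ) (z' : RAAG Γ) X.1)

lemma Skew.smul_val {c : RAAG Γ} {s : V × Bool} (z : Subgroup.centralizer {c}) (X : Skew c s) :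
    (z • X).1 = (z : RAAG Γ) • X.1 := rfl

instance (c : RAAG Γ) (s : V × Bool) : LocallyFiniteOrder (Skew c s) :=
  LocallyFiniteOrder.ofFiniteIcc fun X Y => by
    obtain ⟨⟨k, hk⟩, h⟩ := X.2
    obtain ⟨⟨k', hk'⟩, h'⟩ := Y.2
    refine Set.Finite.of_finite_image (f := Subtype.val)
      ((finite_walls (k * lt Γ s) k').subset ?_) Subtype.val_injective.injOn
    rintro _ ⟨Z, ⟨h1, h2⟩, rfl⟩
    obtain ⟨⟨l, hl⟩, -⟩ := Z.2
    refine ⟨⟨l, s, hl⟩, h1 (by rw [hk]; exact base_mul_mem _ _), fun h3 => ?_⟩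
    have := h2 h3
    rw [hk'] at this
    exact base_notMem _ _ this

instance (c : RAAG Γ) (s : V × Bool) : NoMinOrder (Skew c s) where
  exists_lt X := ⟨(⟨c, by simp [Subgroup.mem_centralizer_singleton_iff]⟩ :
    Subgroup.centralizer {c}) • X, X.2.2⟩

instance (c : RAAG Γ) (s : V × Bool) : NoMaxOrder (Skew c s) where
  exists_gt X := ⟨(⟨c, by simp [Subgroup.mem_centralizer_singleton_iff]⟩ :
    Subgroup.centralizer {c})⁻¹ • X, by
      rw [Skew.lt_iff, Skew.smul_val]
      have := skewer_smul (z := c⁻¹) X.2.2 (Commute.inv_left rfl)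
      rwa [smul_smul, mul_inv_cancel, one_smul] at this⟩

lemma int_orderIso (f : ℤ ≃o ℤ) (n : ℤ) : f n = n + f 0 := by
  have hs : ∀ m, f (m + 1) = f m + 1 := fun m => f.map_succ m
  induction n using Int.induction_on with
  | zero => simp
  | succ n ih => rw [hs, ih]; ring
  | pred n ih => have := hs (-n - 1); rw [sub_add_cancel, ih] at this; linarith

/-- The order automorphism of the skewered halfspaces given by a commuting element. -/
def Skew.iso {c : RAAG Γ} {s : V × Bool} (z : Subgroup.centralizer {c}) : Skew c s ≃o Skew c s where
  toEquiv := MulAction.toPerm z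
  map_rel_iff' := Set.smul_set_subset_smul_set_iff

attribute [local instance] LinearLocallyFiniteOrder.succOrder LinearLocallyFiniteOrder.predOrder in
/-- Elements commuting with `c` act on the halfspaces skewered by `c` as translations. -/
lemma exists_translation (c : RAAG Γ) (s : V × Bool) :
    ∃ τ : Subgroup.centralizer {c} →* Multiplicative ℤ, ∀ z : Subgroup.centralizer {c},
      ∀ k, c • (HS k s : Set (RAAG Γ)) ⊂ HS k s → (τ z = 1 ↔ (z : RAAG Γ) • HS k s = HS k s) := by
  by_cases hne : Nonempty (Skew c s)
  swap
  · exact ⟨1, fun z k hk => (hne ⟨⟨_, ⟨k, rfl⟩, hk⟩⟩).elim⟩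
  let f : Skew c s ≃o ℤ := orderIsoIntOfLinearSuccPredArch
  let F : Subgroup.centralizer {c} → (ℤ ≃o ℤ) := fun z => (f.symm.trans (Skew.iso z)).trans f
  have hF : ∀ z n, F z n = f (z • f.symm n) := fun z n => rfl
  refine ⟨⟨⟨fun z => Multiplicative.ofAdd (F z 0), ?_⟩, ?_⟩, ?_⟩
  · simp [hF]
  · intro z z'
    have : F (z * z') 0 = F z (F z' 0) := by simp [hF, mul_smul]
    change Multiplicative.ofAdd (F (z * z') 0) = _
    rw [this, int_orderIso, add_comm, ofAdd_add]
  · intro z k hk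
    let X : Skew c s := ⟨_, ⟨k, rfl⟩, hk⟩
    have h1 : F z (f X) = f (z • X) := by simp [hF]
    rw [int_orderIso] at h1
    change Multiplicative.ofAdd (F z 0) = 1 ↔ _
    rw [ofAdd_eq_one, ← add_eq_left (a := f X), h1, f.apply_eq_iff_eq]
    exact Subtype.ext_iff

lemma skewer_trichotomy {c z k : RAAG Γ} {s : V × Bool} (h : c • HS k s ⊂ HS k s)
    (hz : Commute z c) : z • HS k s = HS k s ∨ z • HS k s ⊂ HS k s ∨ z⁻¹ • HS k s ⊂ HS k s := by
  have h1 := skewer_smul h hz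
  rw [smul_HS z] at h1 ⊢
  rcases skewer_total h1 h with h2 | h2
  · rcases h2.eq_or_ssubset with h3 | h3
    · exact .inl h3
    · exact .inr (.inl h3)
  · rcases h2.eq_or_ssubset with h3 | h3
    · exact .inl h3.symm
    · right; right
      rw [← smul_HS] at h3
      refine ⟨Set.subset_smul_set_iff.1 h3.1, fun h4 => h3.2 ?_⟩
      rwa [Set.smul_set_subset_iff_subset_inv_smul_set]

/-- Commutators of elements commuting with `c` fix the halfspaces skewered by `c`. -/
lemma commutator_smul {c d₁ d₂ k : RAAG Γ} {s : V × Bool} (h : c • HS k s ⊂ HS k s)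
    (h₁ : Commute d₁ c) (h₂ : Commute d₂ c) : ⁅d₁, d₂⁆ • HS k s = HS k s := by
  obtain ⟨τ, hτ⟩ := exists_translation c s
  let D₁ : Subgroup.centralizer {c} := ⟨d₁, Subgroup.mem_centralizer_singleton_iff.2 h₁⟩
  let D₂ : Subgroup.centralizer {c} := ⟨d₂, Subgroup.mem_centralizer_singleton_iff.2 h₂⟩
  refine (hτ ⁅D₁, D₂⁆ k h).1 ?_
  rw [map_commutatorElement, commutatorElement_eq_one_iff_mul_comm, mul_comm]

lemma commutator_smul' {b d₁ d₂ k : RAAG Γ} {s : V × Bool}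
    (h : ⁅d₁, d₂⁆ • HS k s ⊂ HS k s) (h₁ : Commute b d₁) (h₂ : Commute b d₂) :
    b • HS k s = HS k s := by
  have hb : Commute b ⁅d₁, d₂⁆ := by
    rw [commutatorElement_def]
    exact ((h₁.mul_right h₂).mul_right h₁.inv_right).mul_right h₂.inv_right
  rcases skewer_trichotomy h hb with h3 | h3 | h3
  · exact h3
  · exact absurd (commutator_smul h3 h₁.symm h₂.symm) h.ne
  · exact absurd (commutator_smul h3 h₁.inv_left.symm h₂.inv_left.symm) h.ne

/-- An element skewering a halfspace of label `s` is not conjugate into a special subgroup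
avoiding `s`. -/
lemma label_of_skewer {z h k : RAAG Γ} {s : V × Bool} {J : Set V}
    (hz : z • HS k s ⊂ HS k s) (hJ : h⁻¹ * z * h ∈ SpecialSubgroup Γ J) : s.1 ∈ J := by
  by_contra hs
  have key : ∀ n : ℕ, h ∈ z⁻¹ ^ n • HS k s ↔ h ∈ HS k s := by
    intro n
    rw [Set.mem_smul_set_iff_inv_smul_mem, inv_pow, inv_inv, mem_HS, mem_HS, smul_eq_mul]
    have : k⁻¹ * (z ^ n * h) = k⁻¹ * h * (h⁻¹ * z * h) ^ n := by
      have : h⁻¹ * z * h = h⁻¹ * z * h⁻¹⁻¹ := by simp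
      rw [this, conj_pow]; simp [mul_assoc]
    rw [this]
    exact S_mul_special hs (pow_mem hJ n) _
  have key' : ∀ n : ℕ, h ∈ z ^ n • HS k s ↔ h ∈ HS k s := by
    intro n
    rw [Set.mem_smul_set_iff_inv_smul_mem, mem_HS, mem_HS, smul_eq_mul]
    have : k⁻¹ * ((z ^ n)⁻¹ * h) = k⁻¹ * h * ((h⁻¹ * z * h) ^ n)⁻¹ := by
      have : h⁻¹ * z * h = h⁻¹ * z * h⁻¹⁻¹ := by simp
      rw [this, conj_pow]; simp [mul_assoc]
    rw [this]
    exact S_mul_special hs (inv_mem (pow_mem hJ n)) _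
  obtain ⟨m, hm⟩ := exists_mem_inv_pow_smul hz h
  obtain ⟨n, hn⟩ := exists_notMem_pow_smul hz h
  exact hn ((key' n).2 ((key m).1 hm))

end Skewer

end

section

/-! ### Cyclically reduced words and centralizers -/

section Cyclic

open scoped Pointwise commutatorElement

/-- A word is cyclically reduced if it is shortest among all words for its conjugates. -/
def IsCycRed (Γ : SimpleGraph V) (w : List (V × Bool)) : Prop :=
  ∀ w' k, wp Γ w' = k * wp Γ w * k⁻¹ →
    wlen (fun _ => 1 : V → ℕ) w ≤ wlen (fun _ => 1 : V → ℕ) w'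

lemma exists_cycRed {J : Set V} {g : RAAG Γ} (hg : g ∈ SpecialSubgroup Γ J) :
    ∃ k ∈ SpecialSubgroup Γ J, ∃ w, (∀ s ∈ w, s.1 ∈ J) ∧ IsCycRed Γ w ∧
      g = k * wp Γ w * k⁻¹ := by
  classical
  let P : ℕ → Prop := fun n => ∃ w k, wlen (fun _ => 1 : V → ℕ) w = n ∧ g = k * wp Γ w * k⁻¹
  have hP : ∃ n, P n := by
    obtain ⟨w, hw⟩ := exists_word g
    exact ⟨_, w, 1, rfl, by simp [hw]⟩
  obtain ⟨w, k, hn, hw⟩ := Nat.find_spec hP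
  refine ⟨ret Γ J k, ret_mem _ _, w.filter fun s => s.1 ∈ J, by simp, ?_, ?_⟩
  · intro w' k' h
    refine (wlen_filter_le (fun _ => Nat.one_pos) _ _).trans ?_
    rw [hn]
    refine Nat.find_min' hP ⟨w', ret Γ J k * k'⁻¹, rfl, ?_⟩
    rw [h, ← ret_of_mem hg, hw]
    simp only [map_mul, map_inv, ret_wp]
    group
  · rw [← ret_wp, ← map_inv, ← map_mul, ← map_mul, ← hw, ret_of_mem hg]

lemma IsCycRed.skewer {w₁ w₂ : List (V × Bool)} {y : V × Bool} (h : IsCycRed Γ (w₁ ++ y :: w₂))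
    (k : RAAG Γ) : (k * wp Γ (w₁ ++ y :: w₂) * k⁻¹) • HS (k * wp Γ w₁) y ⊂
      HS (k * wp Γ w₁) y := by
  have hpos : ∀ v : V, 0 < (fun _ => 1 : V → ℕ) v := fun _ => Nat.one_pos
  set c := wp Γ (y :: (w₂ ++ w₁)) with hc
  have hcw : c = (wp Γ w₁)⁻¹ * wp Γ (w₁ ++ y :: w₂) * wp Γ w₁ := by
    simp [hc, mul_assoc]
  have hmin : ∀ w' k', wp Γ w' = k' * c * k'⁻¹ →
      wlen (fun _ => 1 : V → ℕ) (y :: (w₂ ++ w₁)) ≤ wlen (fun _ => 1 : V → ℕ) w' := by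
    intro w' k' h'
    refine le_trans (le_of_eq ?_) (h w' (k' * (wp Γ w₁)⁻¹) ?_)
    · simp; ring
    · rw [h', hcw]; group
  have hred : IsRed Γ (fun _ => 1 : V → ℕ) (y :: (w₂ ++ w₁)) :=
    isRed_of_le fun w' h' => hmin w' 1 (by simp [h', hc])
  have h1 : S y c := S_of_isRed_cons hpos hred
  have h2 : ¬ S y c⁻¹ := by
    intro h2
    have h3 : S y (c⁻¹ * lt Γ y) := by
      by_contra h3
      exact flip_ne _ (S_exit h2 h3).1.symm
    have e1 := om_of_S (wt := (fun _ => 1 : V → ℕ)) h3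
    have e2 : om (fun _ => 1 : V → ℕ) (c⁻¹ * lt Γ y) =
        wlen (fun _ => 1 : V → ℕ) (w₂ ++ w₁) := by
      have hr : IsRed Γ (fun _ => 1 : V → ℕ) (w₂ ++ w₁) := IsRed.right (a := [y]) hred
      have hv : (c⁻¹ * lt Γ y)⁻¹ = (lt Γ y)⁻¹ * c := by group
      rw [← om_inv, hv, hc, wp_cons, inv_mul_cancel_left]
      exact Eq.symm hr
    obtain ⟨w', h4, h5⟩ := exists_geod (fun _ => 1 : V → ℕ) ((lt Γ y)⁻¹ * (c⁻¹ * lt Γ y))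
    have h6 := hmin (winv w') (lt Γ y)⁻¹ (by rw [wp_winv, h4]; group)
    rw [wlen_winv, h5, wlen_cons] at h6
    omega
  have h0 : c • (HS 1 y : Set (RAAG Γ)) ⊂ HS 1 y := by
    have a1 : (1 : RAAG Γ) ∉ HS 1 y := by rw [mem_HS_one]; exact S_one y
    have a2 : (1 : RAAG Γ) ∉ HS c y := by rw [mem_HS, mul_one]; exact h2
    have a3 : c ∈ HS 1 y := mem_HS_one.2 h1
    have a4 : c ∉ HS c y := base_notMem _ _
    have a5 : c * lt Γ y ∈ HS c y := base_mul_mem _ _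
    have a6 : c * lt Γ y ∈ HS 1 y := by
      by_contra a6
      exact flip_ne _ (HS_exit a3 a6).1.symm
    rw [smul_HS, mul_one]
    rcases HS_nested (h := 1) (k := c) (r := y) (s := y) (Γ.loopless.irrefl _) with
      b | b | b | b
    · exact ⟨b, fun b' => a4 (b' a3)⟩
    · exact absurd (b a3) a4
    · exact absurd a6 (Set.disjoint_left.1 b a5)
    · exact absurd (b ▸ Set.mem_univ (1 : RAAG Γ)) (fun b' => b'.elim a2 a1)
  have e : (k * wp Γ (w₁ ++ y :: w₂) * k⁻¹) • HS (k * wp Γ w₁) y =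
      (k * wp Γ w₁) • c • HS 1 y := by
    simp only [smul_HS, hcw]; congr 1; group
  have e' : HS (k * wp Γ w₁) y = (k * wp Γ w₁) • HS 1 y := by simp
  rw [e, e']
  exact ⟨Set.smul_set_subset_smul_set_iff.2 h0.1,
    fun h' => h0.2 (Set.smul_set_subset_smul_set_iff.1 h')⟩

lemma lt_ne_one (s : V × Bool) : lt Γ s ≠ 1 := fun h => S_one (Γ := Γ) s (h ▸ S_lt s)

lemma isCycRed_singleton (s : V × Bool) : IsCycRed Γ [s] := by
  intro w' k h
  cases w' with
  | nil =>
    rw [wp_nil, eq_comm, mul_inv_eq_one, mul_eq_left] at h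
    exact absurd (by simpa using h) (lt_ne_one s)
  | cons r w' => simp

lemma lt_skewer (k : RAAG Γ) (s : V × Bool) :
    (k * lt Γ s * k⁻¹) • HS k s ⊂ HS k s := by
  simpa using IsCycRed.skewer (w₁ := []) (isCycRed_singleton (Γ := Γ) s) k

lemma mem_special_of_forall {b : RAAG Γ} (w : List (V × Bool)) (h : ∀ y ∈ w, b ∈ LS Γ y.1) :
    b ∈ SpecialSubgroup Γ {t | ∀ y ∈ w, Γ.Adj t y.1} := by
  induction w with
  | nil => simp [special_univ]
  | cons y w ih =>
    refine special_mono ?_ (special_inter (h y (by simp)) (ih fun r hr => h r (by simp [hr])))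
    rintro t ⟨h1, h2⟩ r hr
    rcases List.mem_cons.1 hr with rfl | hr
    · exact SimpleGraph.Adj.symm h1
    · exact h2 r hr

lemma IsCycRed.mem_of_fix {w : List (V × Bool)} (hw : IsCycRed Γ w) {k b : RAAG Γ}
    (hb : ∀ h s, (k * wp Γ w * k⁻¹) • (HS h s : Set (RAAG Γ)) ⊂ HS h s → b • HS h s = HS h s) :
    k⁻¹ * b * k ∈ SpecialSubgroup Γ {t | ∀ y ∈ w, Γ.Adj t y.1} := by
  have h1 : ∀ w₁ y w₂, w = w₁ ++ y :: w₂ →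
      (wp Γ w₁)⁻¹ * (k⁻¹ * b * k) * wp Γ w₁ ∈ LS Γ y.1 := by
    rintro w₁ y w₂ rfl
    have h2 := hb _ _ (hw.skewer k)
    rw [smul_HS, HS_eq_iff] at h2
    simpa [mul_assoc] using h2.2
  have h2 : ∀ w₁ w₂, w = w₁ ++ w₂ → Commute (k⁻¹ * b * k) (wp Γ w₁) := by
    intro w₁
    induction w₁ using List.reverseRecOn with
    | nil => intros; simp
    | append_singleton w₁ y ih =>
      intro w₂ e
      rw [List.append_assoc] at e
      have h3 := ih _ e
      have h4 := h1 w₁ y w₂ e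
      rw [mul_assoc, h3.eq, inv_mul_cancel_left] at h4
      rw [wp_append]
      exact h3.mul_right (by simpa using LS_commute_lt h4)
  refine mem_special_of_forall w fun y hy => ?_
  obtain ⟨w₁, w₂, e⟩ := List.append_of_mem hy
  have h4 := h1 w₁ y w₂ e
  rwa [mul_assoc, (h2 _ _ e).eq, inv_mul_cancel_left] at h4

/-- The centralizer of a nontrivial power of a generator. -/
lemma commute_gen_zpow {z : RAAG Γ} {t : V} {n : ℤ} (hn : n ≠ 0)
    (h : Commute z (raagGen Γ t ^ n)) : ∃ i : ℤ, ∃ l ∈ LS Γ t, z = raagGen Γ t ^ i * l := by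
  classical
  set m := n.natAbs with hm
  have hm0 : 0 < m := Int.natAbs_pos.2 hn
  have hz : Commute z (raagGen Γ t ^ m) := by
    rcases Int.natAbs_eq n with h' | h'
    · rw [h', zpow_natCast] at h; exact h
    · rw [h', zpow_neg, zpow_natCast] at h; simpa using h.inv_right
  have h0 : raagGen Γ t • (HS 1 (t, true) : Set (RAAG Γ)) ⊂ HS 1 (t, true) := by
    simpa only [one_mul, inv_one, mul_one, lt_true] using lt_skewer (Γ := Γ) 1 (t, true)
  have h1 : raagGen Γ t ^ m • (HS 1 (t, true) : Set (RAAG Γ)) ⊂ HS 1 (t, true) := by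
    simpa using pow_smul_subset h0 hm0
  have h2 := skewer_smul h1 hz
  rw [smul_HS, mul_one] at h2
  obtain ⟨N, hN⟩ := exists_notMem_pow_smul h2 1
  obtain ⟨M, hM⟩ := exists_mem_inv_pow_smul h2 1
  rw [Set.mem_smul_set_iff_inv_smul_mem, smul_eq_mul, mul_one] at hN hM
  let P : ℕ → Prop := fun j => raagGen Γ t ^ (-(m * N : ℤ) + j) ∈ HS z (t, true)
  have hP : ∃ j, P j := ⟨m * N + m * M, by
    have : raagGen Γ t ^ (-(m * N : ℤ) + ((m * N + m * M : ℕ) : ℤ)) = (raagGen Γ t ^ m) ^ M := by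
      rw [← pow_mul, ← zpow_natCast]; congr 1; push_cast; ring
    simp only [P, this]
    simpa using hM⟩
  have hP0 : ¬ P 0 := by
    have : raagGen Γ t ^ (-(m * N : ℤ) + ((0 : ℕ) : ℤ)) = ((raagGen Γ t ^ m) ^ N)⁻¹ := by
      rw [← pow_mul, ← zpow_natCast, ← zpow_neg]; congr 1; push_cast; ring
    simp only [P, this]
    exact hN
  obtain ⟨j, hj⟩ : ∃ j, Nat.find hP = j + 1 := by
    refine Nat.exists_eq_succ_of_ne_zero fun h' => hP0 ?_
    have := Nat.find_spec hP
    rwa [h'] at this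
  have h3 : ¬ P j := Nat.find_min hP (by omega)
  have h4 : P (j + 1) := hj ▸ Nat.find_spec hP
  simp only [P] at h3 h4
  push_cast at h4
  rw [← add_assoc, zpow_add_one, ← lt_true (Γ := Γ) t] at h4
  obtain ⟨-, h5⟩ := HS_enter (by simpa using h3) h4
  exact ⟨_, _, inv_mem h5, by rw [lt_true, mul_inv_rev, inv_inv, mul_inv_cancel_left]⟩

lemma commute_gen {z : RAAG Γ} {t : V} (h : Commute z (raagGen Γ t)) :
    ∃ i : ℤ, ∃ l ∈ LS Γ t, z = raagGen Γ t ^ i * l :=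
  commute_gen_zpow (n := 1) one_ne_zero (by simpa using h)

/-- Up to conjugation, the elements commuting with a noncommuting pair lie in the special subgroup
of a common link. -/
lemma exists_commutator_core {d₁ d₂ : RAAG Γ} (he : ⁅d₁, d₂⁆ ≠ 1) :
    ∃ (k : RAAG Γ) (L : Set V), L.Nontrivial ∧ k⁻¹ * ⁅d₁, d₂⁆ * k ∈ SpecialSubgroup Γ L ∧
      ∀ b, Commute b d₁ → Commute b d₂ → k⁻¹ * b * k ∈ SpecialSubgroup Γ {t | L ⊆ lk Γ t} := by
  obtain ⟨k, -, w, -, hw, e⟩ := exists_cycRed (J := Set.univ) (g := ⁅d₁, d₂⁆)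
    (by simp [special_univ])
  refine ⟨k, {x | ∃ y ∈ w, y.1 = x}, ?_, ?_, fun b hb₁ hb₂ => ?_⟩
  · have hab : ab ℤ (wp Γ w) = 0 := by
      rw [← ab_conj ℤ k, ← e, commutatorElement_def]; simp
    have hne : wp Γ w ≠ 1 := by
      intro h'; rw [h'] at e; simp at e; exact he (by simpa using e)
    cases w with
    | nil => simp at hne
    | cons y w =>
      by_contra hnt
      rw [Set.not_nontrivial_iff] at hnt
      have hy : ∀ r ∈ y :: w, lt Γ r ∈ Subgroup.zpowers (raagGen Γ y.1) := by
        intro r hr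
        have : r.1 = y.1 := hnt ⟨r, hr, rfl⟩ ⟨y, by simp, rfl⟩
        rw [← this]
        rcases r with ⟨r, b⟩
        cases b <;> simp
      have hz : wp Γ (y :: w) ∈ Subgroup.zpowers (raagGen Γ y.1) := by
        rw [wp]
        refine Subgroup.list_prod_mem _ fun x hx => ?_
        obtain ⟨r, hr, rfl⟩ := List.mem_map.1 hx
        exact hy r hr
      obtain ⟨n, hn⟩ := hz
      rw [← hn] at hab hne
      classical
      simp only [ab_zpow, ab_gen] at hab
      have := congrFun hab y.1
      simp at this
      simp [this] at hne
  · rw [e]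
    have : k⁻¹ * (k * wp Γ w * k⁻¹) * k = wp Γ w := by group
    rw [this]
    exact wp_mem fun y hy => ⟨y, hy, rfl⟩
  · refine special_mono ?_ (hw.mem_of_fix fun h s hs => ?_)
    · rintro t ht _ ⟨y, hy, rfl⟩
      exact ht y hy
    · rw [← e] at hs
      exact commutator_smul' hs hb₁ hb₂

lemma eq_of_mem_special {J : Set V} {ψ : RAAG Γ →* RAAG Γ}
    (h : ∀ x ∈ J, ψ (raagGen Γ x) = raagGen Γ x) {g : RAAG Γ} (hg : g ∈ SpecialSubgroup Γ J) :
    ψ g = g := by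
  refine MonoidHom.eqOn_closure (f := ψ) (g := MonoidHom.id _) ?_ hg
  rintro _ ⟨x, hx, rfl⟩
  exact h x hx

/-- A pair of elements in the special subgroup of a nontrivial link whose common centralizer,
and even the stabilizer of all halfspaces skewered by the commutator, is as small as possible. -/
lemma exists_generic_pair [Fintype V] (hΓ : TriFree Γ) {v : V} (hv : (lk Γ v).Nontrivial) :
    ∃ d₁ ∈ LS Γ v, ∃ d₂ ∈ LS Γ v, ⁅d₁, d₂⁆ ≠ 1 ∧
      ∀ b, (∀ h s, ⁅d₁, d₂⁆ • (HS h s : Set (RAAG Γ)) ⊂ HS h s → b • HS h s = HS h s) →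
        b ∈ SpecialSubgroup Γ (Uset Γ v) := by
  classical
  obtain ⟨a, ha, a', ha', hne⟩ := hv
  set l : List V := (Set.toFinite (lk Γ v \ {a})).toFinset.toList with hl
  have hmem : ∀ x, x ∈ l ↔ x ∈ lk Γ v ∧ x ≠ a := by simp [hl]
  have hnd : l.Nodup := Finset.nodup_toList _
  set d : RAAG Γ := (l.map (raagGen Γ)).prod with hd
  have hprod : ∀ (J : Set V) (l' : List V), (∀ x ∈ l', x ∈ J) →
      (l'.map (raagGen Γ)).prod ∈ SpecialSubgroup Γ J := by
    intro J l' h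
    refine Subgroup.list_prod_mem _ fun x hx => ?_
    obtain ⟨r, hr, rfl⟩ := List.mem_map.1 hx
    exact gen_mem (h r hr)
  have hdJ : d ∈ SpecialSubgroup Γ (lk Γ v \ {a}) := hprod _ _ fun x hx => (hmem x).1 hx
  have hdv : d ∈ LS Γ v := special_mono Set.sdiff_subset hdJ
  have hd1 : d ≠ 1 := by
    intro h1
    have hret : ret Γ {a'} d = raagGen Γ a' := by
      obtain ⟨l₁, l₂, e⟩ := List.append_of_mem ((hmem a').2 ⟨ha', hne.symm⟩)
      rw [e] at hnd
      simp only [List.nodup_append, List.nodup_cons, List.mem_cons, forall_eq_or_imp] at hnd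
      rw [hd, e, List.map_append, List.prod_append, List.map_cons, List.prod_cons, map_mul,
        map_mul, ret_gen, if_pos (Set.mem_singleton _),
        ret_of_disjoint (J' := {a'}ᶜ) (by simp) (hprod _ _ fun x hx => ?_),
        ret_of_disjoint (J' := {a'}ᶜ) (by simp) (hprod _ _ fun x hx => ?_)]
      · simp
      · intro h'; subst h'; exact hnd.2.1.1 hx
      · intro h'; subst h'; exact (hnd.2.2 _ hx).1 rfl
    rw [h1, map_one] at hret
    exact lt_ne_one (Γ := Γ) (a', true) (by rw [lt_true, ← hret])
  have hadj : ∀ x ∈ lk Γ v, ∀ y ∈ lk Γ v, ¬ Γ.Adj x y :=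
    fun x hx y hy => hΓ.tri x v y (SimpleGraph.Adj.symm hx) hy
  have he : ⁅raagGen Γ a, d⁆ ≠ 1 := by
    rw [Ne, commutatorElement_eq_one_iff_mul_comm]
    intro h
    have hS : S (a, true) (raagGen Γ a * d) := by
      rw [S_mul_special (J := lk Γ v \ {a}) (by simp) hdJ]
      simpa using S_lt (Γ := Γ) (a, true)
    rw [h, ← lt_true (Γ := Γ) a, S_mul_self] at hS
    have hS' : ¬ S (a, true) d := by
      have := S_mul_special (s := (a, true)) (J := lk Γ v \ {a}) (by simp) hdJ 1
      rw [one_mul] at this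
      rw [this]; exact S_one _
    have hda : d ∈ LS Γ a := by
      by_contra h'
      exact hS ⟨fun h => absurd h hS', fun h => absurd h h'⟩
    have := special_inter hda hdv
    rw [show lk Γ a ∩ lk Γ v = ∅ by
      ext x; exact ⟨fun h' => hadj a ha x h'.2 h'.1, fun h' => h'.elim⟩] at this
    exact hd1 (special_empty this)
  refine ⟨_, gen_mem ha, d, hdv, he, fun b hb => ?_⟩
  have hev : ⁅raagGen Γ a, d⁆ ∈ LS Γ v := by
    rw [commutatorElement_def]
    exact mul_mem (mul_mem (mul_mem (gen_mem ha) hdv) (inv_mem (gen_mem ha))) (inv_mem hdv)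
  obtain ⟨k, hk, w, hwv, hw, e⟩ := exists_cycRed hev
  have hall : ∀ i ∈ lk Γ v, ∃ y ∈ w, y.1 = i := by
    intro i hi
    by_contra! hno
    have key : ∀ t : RAAG Γ, (i = a → t = 1) →
        (∀ l₁ l₂, l = l₁ ++ i :: l₂ →
          t = ((l₁.map (raagGen Γ)).prod)⁻¹ * ((l₂.map (raagGen Γ)).prod)⁻¹) → False := by
      intro t ht1 ht2
      let f : V → RAAG Γ := fun x => if x = i then t else if x ∈ lk Γ v then raagGen Γ x else 1
      let ψ : RAAG Γ →* RAAG Γ := endo f (by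
        intro x y hxy
        by_cases hx : x ∈ lk Γ v
        · have : y ∉ lk Γ v := fun hy => hadj x hx y hy hxy
          have hy : f y = 1 := by
            simp only [f, if_neg this, ite_eq_right_iff]
            rintro rfl; exact absurd hi this
          simp [hy]
        · have hy : f x = 1 := by
            simp only [f, if_neg hx, ite_eq_right_iff]
            rintro rfl; exact absurd hi hx
          simp [hy])
      have hψ : ∀ {g}, g ∈ SpecialSubgroup Γ (lk Γ v \ {i}) → ψ g = g := fun hg =>
        eq_of_mem_special (fun x hx => by
          have : x ≠ i := hx.2
          simp [ψ, f, this, hx.1]) hg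
      have hψi : ψ (raagGen Γ i) = t := by simp [ψ, f]
      have hψe : ψ ⁅raagGen Γ a, d⁆ = 1 := by
        rw [map_commutatorElement]
        by_cases hia : i = a
        · rw [← hia, hψi, ht1 hia, commutatorElement_one_left]
        · obtain ⟨l₁, l₂, el⟩ := List.append_of_mem ((hmem i).2 ⟨hi, hia⟩)
          have hlm : ∀ x ∈ l, x ∈ lk Γ v := fun x hx => ((hmem x).1 hx).1
          rw [el] at hnd hlm
          simp only [List.nodup_append, List.nodup_cons, List.mem_cons, forall_eq_or_imp] at hnd
          have : ψ d = 1 := by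
            rw [hd, el, List.map_append, List.prod_append, List.map_cons, List.prod_cons, map_mul,
              map_mul, hψi, ht2 _ _ el, hψ (hprod _ _ fun x hx => ⟨hlm x (by simp [hx]), ?_⟩),
              hψ (hprod _ _ fun x hx => ⟨hlm x (by simp [hx]), ?_⟩)]
            · group
            · rintro rfl; exact hnd.2.1.1 hx
            · rintro rfl; exact (hnd.2.2 _ hx).1 rfl
          rw [this, commutatorElement_one_right]
      rw [e, map_mul, map_mul, map_inv, mul_inv_eq_one, mul_eq_left,
        hψ (wp_mem fun y hy => ⟨hwv y hy, hno y hy⟩)] at hψe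
      rw [hψe] at e
      exact he (by simpa using e)
    by_cases hia : i = a
    · exact key 1 (fun _ => rfl) fun l₁ l₂ el =>
        absurd hia ((hmem i).1 (by rw [el]; simp)).2
    · obtain ⟨l₁, l₂, el⟩ := List.append_of_mem ((hmem i).2 ⟨hi, hia⟩)
      refine key (((l₁.map (raagGen Γ)).prod)⁻¹ * ((l₂.map (raagGen Γ)).prod)⁻¹)
        (fun h => absurd h hia) fun l₁' l₂' el' => ?_
      rw [el] at el' hnd
      obtain ⟨rfl, rfl⟩ : l₁ = l₁' ∧ l₂ = l₂' := by
        simp only [List.nodup_append, List.nodup_cons, List.mem_cons, forall_eq_or_imp] at hnd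
        rcases List.append_eq_append_iff.1 el' with ⟨q, h1, h2⟩ | ⟨q, h1, h2⟩
        · cases q with
          | nil => simp_all
          | cons r q =>
            simp only [List.cons_append, List.cons.injEq] at h2
            exact absurd (by rw [h2.2]; simp) hnd.2.1.1
        · cases q with
          | nil => simp_all
          | cons r q =>
            simp only [List.cons_append, List.cons.injEq] at h2
            exact absurd rfl (hnd.2.2 r (by rw [h1]; simp)|>.1 <| h2.1.symm ▸ ·)
      rfl
  have h1 : k⁻¹ * b * k ∈ SpecialSubgroup Γ (Uset Γ v) := by
    refine special_mono ?_ (hw.mem_of_fix fun h s hs => hb h s (e ▸ hs))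
    intro t ht i hi
    obtain ⟨y, hy, rfl⟩ := hall i hi
    exact ht y hy
  have h2 := U_commute h1 hk
  have h3 : b = k⁻¹ * b * k := by
    have : b = k * (k⁻¹ * b * k) * k⁻¹ := by group
    rw [← h2.eq, mul_inv_cancel_right] at this
    exact this
  rw [h3]
  exact h1

end Cyclic

end

section

/-! ### Automorphisms preserve the special subgroups of dominating sets up to conjugacy -/

section Core

open scoped Pointwise commutatorElement

lemma special_commute {J K : Set V} (h : ∀ x ∈ J, ∀ y ∈ K, Γ.Adj x y) {f l : RAAG Γ}
    (hf : f ∈ SpecialSubgroup Γ J) (hl : l ∈ SpecialSubgroup Γ K) : Commute f l := by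
  obtain ⟨w, hw, rfl⟩ := exists_wp hf
  clear hf
  induction w with
  | nil => exact Commute.one_left l
  | cons s w ih =>
    rw [wp_cons]
    refine Commute.mul_left (LS_commute_lt ?_).symm (ih fun r hr => hw r (by simp [hr]))
    exact special_mono (fun y hy => h _ (hw s (by simp)) y hy) hl

lemma mem_special_singleton {t : V} {g : RAAG Γ} (h : g ∈ SpecialSubgroup Γ {t}) :
    ∃ n : ℤ, g = raagGen Γ t ^ n := by
  rw [SpecialSubgroup, Set.image_singleton, Subgroup.mem_closure_singleton] at h
  exact h.imp fun _ h => h.symm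

lemma exists_core [Fintype V] (hΓ : TriFree Γ) (φ : MulAut (RAAG Γ)) {v : V}
    (hv : (lk Γ v).Nontrivial) :
    ∃ (k : RAAG Γ) (T : Set V), (∀ t ∈ T, (lk Γ t).Nontrivial ∧ Uset Γ t ⊆ T) ∧
      ∀ b, b ∈ SpecialSubgroup Γ (Uset Γ v) ↔ k⁻¹ * φ b * k ∈ SpecialSubgroup Γ T := by
  obtain ⟨d₁, hd₁, d₂, hd₂, he, hgen⟩ := exists_generic_pair hΓ hv
  have he' : ⁅φ d₁, φ d₂⁆ ≠ 1 := by
    rw [← map_commutatorElement]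
    exact fun h => he (φ.injective (h.trans (map_one φ).symm))
  obtain ⟨k, L, hL, hk, hcore⟩ := exists_commutator_core he'
  rw [← map_commutatorElement] at hk
  have hev : ⁅d₁, d₂⁆ ∈ LS Γ v := by
    rw [commutatorElement_def]
    exact mul_mem (mul_mem (mul_mem hd₁ hd₂) (inv_mem hd₁)) (inv_mem hd₂)
  have hfwd : ∀ b ∈ SpecialSubgroup Γ (Uset Γ v),
      k⁻¹ * φ b * k ∈ SpecialSubgroup Γ {t | L ⊆ lk Γ t} := fun b hb =>
    hcore _ ((U_commute hb hd₁).map φ) ((U_commute hb hd₂).map φ)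
  refine ⟨k, {t | L ⊆ lk Γ t}, fun t ht => ⟨hL.mono ht, fun x hx y hy => hx (ht hy)⟩,
    fun b => ⟨hfwd b, fun hb => hgen b fun h s hs => ?_⟩⟩
  set e := ⁅d₁, d₂⁆ with hedef
  have hbe : Commute b e := by
    have h1 := special_commute (J := {t | L ⊆ lk Γ t}) (K := L)
      (fun x hx y hy => show y ∈ lk Γ x from hx hy) hb hk
    have h2 := h1.map (MulAut.conj k).toMonoidHom
    have h3 : Commute (φ b) (φ e) := by
      simpa [MulAut.conj_apply, mul_assoc] using h2
    have h4 := h3.map φ⁻¹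
    simpa using h4
  by_contra hbs
  obtain ⟨τ, hτ⟩ := exists_translation e s
  let bC : Subgroup.centralizer {e} := ⟨b, Subgroup.mem_centralizer_singleton_iff.2 hbe.eq⟩
  let eC : Subgroup.centralizer {e} := ⟨e, Subgroup.mem_centralizer_singleton_iff.2 rfl⟩
  have hτe : (τ eC).toAdd ≠ 0 := fun h0 => hs.ne ((hτ eC h hs).1 h0)
  have hτb : (τ bC).toAdd ≠ 0 := fun h0 => hbs ((hτ bC h hs).1 h0)
  set r := (τ eC).toAdd
  set β := (τ bC).toAdd
  set z := b ^ r * e ^ (-β) with hz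
  have hz1 : z • HS h s = HS h s := by
    refine (hτ (bC ^ r * eC ^ (-β)) h hs).1 ?_
    rw [map_mul, map_zpow, map_zpow]
    refine Multiplicative.toAdd.injective ?_
    simp only [toAdd_mul, toAdd_zpow, toAdd_one]
    simp only [smul_eq_mul]
    change r * β + -β * r = 0
    ring
  have hlab : ∀ {h' s'}, e • (HS h' s' : Set (RAAG Γ)) ⊂ HS h' s' → s'.1 ∈ lk Γ v := fun h' =>
    label_of_skewer (h := 1) h' (by simpa using hev)
  have hzL : h⁻¹ * z * h ∈ LS Γ s.1 := by
    rw [smul_HS, HS_eq_iff] at hz1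
    simpa [mul_assoc] using hz1.2
  have hzc : Commute z e :=
    (hbe.zpow_left r).mul_left ((Commute.refl e).zpow_left (-β))
  have hadj : ∀ x ∈ lk Γ v, ∀ y ∈ lk Γ v, ¬ Γ.Adj x y :=
    fun x hx y hy => hΓ.tri x v y (SimpleGraph.Adj.symm hx) hy
  have hzU : z ∈ SpecialSubgroup Γ (Uset Γ v) := by
    refine hgen z fun h' s' hs' => ?_
    rcases skewer_trichotomy hs' hzc with h1 | h1 | h1
    · exact h1
    · exact absurd (label_of_skewer h1 hzL) (hadj _ (hlab hs) _ (hlab hs'))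
    · refine absurd (label_of_skewer (h := h) (J := lk Γ s.1) h1 ?_) (hadj _ (hlab hs) _ (hlab hs'))
      have := inv_mem hzL
      simpa [mul_assoc] using this
  have h1 := hfwd z hzU
  have h2 : k⁻¹ * φ (e ^ (-β)) * k ∈ SpecialSubgroup Γ {t | L ⊆ lk Γ t} := by
    have h3 : (k⁻¹ * φ b * k) ^ r = k⁻¹ * φ (b ^ r) * k := by
      have := conj_zpow (i := r) (a := k⁻¹) (b := φ b)
      simpa using this
    have h4 := mul_mem (inv_mem (zpow_mem hb r)) h1
    rw [h3, hz, map_mul] at h4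
    convert h4 using 1
    group
  have h3 : k⁻¹ * φ (e ^ (-β)) * k ∈ SpecialSubgroup Γ L := by
    have h3 : (k⁻¹ * φ e * k) ^ (-β) = k⁻¹ * φ (e ^ (-β)) * k := by
      have := conj_zpow (i := -β) (a := k⁻¹) (b := φ e)
      simpa using this
    rw [← h3]
    exact zpow_mem hk _
  have h4 := special_inter h2 h3
  rw [show {t | L ⊆ lk Γ t} ∩ L = ∅ by
    ext x; exact ⟨fun h' => Γ.loopless.irrefl x (h'.1 h'.2), fun h' => h'.elim⟩] at h4
  have h6 : e ^ (-β) = 1 := by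
    refine φ.injective ?_
    calc φ (e ^ (-β)) = k * (k⁻¹ * φ (e ^ (-β)) * k) * k⁻¹ := by group
      _ = φ 1 := by rw [special_empty h4, map_one]; group
  have h7 : eC ^ (-β) = 1 := Subtype.ext h6
  have h8 := congrArg (fun x => (τ x).toAdd) h7
  simp only [map_zpow, toAdd_zpow, map_one, toAdd_one, smul_eq_mul] at h8
  change -β * r = 0 at h8
  rcases mul_eq_zero.1 h8 with h9 | h9
  · exact hτb (by simpa using h9)
  · exact hτe h9

end Core

/-! ### The graph symmetry induced by an automorphism -/

section Symmetry

variable [Fintype V]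

lemma exists_perm_single [DecidableEq V] {K : Type*} [Field K] (f : (V → K) ≃ₗ[K] (V → K)) :
    ∃ σ : Equiv.Perm V, ∀ v, f (Pi.single v 1) (σ v) ≠ 0 := by
  have hdet : (LinearMap.toMatrix' f.toLinearMap).det ≠ 0 := by
    rw [LinearMap.det_toMatrix']
    exact (LinearEquiv.isUnit_det' f).ne_zero
  rw [Matrix.det_apply] at hdet
  obtain ⟨σ, -, hσ⟩ := Finset.exists_ne_zero_of_sum_ne_zero hdet
  refine ⟨σ, fun v hv => hσ ?_⟩
  rw [Finset.prod_eq_zero (Finset.mem_univ v), smul_zero]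
  simpa [LinearMap.toMatrix'_apply] using hv

lemma perm_pow_pred {α : Type*} [Finite α] (σ : Equiv.Perm α) (x : α) :
    (σ ^ (orderOf σ - 1)) (σ x) = x := by
  have h : 0 < orderOf σ := orderOf_pos σ
  rw [← Equiv.Perm.mul_apply, ← pow_succ, Nat.sub_add_cancel h, pow_orderOf_eq_one]
  rfl

lemma exists_perm_core (hΓ : TriFree Γ) (φ : MulAut (RAAG Γ)) :
    ∃ σ : Equiv.Perm V, (∀ v, ab ℚ (φ (raagGen Γ v)) (σ v) ≠ 0) ∧
      ∀ v, (lk Γ v).Nontrivial → σ '' Uset Γ v = Uset Γ (σ v) ∧ ∃ k : RAAG Γ,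
        ∀ b, b ∈ SpecialSubgroup Γ (Uset Γ v) ↔
          k⁻¹ * φ b * k ∈ SpecialSubgroup Γ (Uset Γ (σ v)) := by
  classical
  obtain ⟨σ, hσ⟩ := exists_perm_single (abEquiv ℚ φ)
  obtain ⟨σ', hσ'⟩ := exists_perm_single (abEquiv ℚ φ⁻¹)
  simp only [← ab_gen (Γ := Γ), ← ab_aut] at hσ hσ'
  have key : ∀ v, (lk Γ v).Nontrivial → ∃ T : Set V,
      (∀ t ∈ T, (lk Γ t).Nontrivial ∧ Uset Γ t ⊆ T) ∧ σ '' Uset Γ v = T ∧ ∃ k : RAAG Γ,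
      ∀ b, b ∈ SpecialSubgroup Γ (Uset Γ v) ↔ k⁻¹ * φ b * k ∈ SpecialSubgroup Γ T := by
    intro v hv
    obtain ⟨k, T, hT, hk⟩ := exists_core hΓ φ hv
    refine ⟨T, hT, ?_, k, hk⟩
    have h1 : σ '' Uset Γ v ⊆ T := by
      rintro _ ⟨x, hx, rfl⟩
      by_contra h
      exact hσ x (ab_mem_suppIn ℚ ((hk _).1 (gen_mem hx)) _ h)
    have h2 : σ' '' T ⊆ Uset Γ v := by
      rintro _ ⟨x, hx, rfl⟩
      by_contra h
      refine hσ' x ?_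
      have h3 : φ⁻¹ (k * raagGen Γ x * k⁻¹) ∈ SpecialSubgroup Γ (Uset Γ v) := by
        rw [hk]
        simpa [mul_assoc] using gen_mem hx
      rw [map_mul, map_mul, map_inv] at h3
      exact ab_mem_suppIn ℚ (k := (φ⁻¹ k)⁻¹) (by simpa using h3) _ h
    refine Set.eq_of_subset_of_ncard_le h1 ?_
    rw [Set.ncard_image_of_injective _ σ.injective, ← Set.ncard_image_of_injective T σ'.injective]
    exact Set.ncard_le_ncard h2
  have hle : ∀ v, (lk Γ v).Nontrivial → (lk Γ (σ v)).Nontrivial ∧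
      (Uset Γ (σ v)).ncard ≤ (Uset Γ v).ncard := by
    intro v hv
    obtain ⟨T, hT, hσT, -⟩ := key v hv
    have hm : σ v ∈ T := hσT ▸ Set.mem_image_of_mem _ (self_mem_Uset v)
    refine ⟨(hT _ hm).1, ?_⟩
    rw [← Set.ncard_image_of_injective (Uset Γ v) σ.injective, hσT]
    exact Set.ncard_le_ncard (hT _ hm).2
  have hiter : ∀ (n : ℕ) v, (lk Γ v).Nontrivial → (lk Γ ((σ ^ n) v)).Nontrivial ∧
      (Uset Γ ((σ ^ n) v)).ncard ≤ (Uset Γ v).ncard := by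
    intro n
    induction n with
    | zero => intro v hv; exact ⟨hv, le_rfl⟩
    | succ n ih =>
      intro v hv
      obtain ⟨h1, h2⟩ := hle v hv
      obtain ⟨h3, h4⟩ := ih _ h1
      rw [pow_succ, Equiv.Perm.mul_apply]
      exact ⟨h3, h4.trans h2⟩
  refine ⟨σ, hσ, fun v hv => ?_⟩
  obtain ⟨T, hT, hσT, k, hk⟩ := key v hv
  have hm : σ v ∈ T := hσT ▸ Set.mem_image_of_mem _ (self_mem_Uset v)
  have hU : Uset Γ (σ v) = T := by
    refine Set.eq_of_subset_of_ncard_le (hT _ hm).2 ?_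
    rw [← hσT, Set.ncard_image_of_injective _ σ.injective]
    have := (hiter (orderOf σ - 1) _ (hle v hv).1).2
    rwa [perm_pow_pred] at this
  rw [hU]
  exact ⟨hσT, k, hk⟩

lemma Uset_of_leaf {u w : V} (hu : ¬ (lk Γ u).Nontrivial) (h : Γ.Adj u w) : Uset Γ w = {w} := by
  ext x
  refine ⟨fun hx => ?_, by rintro rfl; exact self_mem_Uset x⟩
  by_contra hne
  exact hu ⟨w, h, x, SimpleGraph.Adj.symm (hx (SimpleGraph.Adj.symm h)), Ne.symm hne⟩

/-- Every automorphism, up to a graph symmetry, preserves the special subgroups of the dominating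
sets of the non-leaf vertices up to conjugacy. -/
lemma exists_symmetry (hΓ : TriFree Γ)
    (hleaf : ∀ u v, Γ.Adj u v → (lk Γ u).Nontrivial ∨ (lk Γ v).Nontrivial)
    (φ : MulAut (RAAG Γ)) : ∃ σ : Γ ≃g Γ, ∀ v, (lk Γ v).Nontrivial → ∃ k : RAAG Γ,
      ∀ b, b ∈ SpecialSubgroup Γ (Uset Γ v) ↔
        k⁻¹ * (φ * (symAut σ)⁻¹) b * k ∈ SpecialSubgroup Γ (Uset Γ v) := by
  classical
  obtain ⟨σ, hσ, hcore⟩ := exists_perm_core hΓ φ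
  have hab : ∀ {t x : V} {i : ℤ} {l : RAAG Γ}, l ∈ LS Γ t →
      ab ℚ (raagGen Γ t ^ i * l) x ≠ 0 → x ≠ t → Γ.Adj t x := by
    intro t x i l hl h hne
    by_contra hnot
    refine h ?_
    rw [ab_mul, ab_zpow, ab_gen, Pi.add_apply, ab_special ℚ hl hnot]
    simp [hne]
  have hleaf' : ∀ u w, ¬ (lk Γ u).Nontrivial → Γ.Adj u w → Γ.Adj (σ w) (σ u) := by
    intro u w hu huw
    have hw := (hleaf u w huw).resolve_left hu
    obtain ⟨hU, k, hk⟩ := hcore w hw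
    rw [Uset_of_leaf hu huw, Set.image_singleton] at hU
    rw [← hU] at hk
    obtain ⟨n, hn⟩ := mem_special_singleton ((hk _).1 (gen_mem (self_mem_Uset w)))
    have hn0 : n ≠ 0 := by
      rintro rfl
      have h1 : ab ℚ (φ (raagGen Γ w)) = 0 := by
        rw [← ab_inv_conj ℚ _ k, hn, zpow_zero, ab_one]
      exact hσ w (by rw [h1]; rfl)
    have hc : Commute (k⁻¹ * φ (raagGen Γ u) * k) (raagGen Γ (σ w) ^ n) := by
      rw [← hn]
      have h1 : Commute (φ (raagGen Γ u)) (φ (raagGen Γ w)) :=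
        Commute.map (show Commute _ _ from gen_comm huw) φ
      have h2 := h1.map (MulAut.conj k⁻¹).toMonoidHom
      simpa [MulAut.conj_apply] using h2
    obtain ⟨i, l, hl, e⟩ := commute_gen_zpow hn0 hc
    refine hab hl (x := σ u) (i := i) ?_ (σ.injective.ne huw.ne)
    rw [← e, ab_inv_conj]
    exact hσ u
  have hadj : ∀ u v, Γ.Adj u v → Γ.Adj (σ u) (σ v) := by
    intro u v huv
    by_cases hu : (lk Γ u).Nontrivial
    swap
    · exact (hleaf' u v hu huv).symm
    by_cases hv : (lk Γ v).Nontrivial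
    swap
    · exact hleaf' v u hv huv.symm
    obtain ⟨-, k, hk⟩ := hcore u hu
    obtain ⟨-, k', hk'⟩ := hcore v hv
    have h1 : φ⁻¹ (k * raagGen Γ (σ u) * k⁻¹) ∈ SpecialSubgroup Γ (Uset Γ u) := by
      rw [hk]; simpa [mul_assoc] using gen_mem (self_mem_Uset (σ u))
    have h2 : φ⁻¹ (k' * raagGen Γ (σ v) * k'⁻¹) ∈ SpecialSubgroup Γ (Uset Γ v) := by
      rw [hk']; simpa [mul_assoc] using gen_mem (self_mem_Uset (σ v))
    have h3 := special_commute (fun x hx y hy =>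
      Γ.adj_symm (Uset_adj hy (SimpleGraph.Adj.symm (Uset_adj hx huv)))) h1 h2
    have h4 : Commute (k * raagGen Γ (σ u) * k⁻¹) (k' * raagGen Γ (σ v) * k'⁻¹) := by
      simpa using h3.map φ
    have h5 : Commute (k⁻¹ * k' * raagGen Γ (σ v) * (k⁻¹ * k')⁻¹) (raagGen Γ (σ u)) := by
      simpa [MulAut.conj_apply, mul_assoc] using (h4.map (MulAut.conj k⁻¹).toMonoidHom).symm
    obtain ⟨i, l, hl, e⟩ := commute_gen h5
    refine hab hl (i := i) ?_ (σ.injective.ne huv.ne')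
    rw [← e, ab_conj, ab_gen]
    simp
  have hiter : ∀ (n : ℕ) u v, Γ.Adj u v → Γ.Adj ((σ ^ n) u) ((σ ^ n) v) := by
    intro n
    induction n with
    | zero => exact fun _ _ h => h
    | succ n ih =>
      intro u v h
      rw [pow_succ, Equiv.Perm.mul_apply, Equiv.Perm.mul_apply]
      exact ih _ _ (hadj _ _ h)
  let σ' : Γ ≃g Γ := ⟨σ, fun {u v} => ⟨fun h => by
    have := hiter (orderOf σ - 1) _ _ h
    rwa [perm_pow_pred, perm_pow_pred] at this, hadj u v⟩⟩
  have hlk : ∀ v x, x ∈ lk Γ v ↔ σ' x ∈ lk Γ (σ' v) := fun v x => σ'.map_rel_iff.symm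
  refine ⟨σ', fun v hv => ?_⟩
  obtain ⟨v, rfl⟩ := σ'.surjective v
  have hv' : (lk Γ v).Nontrivial := by
    obtain ⟨a, ha, b, hb, hne⟩ := hv
    obtain ⟨a, rfl⟩ := σ'.surjective a
    obtain ⟨b, rfl⟩ := σ'.surjective b
    exact ⟨a, (hlk _ _).2 ha, b, (hlk _ _).2 hb, fun h => hne (h ▸ rfl)⟩
  obtain ⟨hU, k, hk⟩ := hcore v hv'
  refine ⟨k, fun b => ?_⟩
  obtain ⟨b, rfl⟩ := (symAut σ').surjective b
  have h1 : symAut σ' b ∈ SpecialSubgroup Γ (Uset Γ (σ' v)) ↔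
      b ∈ SpecialSubgroup Γ (Uset Γ v) := by
    constructor
    · intro h
      have := map_special (symAut σ')⁻¹ (Uset Γ (σ' v)) (SpecialSubgroup Γ (Uset Γ v)) ?_ h
      · simpa using this
      · intro x hx
        change x ∈ Uset Γ (σ v) at hx
        rw [← hU] at hx
        obtain ⟨y, hy, rfl⟩ := hx
        have e : (symAut σ')⁻¹ (raagGen Γ (σ y)) = raagGen Γ y := aut_inv_gen (symAut_gen σ' y)
        rw [e]
        exact gen_mem hy
    · refine map_special (symAut σ') _ _ fun x hx => ?_
      rw [symAut_gen]
      refine gen_mem ?_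
      change σ x ∈ Uset Γ (σ v)
      rw [← hU]
      exact Set.mem_image_of_mem _ hx
  rw [h1, hk]
  simp only [MulAut.mul_apply, MulAut.inv_apply_self]
  rfl

end Symmetry

end

section

/-! ### Making an automorphism good -/

lemma exists_transvection_zpow {x w : V} (hne : w ≠ x) (hst : lk Γ x ⊆ starOf Γ w) (m : ℤ) :
    ∃ α ∈ Aut0 Γ, α (raagGen Γ x) = raagGen Γ x * raagGen Γ w ^ m ∧
      ∀ y, y ≠ x → α (raagGen Γ y) = raagGen Γ y := by
  induction m using Int.induction_on with
  | zero => exact ⟨1, one_mem _, by simp, fun _ _ => rfl⟩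
  | succ m ih =>
    obtain ⟨α, hα, h1, h2⟩ := ih
    obtain ⟨β, hβ, h3, h4⟩ := exists_transvection_right (p := (w, true)) hne hst
    refine ⟨α * β, mul_mem hα hβ, ?_, fun y hy => ?_⟩
    · rw [MulAut.mul_apply, h3, map_mul, h1, lt_true, h2 w hne, zpow_add_one, mul_assoc]
    · rw [MulAut.mul_apply, h4 y hy, h2 y hy]
  | pred m ih =>
    obtain ⟨α, hα, h1, h2⟩ := ih
    obtain ⟨β, hβ, h3, h4⟩ := exists_transvection_right (p := (w, false)) hne hst
    refine ⟨α * β, mul_mem hα hβ, ?_, fun y hy => ?_⟩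
    · rw [MulAut.mul_apply, h3, map_mul, h1, lt_false, map_inv, h2 w hne, zpow_sub_one, mul_assoc]
    · rw [MulAut.mul_apply, h4 y hy, h2 y hy]

lemma exists_transvections {f : V → V} {m : V → ℤ} (A : Finset V)
    (hA : ∀ x ∈ A, f x ∉ A ∧ lk Γ x ⊆ starOf Γ (f x)) :
    ∃ α ∈ Aut0 Γ, (∀ x ∈ A, α (raagGen Γ x) = raagGen Γ x * raagGen Γ (f x) ^ m x) ∧
      ∀ x ∉ A, α (raagGen Γ x) = raagGen Γ x := by
  classical
  induction A using Finset.induction_on with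
  | empty => exact ⟨1, one_mem _, by simp, fun _ _ => rfl⟩
  | insert x A hx ih =>
    obtain ⟨α, hα, h1, h2⟩ := ih fun y hy =>
      ⟨fun h => (hA y (by simp [hy])).1 (by simp [h]), (hA y (by simp [hy])).2⟩
    obtain ⟨h5, h6⟩ := hA x (by simp)
    rw [Finset.mem_insert, not_or] at h5
    obtain ⟨β, hβ, h3, h4⟩ := exists_transvection_zpow h5.1 h6 (m x)
    refine ⟨α * β, mul_mem hα hβ, fun y hy => ?_, fun y hy => ?_⟩
    · by_cases hyx : y = x
      · subst hyx
        rw [MulAut.mul_apply, h3, map_mul, map_zpow, h2 _ hx, h2 _ h5.2]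
      · rw [MulAut.mul_apply, h4 y hyx, h1 y ((Finset.mem_insert.1 hy).resolve_left hyx)]
    · rw [Finset.mem_insert, not_or] at hy
      rw [MulAut.mul_apply, h4 y hy.1, h2 y hy.2]

section

variable [Fintype V]

lemma exists_good_of_core (hΓ : TriFree Γ)
    (hleaf : ∀ u v, Γ.Adj u v → (lk Γ u).Nontrivial ∨ (lk Γ v).Nontrivial) {φ : MulAut (RAAG Γ)}
    (h : ∀ v, (lk Γ v).Nontrivial → ∃ k : RAAG Γ, ∀ b, b ∈ SpecialSubgroup Γ (Uset Γ v) ↔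
        k⁻¹ * φ b * k ∈ SpecialSubgroup Γ (Uset Γ v)) :
    ∃ α ∈ Aut0 Γ, ∃ g, Good (φ * α) g := by
  classical
  have h' : ∀ v, ∃ k : RAAG Γ, (lk Γ v).Nontrivial → ∀ b, b ∈ SpecialSubgroup Γ (Uset Γ v) ↔
      k⁻¹ * φ b * k ∈ SpecialSubgroup Γ (Uset Γ v) := fun v => by
    by_cases hv : (lk Γ v).Nontrivial
    · exact (h v hv).imp fun _ hk _ => hk
    · exact ⟨1, fun h => absurd h hv⟩
  choose k hk using h'
  choose f hf using hΓ.nonempty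
  have hfadj : ∀ x, Γ.Adj x (f x) := hf
  have hflk : ∀ x, ¬ (lk Γ x).Nontrivial → lk Γ x = {f x} := fun x hx =>
    (Set.not_nontrivial_iff.1 hx).eq_singleton_of_mem (hf x)
  have hfn : ∀ x, ¬ (lk Γ x).Nontrivial → (lk Γ (f x)).Nontrivial := fun x hx =>
    (hleaf x _ (hfadj x)).resolve_left hx
  have hab : ∀ {t : V} {i : ℤ} {l : RAAG Γ}, l ∈ LS Γ t →
      ab ℤ (raagGen Γ t ^ i * l) t = i := by
    intro t i l hl
    rw [ab_mul, ab_zpow, ab_gen, Pi.add_apply, ab_special ℤ hl (Γ.loopless.irrefl t)]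
    simp
  have hgen : ∀ v, (lk Γ v).Nontrivial → ∃ b ∈ SpecialSubgroup Γ (Uset Γ v),
      φ b = k v * raagGen Γ v * (k v)⁻¹ := by
    intro v hv
    refine ⟨φ⁻¹ (k v * raagGen Γ v * (k v)⁻¹), ?_, by simp⟩
    rw [hk v hv]
    simpa [mul_assoc] using gen_mem (self_mem_Uset v)
  have hU : ∀ v, ¬ (lk Γ v).Nontrivial → Uset Γ v = lk Γ (f v) := fun v hv => by
    ext x
    change lk Γ v ⊆ lk Γ x ↔ x ∈ lk Γ (f v)
    rw [hflk v hv, Set.singleton_subset_iff, mem_lk, mem_lk, SimpleGraph.adj_comm]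
  have hcomm : ∀ v x, (lk Γ v).Nontrivial → Γ.Adj v x →
      ∃ i : ℤ, ∃ l ∈ LS Γ v, (k v)⁻¹ * φ (raagGen Γ x) * k v = raagGen Γ v ^ i * l := by
    intro v x hv hx
    obtain ⟨b, hb, e⟩ := hgen v hv
    refine commute_gen ?_
    have h1 := (U_commute hb (gen_mem (show x ∈ lk Γ v from hx))).symm.map φ
    rw [e] at h1
    simpa [MulAut.conj_apply, mul_assoc] using h1.map (MulAut.conj (k v)⁻¹).toMonoidHom
  have hm : ∀ x, ∃ m : ℤ, ¬ (lk Γ x).Nontrivial →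
      (k (f x))⁻¹ * φ (raagGen Γ x * raagGen Γ (f x) ^ m) * k (f x) ∈ LS Γ (f x) := by
    intro x
    by_cases hx : (lk Γ x).Nontrivial
    · exact ⟨0, fun h => absurd hx h⟩
    set w := f x with hw
    have hUw : Uset Γ w = {w} := Uset_of_leaf hx (hfadj x)
    have hkw := hk w (hfn x hx)
    obtain ⟨i, l, hl, e⟩ := hcomm w x (hfn x hx) (hfadj x).symm
    obtain ⟨n, hn⟩ := mem_special_singleton
      (hUw ▸ (hkw (raagGen Γ w)).1 (gen_mem (self_mem_Uset w)))
    obtain ⟨b, hb, hb'⟩ := hgen w (hfn x hx)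
    rw [hUw] at hb
    obtain ⟨j, rfl⟩ := mem_special_singleton hb
    have hpow : ∀ r : ℤ, (k w)⁻¹ * φ (raagGen Γ w ^ r) * k w = raagGen Γ w ^ (n * r) := by
      intro r
      have := conj_zpow (i := r) (a := (k w)⁻¹) (b := φ (raagGen Γ w))
      rw [inv_inv] at this
      rw [map_zpow, ← this, hn, zpow_mul]
    have hnj : n * j = 1 := by
      have h1 := hpow j
      rw [hb'] at h1
      have h2 := congrArg (fun z => ab ℤ z w) h1
      simpa [mul_assoc, ab_gen, ab_zpow] using h2.symm
    refine ⟨-(j * i), fun _ => ?_⟩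
    have h1 : (k w)⁻¹ * φ (raagGen Γ x * raagGen Γ w ^ (-(j * i))) * k w =
        ((k w)⁻¹ * φ (raagGen Γ x) * k w) * ((k w)⁻¹ * φ (raagGen Γ w ^ (-(j * i))) * k w) := by
      rw [map_mul]; group
    have h2 : n * -(j * i) = -i := by rw [mul_neg, ← mul_assoc, hnj, one_mul]
    rw [h1, hpow, e, h2, mul_assoc, ((LS_commute hl).zpow_right (-i)).eq, zpow_neg,
      mul_inv_cancel_left]
    exact hl
  choose m hm using hm
  obtain ⟨α, hα, hα1, hα2⟩ := exists_transvections (Γ := Γ) (f := f) (m := m)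
    (Finset.univ.filter fun x => ¬ (lk Γ x).Nontrivial) (fun x hx => by
      simp only [Finset.mem_filter, Finset.mem_univ, true_and] at hx ⊢
      refine ⟨not_not.2 (hfn x hx), ?_⟩
      rw [hflk x hx]
      exact Set.singleton_subset_iff.2 (Set.mem_insert _ _))
  simp only [Finset.mem_filter, Finset.mem_univ, true_and, not_not] at hα1 hα2
  refine ⟨α, hα, fun x => if (lk Γ x).Nontrivial then k x else k (f x), ?_, ?_⟩
  · intro v x hx
    rw [MulAut.mul_apply]
    by_cases hv : (lk Γ v).Nontrivial
    · rw [if_pos hv, hα2 x (hv.mono hx), ← hk v hv]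
      exact gen_mem hx
    rw [if_neg hv, hU v hv]
    rw [hU v hv] at hx
    by_cases hx' : (lk Γ x).Nontrivial
    · rw [hα2 x hx']
      obtain ⟨i, l, hl, e⟩ := hcomm (f v) x (hfn v hv) hx
      have hi : i = 0 := by
        rw [← hab hl (i := i), ← e, ab_inv_conj]
        have h1 := ab_mem_suppIn ℤ ((hk x hx' (raagGen Γ x)).1 (gen_mem (self_mem_Uset x)))
        refine mem_suppIn.1 h1 _ fun h2 => ?_
        exact Γ.loopless.irrefl _ (Uset_adj h2 (SimpleGraph.Adj.symm hx))
      rw [e, hi, zpow_zero, one_mul]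
      exact hl
    · have hfx : f v = f x := by
        have : f v ∈ lk Γ x := SimpleGraph.Adj.symm hx
        rwa [hflk x hx'] at this
      rw [hα1 x hx', hfx]
      exact hm x hx'
  · intro u v huv
    by_cases hu : (lk Γ u).Nontrivial
    swap
    · have hfu : v = f u := by
        have : v ∈ lk Γ u := huv
        rwa [hflk u hu] at this
      rw [if_neg hu, hfu, if_pos (hfn u hu)]
      exact ⟨1, one_mem _, 1, one_mem _, by simp⟩
    by_cases hv : (lk Γ v).Nontrivial
    swap
    · have hfv : u = f v := by
        have : u ∈ lk Γ v := huv.symm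
        rwa [hflk v hv] at this
      rw [if_neg hv, hfv, if_pos (hfn v hv)]
      exact ⟨1, one_mem _, 1, one_mem _, by simp⟩
    rw [if_pos hu, if_pos hv]
    obtain ⟨b, hb, e⟩ := hgen u hu
    obtain ⟨b', hb', e'⟩ := hgen v hv
    have h3 := special_commute (fun x hx y hy =>
      Γ.adj_symm (Uset_adj hy (SimpleGraph.Adj.symm (Uset_adj hx huv)))) hb hb'
    have h4 := h3.map φ
    rw [e, e'] at h4
    set t := (k u)⁻¹ * k v with ht
    have h5 : Commute (t * raagGen Γ v * t⁻¹) (raagGen Γ u) := by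
      simpa [ht, MulAut.conj_apply, mul_assoc] using
        (h4.map (MulAut.conj (k u)⁻¹).toMonoidHom).symm
    obtain ⟨i, l, hl, el⟩ := commute_gen h5
    have hi : i = 0 := by
      rw [← hab hl (i := i), ← el, ab_conj, ab_gen, Pi.single_eq_of_ne huv.ne]
    rw [hi, zpow_zero, one_mul] at el
    set r := ret Γ (lk Γ u) t with hr
    have h6 : r * raagGen Γ v * r⁻¹ = t * raagGen Γ v * t⁻¹ := by
      have h7 := ret_of_mem hl
      rw [← el] at h7
      rw [← h7, map_mul, map_mul, map_inv, ret_gen, if_pos (show v ∈ lk Γ u from huv)]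
    have h7 : Commute (r⁻¹ * t) (raagGen Γ v) := by
      have := congrArg (fun z => r⁻¹ * z * t) h6
      simp only [mul_assoc, inv_mul_cancel_left, inv_mul_cancel, mul_one] at this
      change r⁻¹ * t * raagGen Γ v = raagGen Γ v * (r⁻¹ * t)
      rw [mul_assoc, ← this]
    obtain ⟨j, l', hl', e2⟩ := commute_gen h7
    refine ⟨r, special_mono Set.subset_union_right (ret_mem _ _), r⁻¹ * t, ?_, by group⟩
    rw [e2]
    exact mul_mem (zpow_mem (gen_mem (Set.mem_union_left _ (self_mem_Uset v))) j)
      (special_mono Set.subset_union_right hl')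

lemma exists_good (hΓ : TriFree Γ)
    (hleaf : ∀ u v, Γ.Adj u v → (lk Γ u).Nontrivial ∨ (lk Γ v).Nontrivial) (φ : MulAut (RAAG Γ)) :
    ∃ σ : Γ ≃g Γ, ∃ α ∈ Aut0 Γ, ∃ g, Good (φ * (symAut σ)⁻¹ * α) g := by
  obtain ⟨σ, h⟩ := exists_symmetry hΓ hleaf φ
  exact ⟨σ, exists_good_of_core hΓ hleaf h⟩

end

end

section

/-! ### Pure graph symmetries -/

/-- The vertices whose closed star contains the link of `v`. -/
def Dset (Γ : SimpleGraph V) (v : V) : Set V := {x | lk Γ v ⊆ starOf Γ x}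

lemma mem_starOf {v w : V} : w ∈ starOf Γ v ↔ w = v ∨ Γ.Adj v w := Iff.rfl

lemma self_mem_Dset (v : V) : v ∈ Dset Γ v := Set.subset_insert _ _

lemma Dset_trans {v x y : V} (hx : x ∈ Dset Γ v) (hy : y ∈ Dset Γ x) : y ∈ Dset Γ v := by
  intro z hz
  rcases mem_starOf.1 (hx hz) with rfl | h
  · rcases mem_starOf.1 (hy (SimpleGraph.Adj.symm hz)) with rfl | h'
    · exact Or.inr hz
    · rcases mem_starOf.1 (hx (SimpleGraph.Adj.symm h')) with rfl | h''
      · exact Or.inl rfl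
      · exact Or.inr (SimpleGraph.Adj.symm h'')
  · exact hy h

lemma ab_mem_Dset [Fintype V] {ψ : MulAut (RAAG Γ)} (h : ψ ∈ Aut0 Γ) :
    ∀ v, ab ℚ (ψ (raagGen Γ v)) ∈ suppIn ℚ (Dset Γ v) := by
  classical
  have hgen : ∀ v, ab ℚ (raagGen Γ v) ∈ suppIn ℚ (Dset Γ v) := fun v =>
    mem_suppIn.2 fun x hx => by
      rw [ab_gen, Pi.single_eq_of_ne]
      rintro rfl
      exact hx (self_mem_Dset x)
  have hmono : ∀ {v x}, x ∈ Dset Γ v → suppIn ℚ (Dset Γ x) ≤ suppIn ℚ (Dset Γ v) :=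
    fun hx f hf => mem_suppIn.2 fun y hy => mem_suppIn.1 hf y fun h => hy (Dset_trans hx h)
  induction h using Subgroup.closure_induction with
  | mem ψ hψ =>
    intro v
    rcases hψ with ((⟨g, rfl⟩ | ⟨w, h1, h2⟩) | ⟨u, C, -, h1, h2⟩) | ⟨w, u, -, h1, h2, h3⟩
    · rw [MulAut.conj_apply, ab_conj]
      exact hgen v
    · by_cases hv : v = w
      · subst hv
        rw [h1, ab_inv]
        exact neg_mem (hgen v)
      · rw [h2 v hv]
        exact hgen v
    · by_cases hv : v ∈ C
      · rw [h1 v hv, ab_inv_conj]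
        exact hgen v
      · rw [h2 v hv]
        exact hgen v
    · by_cases hv : v = w
      · subst hv
        rw [h2, ab_mul]
        exact add_mem (hgen v) (hmono h1 (hgen u))
      · rw [h3 v hv]
        exact hgen v
  | one => exact hgen
  | mul φ ψ _ _ hφ hψ =>
    intro v
    rw [MulAut.mul_apply, ab_aut]
    exact abMap_mem_of_gen (fun x hx => hmono hx (hφ x)) (mem_suppIn.1 (hψ v))
  | inv φ _ hφ =>
    intro v
    refine map_suppIn_eq (φ := φ) (fun x hx => hmono hx (hφ x)) ?_
    rw [← ab_aut, MulAut.apply_inv_self]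
    exact hgen v

lemma lk_symm (σ : Γ ≃g Γ) (v : V) : lk Γ (σ v) = σ '' lk Γ v := by
  ext x
  obtain ⟨x, rfl⟩ := σ.surjective x
  rw [σ.injective.mem_set_image, mem_lk, mem_lk, σ.map_adj_iff]

lemma lk_eq_of_symAut_mem [Fintype V] (hΓ : TriFree Γ)
    (hleaf : ∀ u v, Γ.Adj u v → (lk Γ u).Nontrivial ∨ (lk Γ v).Nontrivial) {σ : Γ ≃g Γ}
    (h : symAut σ ∈ Aut0 Γ) (v : V) : lk Γ (σ v) = lk Γ v := by
  classical
  have h1 : lk Γ v ⊆ starOf Γ (σ v) := by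
    by_contra h2
    have h3 := mem_suppIn.1 (ab_mem_Dset h v) (σ v) h2
    rw [symAut_gen, ab_gen, Pi.single_eq_same] at h3
    exact one_ne_zero h3
  by_cases hadj : Γ.Adj v (σ v)
  · have h2 : ¬ (lk Γ v).Nontrivial := by
      rw [Set.not_nontrivial_iff]
      refine Set.subsingleton_of_subset_singleton (a := σ v) fun x hx => ?_
      exact (mem_starOf.1 (h1 hx)).resolve_right fun h3 => hΓ.tri v (σ v) x hadj h3 hx
    refine absurd (hleaf _ _ hadj) (not_or.2 ⟨h2, ?_⟩)
    rwa [lk_symm, Set.image_nontrivial σ.injective]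
  · refine (Set.eq_of_subset_of_ncard_le (fun x hx => ?_) ?_ (Set.toFinite _)).symm
    · refine (mem_starOf.1 (h1 hx)).resolve_left ?_
      rintro rfl
      exact hadj hx
    · rw [lk_symm, Set.ncard_image_of_injective _ σ.injective]

/-- A permutation of the vertices preserving all links, as a graph symmetry. -/
def symOfLk (π : Equiv.Perm V) (h : ∀ v, lk Γ (π v) = lk Γ v) : Γ ≃g Γ :=
  ⟨π, lk_congr_adj (h _) (h _)⟩

lemma symAut_mul (σ τ : Γ ≃g Γ) : symAut (σ * τ) = symAut σ * symAut τ :=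
  aut_ext fun v => by
    rw [MulAut.mul_apply, symAut_gen, symAut_gen, symAut_gen]
    rfl

lemma swap_lk [DecidableEq V] {x y : V} (h : lk Γ x = lk Γ y) (v : V) :
    lk Γ (Equiv.swap x y v) = lk Γ v := by
  by_cases hx : v = x
  · rw [hx, Equiv.swap_apply_left, h]
  by_cases hy : v = y
  · rw [hy, Equiv.swap_apply_right, h]
  rw [Equiv.swap_apply_of_ne_of_ne hx hy]

lemma symAut_swap_mem [Fintype V] [DecidableEq V] {x y : V} (h : lk Γ x = lk Γ y) (hne : x ≠ y) :
    symAut (symOfLk (Equiv.swap x y) (swap_lk h)) ∈ Aut0 Γ := by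
  set s := symAut (symOfLk (Equiv.swap x y) (swap_lk h)) with hs
  have hsx : s (raagGen Γ x) = raagGen Γ y := by
    rw [hs, symAut_gen]; exact congrArg _ (Equiv.swap_apply_left x y)
  have hsy : s (raagGen Γ y) = raagGen Γ x := by
    rw [hs, symAut_gen]; exact congrArg _ (Equiv.swap_apply_right x y)
  have hsz : ∀ z, z ≠ x → z ≠ y → s (raagGen Γ z) = raagGen Γ z := fun z h1 h2 => by
    rw [hs, symAut_gen]; exact congrArg _ (Equiv.swap_apply_of_ne_of_ne h1 h2)
  have hxy : lk Γ x ⊆ starOf Γ y := h ▸ Set.subset_insert _ _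
  have hyx : lk Γ y ⊆ starOf Γ x := h ▸ Set.subset_insert _ _
  obtain ⟨α, hα, a1, a2⟩ := exists_transvection_right (p := (y, true)) hne.symm hxy
  obtain ⟨β, hβ, b1, b2⟩ := exists_transvection_right (p := (x, false)) hne hyx
  obtain ⟨γ, hγ, c1, c2⟩ := exists_transvection_left (p := (y, true)) hne.symm hxy
  rw [lt_true] at a1 c1
  rw [lt_false] at b1
  have hψ := mul_mem (mul_mem hα hβ) hγ
  have hsign : s⁻¹ * (α * β * γ) ∈ Aut0 Γ := by
    refine mem_Aut0_of_signs fun v => ?_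
    simp only [MulAut.mul_apply]
    by_cases hx : v = x
    · subst hx
      refine Or.inl (aut_inv_gen ?_)
      rw [c1, map_mul, b1, b2 v hne, hsx]
      simp [a2 y hne.symm]
    by_cases hy : v = y
    · subst hy
      right
      rw [c2 v hne.symm, b1]
      refine aut_inv_gen ?_
      simp [a1, a2 v hne.symm, hsy]
    · refine Or.inl (aut_inv_gen ?_)
      rw [c2 v hx, b2 v hy, a2 v hx, hsz v hx hy]
  have := mul_mem hψ (inv_mem hsign)
  rwa [mul_inv_rev, inv_inv, mul_inv_cancel_left] at this

lemma symAut_mem_of_lk [Fintype V] {σ : Γ ≃g Γ} (h : ∀ v, lk Γ (σ v) = lk Γ v) :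
    symAut σ ∈ Aut0 Γ := by
  classical
  suffices H : ∀ A : Finset V, ∀ σ : Γ ≃g Γ, (∀ v, lk Γ (σ v) = lk Γ v) → (∀ v ∉ A, σ v = v) →
      symAut σ ∈ Aut0 Γ from H Finset.univ σ h (by simp)
  intro A
  induction A using Finset.induction_on with
  | empty =>
    intro σ _ h
    rw [show symAut σ = 1 from aut_ext fun v => by
      rw [symAut_gen, h v (Finset.notMem_empty v), MulAut.one_apply]]
    exact one_mem _
  | insert x A hx ih =>
    intro σ hσ h
    by_cases hfix : σ x = x
    · refine ih σ hσ fun v hv => ?_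
      by_cases hvx : v = x
      · rw [hvx, hfix]
      · exact h v (by simp [hv, hvx])
    set s := symOfLk (Γ := Γ) (Equiv.swap x (σ x)) (swap_lk (hσ x).symm) with hs
    have h1 : symAut s ∈ Aut0 Γ := symAut_swap_mem (hσ x).symm (Ne.symm hfix)
    have h2 : symAut (s * σ) ∈ Aut0 Γ := by
      refine ih _ (fun v => (swap_lk (hσ x).symm (σ v)).trans (hσ v)) fun v hv => ?_
      change Equiv.swap x (σ x) (σ v) = v
      by_cases hvx : v = x
      · rw [hvx, Equiv.swap_apply_right]
      · have h3 : σ v = v := h v (by simp [hv, hvx])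
        rw [h3, Equiv.swap_apply_of_ne_of_ne hvx]
        intro h4
        exact hvx (σ.injective (h3.trans h4))
    rw [symAut_mul] at h2
    exact (Subgroup.mul_mem_cancel_left _ h1).1 h2

/-! ### The complement -/

/-- The action of the graph symmetries on the right-angled Artin group. -/
def symHom (Γ : SimpleGraph V) : (Γ ≃g Γ) →* MulAut (RAAG Γ) where
  toFun := symAut
  map_one' := aut_ext fun v => symAut_gen 1 v
  map_mul' := symAut_mul

lemma symHom_mem (σ : Γ ≃g Γ) : symHom Γ σ ∈ SymGrp Γ :=
  Subgroup.subset_closure ⟨σ, symAut_gen σ⟩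

lemma exists_rank (Γ : SimpleGraph V) [Fintype V] : ∃ r : V → ℕ,
    (∀ v w, lk Γ v = lk Γ w → r v = r w → v = w) ∧
    ∀ (σ : Γ ≃g Γ) (v : V), ∃ w, lk Γ w = lk Γ (σ v) ∧ r w = r v := by
  classical
  let e : ∀ c : Set V, {u // lk Γ u = c} ≃ Fin (Fintype.card {u // lk Γ u = c}) := fun c =>
    Fintype.equivFin _
  have he : ∀ c (u : {u // lk Γ u = c}), (e (lk Γ u.1) ⟨u.1, rfl⟩ : ℕ) = e c u := by
    rintro _ ⟨u, rfl⟩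
    rfl
  refine ⟨fun v => e (lk Γ v) ⟨v, rfl⟩, fun v w h h' => ?_, fun σ v => ?_⟩
  · have h1 := he _ ⟨v, h⟩
    dsimp only at h' h1
    rw [h1] at h'
    exact congrArg Subtype.val ((e _).injective (Fin.ext h'))
  · have hc : Fintype.card {u // lk Γ u = lk Γ v} = Fintype.card {u // lk Γ u = lk Γ (σ v)} := by
      refine Fintype.card_congr (σ.toEquiv.subtypeEquiv fun u => ?_)
      change _ ↔ lk Γ (σ u) = _
      rw [lk_symm, lk_symm, σ.injective.image_injective.eq_iff]
    let w := (e (lk Γ (σ v))).symm (Fin.cast hc (e (lk Γ v) ⟨v, rfl⟩))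
    refine ⟨w.1, w.2, ?_⟩
    dsimp only
    rw [he _ w, Equiv.apply_symm_apply]
    rfl

lemma exists_symmetry_factor [Fintype V] {r : V → ℕ}
    (hr : ∀ v w, lk Γ v = lk Γ w → r v = r w → v = w) {σ : Γ ≃g Γ}
    (h : ∀ v, ∃ w, lk Γ w = lk Γ (σ v) ∧ r w = r v) :
    ∃ τ ρ : Γ ≃g Γ, (∀ v, lk Γ (τ v) = lk Γ v) ∧ (∀ v, r (ρ v) = r v) ∧ σ = τ * ρ := by
  choose f hf hfr using h
  have hinj : Function.Injective f := fun v w hvw => by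
    refine hr v w ?_ (by rw [← hfr, hvw, hfr])
    have := (hf v).symm.trans ((congrArg (lk Γ) hvw).trans (hf w))
    rwa [lk_symm, lk_symm, σ.injective.image_injective.eq_iff] at this
  let ρ : Γ ≃g Γ := ⟨Equiv.ofBijective f (Finite.injective_iff_bijective.1 hinj),
    (lk_congr_adj (hf _) (hf _)).trans σ.map_adj_iff⟩
  refine ⟨σ * ρ⁻¹, ρ, fun v => ?_, hfr, by group⟩
  obtain ⟨v, rfl⟩ := ρ.surjective v
  have h1 : (σ * ρ⁻¹) (ρ v) = σ v := congrArg σ (RelIso.inv_apply_self ρ v)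
  rw [h1]
  exact (hf v).symm

lemma exists_mul_symAut [Fintype V] (hΓ : TriFree Γ)
    (hleaf : ∀ u v, Γ.Adj u v → (lk Γ u).Nontrivial ∨ (lk Γ v).Nontrivial) (φ : MulAut (RAAG Γ)) :
    ∃ σ : Γ ≃g Γ, φ * (symAut σ)⁻¹ ∈ Aut0 Γ := by
  let key : V → ℕ ×ₗ Fin (Fintype.card V) := fun v =>
    toLex ((lk Γ v).ncard, Fintype.equivFin V v)
  have hkey : Function.Injective key := fun v w h =>
    (Fintype.equivFin V).injective (congrArg (fun p => (ofLex p).2) h)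
  let : LinearOrder V := LinearOrder.lift' key hkey
  have hord : ∀ x y : V, x ≤ y → (lk Γ x).ncard ≤ (lk Γ y).ncard := fun x y h => by
    have h' : key x ≤ key y := h
    rcases Prod.Lex.le_iff.1 h' with h1 | h1
    · exact h1.le
    · exact h1.1.le
  obtain ⟨σ, α, hα, g, hg⟩ := exists_good hΓ hleaf φ
  obtain ⟨τ, hτ, h⟩ := hg.mem_Aut0 hΓ hord
  refine ⟨σ, ?_⟩
  rw [Subgroup.mul_mem_cancel_left _ (inv_mem (symAut_mem_of_lk hτ))] at h
  exact (Subgroup.mul_mem_cancel_right _ hα).1 h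

lemma triFree_of_connected (hconn : Γ.Connected) (htf : Γ.CliqueFree 3)
    (hE : 2 ≤ Γ.edgeSet.ncard) : TriFree Γ := by
  classical
  refine ⟨fun v => ?_, fun x y z hxy hyz hxz => ?_⟩
  · have hne : Γ.edgeSet.Nonempty := by
      rw [Set.nonempty_iff_ne_empty]
      intro h
      rw [h, Set.ncard_empty] at hE
      omega
    obtain ⟨⟨a, b⟩, hab⟩ := hne
    have : Nontrivial V := ⟨a, b, SimpleGraph.Adj.ne hab⟩
    exact hconn.preconnected.exists_adj_of_nontrivial v
  · exact htf {x, y, z} (SimpleGraph.is3Clique_triple_iff.2 ⟨hxy, hxz, hyz⟩)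

lemma nontrivial_lk_of_connected (hconn : Γ.Connected) (hE : 2 ≤ Γ.edgeSet.ncard) {u v : V}
    (huv : Γ.Adj u v) : (lk Γ u).Nontrivial ∨ (lk Γ v).Nontrivial := by
  by_contra! h
  have h1 : lk Γ u = {v} := h.1.eq_singleton_of_mem huv
  have h2 : lk Γ v = {u} := h.2.eq_singleton_of_mem huv.symm
  have hstep : ∀ x y, Γ.Adj x y → x = u ∨ x = v → y = u ∨ y = v := by
    rintro x y hxy (rfl | rfl)
    · exact Or.inr (h1 ▸ hxy : y ∈ ({v} : Set V))
    · exact Or.inl (h2 ▸ hxy : y ∈ ({u} : Set V))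
  have hall : ∀ y, y = u ∨ y = v := fun y => by
    obtain ⟨p⟩ := hconn.preconnected u y
    have : ∀ {x y : V} (p : Γ.Walk x y), x = u ∨ x = v → y = u ∨ y = v := by
      intro x y p
      induction p with
      | nil => exact id
      | cons hxy _ ih => exact fun hx => ih (hstep _ _ hxy hx)
    exact this p (Or.inl rfl)
  have hsub : Γ.edgeSet ⊆ {s(u, v)} := by
    rintro ⟨a, b⟩ hab
    have hne : a ≠ b := SimpleGraph.Adj.ne hab
    change s(a, b) = s(u, v)
    rcases hall a with rfl | rfl <;> rcases hall b with rfl | rfl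
    · exact absurd rfl hne
    · rfl
    · exact Sym2.eq_swap
    · exact absurd rfl hne
  have := Set.ncard_le_ncard hsub
  rw [Set.ncard_singleton] at this
  omega

lemma isComplement'_of_factor {G : Type*} [Group G] {A H : Subgroup G}
    (hd : ∀ g ∈ A, g ∈ H → g = 1) (hm : ∀ g, ∃ a ∈ A, ∃ h ∈ H, g = a * h) :
    A.IsComplement' H := by
  refine Subgroup.isComplement'_of_disjoint_and_mul_eq_univ
    (Subgroup.disjoint_def.2 fun h h' => hd _ h h') (Set.eq_univ_of_forall fun g => ?_)
  obtain ⟨a, ha, h, hh, rfl⟩ := hm g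
  exact Set.mul_mem_mul ha hh

end

end RaagSplit

open RaagSplit in
/-- The quotient maps from `Aut(A_Γ)`, `Out(A_Γ)` and `Sym(Γ)` onto
`Q(Γ) = Sym(Γ)/Sym⁰(Γ) ≅ Aut(A_Γ)/Aut⁰(A_Γ) ≅ Out(A_Γ)/Out⁰(A_Γ)` all split:
there is a common complement `H ≤ Sym(Γ)` of `Aut⁰(A_Γ)` in `Aut(A_Γ)`, which is
also a complement of `Sym⁰(Γ)` in `Sym(Γ)`, and whose image in `Out(A_Γ)` is a
complement of `Out⁰(A_Γ)`. -/
theorem quotient_by_pure_splits {V : Type*} [Fintype V] (Γ : SimpleGraph V)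
    (hconn : Γ.Connected) (htf : Γ.CliqueFree 3) (hE : 2 ≤ Γ.edgeSet.ncard) :
    ∃ H : Subgroup (MulAut (RAAG Γ)), H ≤ SymGrp Γ ∧
      (Aut0 Γ).IsComplement' H ∧
      ((Sym0 Γ).subgroupOf (SymGrp Γ)).IsComplement' (H.subgroupOf (SymGrp Γ)) ∧
      (Out0 Γ).IsComplement' (H.map (QuotientGroup.mk' (Inn (RAAG Γ)))) := by
  have hΓ := triFree_of_connected hconn htf hE
  have hleaf := fun u v (h : Γ.Adj u v) => nontrivial_lk_of_connected hconn hE h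
  obtain ⟨r, hr, hrank⟩ := exists_rank Γ
  let H₀ : Subgroup (Γ ≃g Γ) :=
    { carrier := {ρ | ∀ v, r (ρ v) = r v}
      one_mem' := fun _ => rfl
      mul_mem' := fun {a b} ha hb v => (ha (b v)).trans (hb v)
      inv_mem' := fun {a} ha v => by
        rw [← ha, RelIso.apply_inv_self] }
  have hH : H₀.map (symHom Γ) ≤ SymGrp Γ := by
    rintro _ ⟨ρ, -, rfl⟩
    exact symHom_mem ρ
  have hd : ∀ g ∈ Aut0 Γ, g ∈ H₀.map (symHom Γ) → g = 1 := by
    rintro _ hg ⟨ρ, hρ, rfl⟩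
    have : ρ = 1 := RelIso.ext fun v => hr _ _ (lk_eq_of_symAut_mem hΓ hleaf hg v) (hρ v)
    rw [this, map_one]
  have hm : ∀ g, ∃ a ∈ Aut0 Γ, ∃ h ∈ H₀.map (symHom Γ), g = a * h := by
    intro g
    obtain ⟨σ, hσ⟩ := exists_mul_symAut hΓ hleaf g
    obtain ⟨τ, ρ, hτ, hρ, rfl⟩ := exists_symmetry_factor hr (hrank σ)
    refine ⟨g * (symAut (τ * ρ))⁻¹ * symAut τ, mul_mem hσ (symAut_mem_of_lk hτ), symHom Γ ρ,
      Subgroup.mem_map_of_mem _ hρ, ?_⟩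
    change g = g * (symAut (τ * ρ))⁻¹ * symAut τ * symAut ρ
    rw [symAut_mul]
    group
  refine ⟨H₀.map (symHom Γ), hH, isComplement'_of_factor hd hm,
    isComplement'_of_factor (fun g hg hg' => ?_) fun g => ?_,
    isComplement'_of_factor (fun g hg hg' => ?_) fun g => ?_⟩
  · rw [Subgroup.mem_subgroupOf] at hg hg'
    exact Subtype.ext (hd _ hg.2 hg')
  · obtain ⟨a, ha, h, hh, e⟩ := hm g
    have ha' : a ∈ SymGrp Γ := by
      rw [← Subgroup.mul_mem_cancel_right _ (hH hh), ← e]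
      exact g.2
    exact ⟨⟨a, ha'⟩, Subgroup.mem_subgroupOf.2 ⟨ha', ha⟩, ⟨h, hH hh⟩,
      Subgroup.mem_subgroupOf.2 hh, Subtype.ext e⟩
  · obtain ⟨a, ha, rfl⟩ := hg
    obtain ⟨h, hh, e⟩ := hg'
    have h1 : a⁻¹ * h ∈ Inn (RAAG Γ) := QuotientGroup.eq.1 e.symm
    have h2 : h ∈ Aut0 Γ := (Subgroup.mul_mem_cancel_left _ (inv_mem ha)).1 (Inn_le_Aut0 h1)
    rw [← e, hd h h2 hh, map_one]
  · obtain ⟨g, rfl⟩ := QuotientGroup.mk'_surjective _ g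
    obtain ⟨a, ha, h, hh, rfl⟩ := hm g
    exact ⟨_, Subgroup.mem_map_of_mem _ ha, _, Subgroup.mem_map_of_mem _ hh, map_mul _ _ _⟩

end
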